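/- Fix an integer p ≥ 1. There exists a density one subsequence S'⊆S and a constant C=C(p)>0 such that for every λ∈S' and every flat, L²-normalized toral eigenfunction f with eigenvalue λ: ∫_{𝕋²} |log |f(x)||^p dx ≤ C. -/

import Mathlib

open MeasureTheory Filter Topology Complex
open scoped ENNReal NNReal RealInnerProductSpace

noncomputable section

/-- The Euclidean plane `ℝ²`; the torus `𝕋² = ℝ²/ℤ²` is modeled by `ℤ²`-periodic
functions on `E2` (toral eigenfunctions are automatically periodic), the fundamental
domain `Tdom`, and Euclidean balls of radius at most `1/2`. -/
abbrev E2 := EuclideanSpace ℝ (Fin 2)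

/-- The point `(a, b) ∈ ℝ²`. -/
def pt (a b : ℝ) : E2 := (WithLp.equiv 2 (Fin 2 → ℝ)).symm ![a, b]

/-- `S`: the set of positive integers expressible as a sum of two squares. -/
def sumTwoSq : Set ℕ := {n | 0 < n ∧ ∃ a b : ℤ, (n : ℤ) = a ^ 2 + b ^ 2}

/-- `S' ⊆ S` is a density one subsequence of `S`. -/
def DensityOne (S' : Set ℕ) : Prop :=
  S' ⊆ sumTwoSq ∧
    Tendsto
      (fun X : ℕ =>
        (Nat.card {n : ℕ | n ∈ S' ∧ n ≤ X} : ℝ) /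
          (Nat.card {n : ℕ | n ∈ sumTwoSq ∧ n ≤ X} : ℝ))
      atTop (𝓝 1)

/-- The lattice points `ξ ∈ ℤ²` with `|ξ|² = lam`. -/
def latticePts (lam : ℕ) : Finset (ℤ × ℤ) :=
  ((Finset.Icc (-(lam : ℤ)) lam) ×ˢ (Finset.Icc (-(lam : ℤ)) lam)).filter
    fun ξ => ξ.1 ^ 2 + ξ.2 ^ 2 = (lam : ℤ)

/-- `f` is a real-valued `L²`-normalized toral eigenfunction with eigenvalue `lam` and
Fourier coefficients `a`: `f(x) = Σ_{|ξ|²=lam} a_ξ e(⟨ξ,x⟩)`, `a_{-ξ} = conj a_ξ`,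
`Σ |a_ξ|² = 1`. -/
def IsEigenfunction (lam : ℕ) (a : ℤ × ℤ → ℂ) (f : E2 → ℝ) : Prop :=
  (∀ ξ : ℤ × ℤ, ξ ∉ latticePts lam → a ξ = 0) ∧
    (∀ ξ : ℤ × ℤ, a (-ξ) = starRingEnd ℂ (a ξ)) ∧
    (∑ ξ ∈ latticePts lam, ‖a ξ‖ ^ 2 = 1) ∧
    ∀ x : E2, (f x : ℂ) =
      ∑ ξ ∈ latticePts lam,
        a ξ * Complex.exp (2 * (Real.pi : ℂ) * Complex.I *
          ((((ξ.1 : ℝ) * x 0 + (ξ.2 : ℝ) * x 1 : ℝ)) : ℂ))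

/-- Flatness: `|a_ξ|² ≤ 100 N^{-1+ε}` for every `ε > 0`. -/
def IsFlat (lam : ℕ) (a : ℤ × ℤ → ℂ) : Prop :=
  ∀ ε : ℝ, 0 < ε → ∀ ξ ∈ latticePts lam,
    ‖a ξ‖ ^ 2 ≤ 100 * ((latticePts lam).card : ℝ) ^ (-1 + ε : ℝ)

/-- A fundamental domain `[0,1]²` for the torus `𝕋²`. -/
def Tdom : Set E2 := {x | x 0 ∈ Set.Icc (0 : ℝ) 1 ∧ x 1 ∈ Set.Icc (0 : ℝ) 1}

/-- The square `[-1/2,1/2]²`. -/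
def Qdom : Set E2 := {y | y 0 ∈ Set.Icc (-(1/2) : ℝ) (1/2) ∧ y 1 ∈ Set.Icc (-(1/2) : ℝ) (1/2)}

/-- `L(f, B)`: the `1`-dimensional Hausdorff measure of the nodal set of `f` in `B`. -/
def nodalLen (f : E2 → ℝ) (B : Set E2) : ℝ := (μH[1] ({x : E2 | f x = 0} ∩ B)).toReal

/-- `L(F_x)` where `F_x(y) = f(x + R y / √lam)` for `y ∈ [-1/2,1/2]²`, as an
extended nonnegative real. -/
def LF (lam : ℕ) (R : ℝ) (f : E2 → ℝ) (x : E2) : ℝ≥0∞ :=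
  μH[1] {y : E2 | y ∈ Qdom ∧ f (x + (R / Real.sqrt lam) • y) = 0}

/-- The pseudo-spectral measure `µ_f = Σ_ξ |a_ξ|² δ_{ξ/√lam}` on `S¹ ⊂ ℝ²`. -/
def specMeasure (lam : ℕ) (a : ℤ × ℤ → ℂ) : Measure E2 :=
  ∑ ξ ∈ latticePts lam,
    (ENNReal.ofReal (‖a ξ‖ ^ 2)) •
      Measure.dirac (pt ((ξ.1 : ℝ) / Real.sqrt lam) ((ξ.2 : ℝ) / Real.sqrt lam))

/-- Weak-star convergence of the pseudo-spectral measures of the sequence `a` to `mu`,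
along `λ → ∞`, `λ ∈ S'`. -/
def SpecTendsto (S' : Set ℕ) (a : ℕ → ℤ × ℤ → ℂ) (mu : Measure E2) : Prop :=
  ∀ g : BoundedContinuousFunction E2 ℝ,
    Tendsto (fun lam => ∫ z, g z ∂(specMeasure lam (a lam))) (atTop ⊓ 𝓟 S')
      (𝓝 (∫ z, g z ∂mu))

/-- The support of `mu` is not contained in a line. -/
def NotOnLine (mu : Measure E2) : Prop :=
  ∀ A B c : ℝ, ¬(A = 0 ∧ B = 0) → mu {x : E2 | A * x 0 + B * x 1 = c} < 1

/-- `µ̂(2) = ∫_{S¹} z² dµ(z)`, identifying `S¹ ⊂ ℂ`. -/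
def muhat2 (mu : Measure E2) : ℂ := ∫ x, ((x 0 : ℂ) + (x 1 : ℂ) * Complex.I) ^ 2 ∂mu

/-- The constant `c₁ = (1-µ̂(2)²)/(2^{5/2}π) ∫₀^{2π} (1-µ̂(2)cos 2θ)^{-3/2} dθ`
(for `µ̂(2)` real). -/
def c1const (mu : Measure E2) : ℝ :=
  ((1 - (muhat2 mu).re ^ 2) / (2 ^ ((5:ℝ)/2) * Real.pi)) *
    ∫ θ in (0:ℝ)..(2 * Real.pi), ((1 - (muhat2 mu).re * Real.cos (2 * θ)) ^ (-(3/2) : ℝ))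

/-- The nontrivial Dirichlet character mod `4`, with real values. -/
def chi (n : ℕ) : ℝ := (ZMod.χ₄ n : ℤ)

lemma chi_eq (n : ℕ) : chi n = if n % 2 = 0 then 0 else if n % 4 = 1 then 1 else -1 := by
  rw [chi, ZMod.χ₄_nat_eq_if_mod_four]
  split_ifs <;> simp

lemma chi_mul (m n : ℕ) : chi (m * n) = chi m * chi n := by
  simp only [chi, Nat.cast_mul, map_mul, Int.cast_mul]

lemma abs_chi_le (n : ℕ) : |chi n| ≤ 1 := by
  rw [chi_eq]; split_ifs <;> simp

lemma sum_Ioc_chi (N : ℕ) :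
    ∑ n ∈ Finset.Ioc 0 N, chi n = if N % 4 = 1 ∨ N % 4 = 2 then 1 else 0 := by
  induction N with
  | zero => simp
  | succ N ih =>
    rw [Finset.sum_Ioc_succ_top (by omega), ih, chi_eq]
    have : N % 4 = 0 ∨ N % 4 = 1 ∨ N % 4 = 2 ∨ N % 4 = 3 := by omega
    rcases this with h | h | h | h <;>
      simp [h, show (N + 1) % 4 = (N % 4 + 1) % 4 by omega,
        show (N + 1) % 2 = (N % 4 + 1) % 2 by omega]

lemma abs_sum_chi_mul_le {f : ℕ → ℝ} {m : ℕ} (hf : ∀ n, m < n → f (n + 1) ≤ f n)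
    (h0 : ∀ n, m < n → 0 ≤ f n) (N : ℕ) (hN : m ≤ N) :
    |∑ n ∈ Finset.Ioc m N, chi n * f n| ≤ f (m + 1) := by
  set X : ℕ → ℝ := fun N => ∑ n ∈ Finset.Ioc 0 N, chi n with hX
  have hX01 : ∀ n, 0 ≤ X n ∧ X n ≤ 1 := by
    intro n
    simp only [hX, sum_Ioc_chi]
    split_ifs <;> simp
  have hstep : ∀ n, X (n + 1) = X n + chi (n + 1) := by
    intro n
    simp only [hX]
    rw [Finset.sum_Ioc_succ_top (by omega)]
  rcases Nat.eq_or_lt_of_le hN with rfl | hlt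
  · simpa using h0 _ (Nat.lt_succ_self _)
  have key : ∀ N, m + 1 ≤ N →
      -(X m * f (m + 1)) ≤ ∑ n ∈ Finset.Ioc m N, chi n * f n - X N * f N ∧
      ∑ n ∈ Finset.Ioc m N, chi n * f n - X N * f N ≤ f (m + 1) - f N - X m * f (m + 1) := by
    intro N hN
    induction N, hN using Nat.le_induction with
    | base =>
      rw [Finset.sum_Ioc_succ_top (by omega)]
      simp only [Finset.Ioc_self, Finset.sum_empty, hstep]
      constructor <;> nlinarith
    | succ N hN ih =>
      rw [Finset.sum_Ioc_succ_top (by omega), hstep]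
      have h1 := hf N (by omega)
      have h2 := hX01 N
      have : 0 ≤ X N * (f N - f (N + 1)) := mul_nonneg h2.1 (by linarith)
      have : X N * (f N - f (N + 1)) ≤ 1 * (f N - f (N + 1)) :=
        mul_le_mul_of_nonneg_right h2.2 (by linarith)
      constructor <;> nlinarith
  obtain ⟨k1, k2⟩ := key N hlt
  have a1 := hX01 m
  have a2 := hX01 N
  have f1 := h0 (m + 1) (by omega)
  have f2 := h0 N hlt
  have b1 := mul_le_mul_of_nonneg_right a1.2 f1
  have b2 := mul_le_mul_of_nonneg_right a2.2 f2
  have b3 := mul_nonneg a1.1 f1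
  have b4 := mul_nonneg a2.1 f2
  rw [abs_le]
  constructor <;> linarith

lemma sum_Ioc_sum_divisors (g : ℕ → ℕ → ℝ) (N : ℕ) :
    ∑ n ∈ Finset.Ioc 0 N, ∑ d ∈ n.divisors, g d (n / d) =
      ∑ d ∈ Finset.Ioc 0 N, ∑ m ∈ Finset.Ioc 0 (N / d), g d m := by
  rw [Finset.sum_sigma', Finset.sum_sigma']
  refine Finset.sum_bij' (fun x _ => ⟨x.2, x.1 / x.2⟩) (fun y _ => ⟨y.1 * y.2, y.1⟩) ?_ ?_ ?_ ?_ ?_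
  · rintro ⟨n, d⟩ h
    simp only [Finset.mem_sigma, Finset.mem_Ioc, Nat.mem_divisors] at h ⊢
    obtain ⟨⟨h1, h2⟩, h3, h4⟩ := h
    have hd := Nat.pos_of_dvd_of_pos h3 h1
    have := Nat.le_of_dvd h1 h3
    exact ⟨⟨hd, by omega⟩, Nat.div_pos this hd, Nat.div_le_div_right h2⟩
  · rintro ⟨d, m⟩ h
    simp only [Finset.mem_sigma, Finset.mem_Ioc, Nat.mem_divisors] at h ⊢
    obtain ⟨⟨h1, h2⟩, h3, h4⟩ := h
    refine ⟨⟨Nat.mul_pos h1 h3, ?_⟩, dvd_mul_right _ _, (Nat.mul_pos h1 h3).ne'⟩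
    rw [mul_comm]
    exact (Nat.le_div_iff_mul_le h1).1 h4
  · rintro ⟨n, d⟩ h
    simp only [Finset.mem_sigma, Finset.mem_Ioc, Nat.mem_divisors] at h ⊢
    obtain ⟨⟨h1, h2⟩, h3, h4⟩ := h
    rw [Nat.mul_div_cancel' h3]
  · rintro ⟨d, m⟩ h
    simp only [Finset.mem_sigma, Finset.mem_Ioc] at h ⊢
    rw [Nat.mul_div_cancel_left _ h.1.1]
  · rintro ⟨n, d⟩ h
    rfl

section PrimeSums

open scoped ArithmeticFunction.vonMangoldt

lemma sum_vonMangoldt_le (N : ℕ) : ∑ n ∈ Finset.Ioc 0 N, Λ n ≤ 6 * N := by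
  have h := Chebyshev.psi_le_const_mul_self (x := N) (by positivity)
  simp only [Chebyshev.psi, Nat.floor_natCast] at h
  have : Real.log 4 ≤ 2 := by
    rw [Real.log_le_iff_le_exp (by norm_num)]
    have := Real.add_one_le_exp (1 : ℝ)
    have h2 : Real.exp 2 = Real.exp 1 * Real.exp 1 := by rw [← Real.exp_add]; norm_num
    nlinarith
  refine h.trans ?_
  gcongr
  linarith

/-- `∑_{n ≤ N} Λ(n)/n ≤ log N + 6`. -/
lemma sum_vonMangoldt_div_le (N : ℕ) (hN : 1 ≤ N) :
    ∑ n ∈ Finset.Ioc 0 N, Λ n / n ≤ Real.log N + 6 := by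
  have hN' : (0 : ℝ) < N := by positivity
  have h1 : ∑ n ∈ Finset.Ioc 0 N, Real.log n = ∑ d ∈ Finset.Ioc 0 N, Λ d * (N / d : ℕ) := by
    have := sum_Ioc_sum_divisors (fun d _ => Λ d) N
    simp only [ArithmeticFunction.vonMangoldt_sum, Finset.sum_const, Nat.card_Ioc] at this
    rw [this]
    refine Finset.sum_congr rfl fun d _ => ?_
    simp [mul_comm]
  have h2 : ∑ n ∈ Finset.Ioc 0 N, Real.log n ≤ N * Real.log N := by
    calc _ ≤ ∑ n ∈ Finset.Ioc 0 N, Real.log N := by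
          refine Finset.sum_le_sum fun n hn => ?_
          rw [Finset.mem_Ioc] at hn
          exact Real.log_le_log (by exact_mod_cast hn.1) (by exact_mod_cast hn.2)
      _ = _ := by simp
  have h3 : ∑ d ∈ Finset.Ioc 0 N, Λ d * ((N : ℝ) / d - 1) ≤
      ∑ d ∈ Finset.Ioc 0 N, Λ d * (N / d : ℕ) := by
    refine Finset.sum_le_sum fun d hd => ?_
    refine mul_le_mul_of_nonneg_left ?_ ArithmeticFunction.vonMangoldt_nonneg
    have := Nat.lt_floor_add_one ((N : ℝ) / d)
    rw [Nat.floor_div_eq_div] at this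
    linarith
  have h4 : ∑ d ∈ Finset.Ioc 0 N, Λ d * ((N : ℝ) / d - 1) =
      N * ∑ n ∈ Finset.Ioc 0 N, Λ n / n - ∑ n ∈ Finset.Ioc 0 N, Λ n := by
    rw [Finset.mul_sum, ← Finset.sum_sub_distrib]
    refine Finset.sum_congr rfl fun d _ => ?_
    ring
  have h5 := sum_vonMangoldt_le N
  have : N * ∑ n ∈ Finset.Ioc 0 N, Λ n / n ≤ N * (Real.log N + 6) := by
    rw [mul_add]
    linarith
  exact le_of_mul_le_mul_left this hN'

lemma log_factorial_ge (N : ℕ) (hN : 1 ≤ N) :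
    N * Real.log N - N ≤ ∑ n ∈ Finset.Ioc 0 N, Real.log n := by
  induction N, hN using Nat.le_induction with
  | base => simp
  | succ N hN ih =>
    rw [Finset.sum_Ioc_succ_top (by omega)]
    have hN' : (0 : ℝ) < N := by positivity
    have h : Real.log (N + 1) ≤ Real.log N + 1 / N := by
      have := Real.log_le_sub_one_of_pos (x := (N + 1 : ℝ) / N) (by positivity)
      rw [Real.log_div (by positivity) (by positivity)] at this
      have e : (N + 1 : ℝ) / N - 1 = 1 / N := by field_simp; ring
      linarith
    have := mul_le_mul_of_nonneg_left h hN'.le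
    rw [mul_add, mul_one_div_cancel hN'.ne'] at this
    push_cast
    linarith

/-- `log N - 1 ≤ ∑_{n ≤ N} Λ(n)/n`. -/
lemma le_sum_vonMangoldt_div (N : ℕ) (hN : 1 ≤ N) :
    Real.log N - 1 ≤ ∑ n ∈ Finset.Ioc 0 N, Λ n / n := by
  have hN' : (0 : ℝ) < N := by positivity
  have h1 : ∑ n ∈ Finset.Ioc 0 N, Real.log n = ∑ d ∈ Finset.Ioc 0 N, Λ d * (N / d : ℕ) := by
    have := sum_Ioc_sum_divisors (fun d _ => Λ d) N
    simp only [ArithmeticFunction.vonMangoldt_sum, Finset.sum_const, Nat.card_Ioc] at this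
    rw [this]
    refine Finset.sum_congr rfl fun d _ => ?_
    simp [mul_comm]
  have h2 := log_factorial_ge N hN
  have h3 : ∑ d ∈ Finset.Ioc 0 N, Λ d * (N / d : ℕ) ≤ N * ∑ n ∈ Finset.Ioc 0 N, Λ n / n := by
    rw [Finset.mul_sum]
    refine Finset.sum_le_sum fun d hd => ?_
    have : ((N / d : ℕ) : ℝ) ≤ N / d := Nat.cast_div_le
    calc _ ≤ Λ d * ((N : ℝ) / d) :=
          mul_le_mul_of_nonneg_left this ArithmeticFunction.vonMangoldt_nonneg
      _ = _ := by ring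
  have : N * (Real.log N - 1) ≤ N * ∑ n ∈ Finset.Ioc 0 N, Λ n / n := by
    rw [mul_sub]; linarith
  exact le_of_mul_le_mul_left this hN'

lemma log_div_antitone_nat (n : ℕ) (hn : 2 < n) :
    Real.log ((n + 1 : ℕ) : ℝ) / ((n + 1 : ℕ) : ℝ) ≤ Real.log n / n := by
  have e3 : Real.exp 1 ≤ 3 := by have := Real.exp_one_lt_d9; linarith
  have h3 : (3 : ℝ) ≤ n := by exact_mod_cast hn
  exact Real.log_div_self_antitoneOn (show Real.exp 1 ≤ _ by linarith)
    (show Real.exp 1 ≤ _ by push_cast; linarith) (by push_cast; linarith)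

lemma abs_sum_chi_log_div_le (N : ℕ) :
    |∑ n ∈ Finset.Ioc 0 N, chi n * (Real.log n / n)| ≤ 1 := by
  rcases le_or_gt N 2 with h | h
  · interval_cases N <;> simp [Finset.sum_Ioc_succ_top, chi_eq]
  have h1 : ∑ n ∈ Finset.Ioc 0 N, chi n * (Real.log n / n) =
      ∑ n ∈ Finset.Ioc 2 N, chi n * (Real.log n / n) := by
    rw [← Finset.sum_Ioc_consecutive _ (Nat.zero_le 2) h.le]
    simp [Finset.sum_Ioc_succ_top, chi_eq]
  rw [h1]
  have := abs_sum_chi_mul_le (f := fun n => Real.log n / n) (m := 2)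
    (fun n hn => log_div_antitone_nat n hn) (fun n hn => by positivity) N h.le
  refine this.trans ?_
  have := Real.log_le_sub_one_of_pos (x := 3) (by norm_num)
  norm_num
  linarith

lemma abs_sum_chi_div_sub_le (m N : ℕ) (h : m ≤ N) :
    |∑ n ∈ Finset.Ioc 0 N, chi n / n - ∑ n ∈ Finset.Ioc 0 m, chi n / n| ≤ 1 / (m + 1) := by
  rw [← Finset.sum_Ioc_consecutive _ (Nat.zero_le m) h, add_sub_cancel_left]
  have := abs_sum_chi_mul_le (f := fun n => 1 / (n : ℝ)) (m := m)
    (fun n hn => by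
      have : (0 : ℝ) < n := by exact_mod_cast (by omega : 0 < n)
      push_cast
      exact one_div_le_one_div_of_le this (by linarith)) (fun n hn => by positivity) N h
  simpa [div_eq_mul_inv] using this

lemma two_thirds_le_sum_chi_div (N : ℕ) (hN : 1 ≤ N) :
    2 / 3 ≤ ∑ n ∈ Finset.Ioc 0 N, chi n / n := by
  rcases le_or_gt N 2 with h | h
  · interval_cases N <;> simp [Finset.sum_Ioc_succ_top, chi_eq] <;> norm_num
  have := abs_sum_chi_div_sub_le 2 N h.le
  rw [abs_le] at this
  have e : ∑ n ∈ Finset.Ioc 0 2, chi n / n = 1 := by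
    simp [Finset.sum_Ioc_succ_top, chi_eq]
  rw [e] at this
  push_cast at this
  linarith [this.1]

/-- Mertens' estimate for the character mod `4`. -/
lemma abs_sum_chi_vonMangoldt_div_le (N : ℕ) (hN : 1 ≤ N) :
    |∑ n ∈ Finset.Ioc 0 N, chi n * (Λ n / n)| ≤ 12 := by
  have hN' : (0 : ℝ) < N := by positivity
  set c : ℕ → ℝ := fun M => ∑ n ∈ Finset.Ioc 0 M, chi n / n with hc
  have h1 : ∑ n ∈ Finset.Ioc 0 N, chi n * (Real.log n / n) =
      ∑ d ∈ Finset.Ioc 0 N, chi d * (Λ d / d) * c (N / d) := by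
    have := sum_Ioc_sum_divisors (fun d m => chi d * (Λ d / d) * (chi m / m)) N
    simp only [← Finset.mul_sum] at this
    rw [← this]
    refine Finset.sum_congr rfl fun n hn => ?_
    rw [Finset.mem_Ioc] at hn
    rw [← ArithmeticFunction.vonMangoldt_sum, Finset.sum_div, Finset.mul_sum]
    refine Finset.sum_congr rfl fun d hd => ?_
    have hdn := Nat.dvd_of_mem_divisors hd
    obtain ⟨m, rfl⟩ := hdn
    have hd0 : 0 < d := Nat.pos_of_mem_divisors hd
    rw [Nat.mul_div_cancel_left _ hd0, chi_mul]
    push_cast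
    field_simp
  have h2 : |∑ d ∈ Finset.Ioc 0 N, chi d * (Λ d / d) * (c N - c (N / d))| ≤ 6 := by
    calc _ ≤ ∑ d ∈ Finset.Ioc 0 N, |chi d * (Λ d / d) * (c N - c (N / d))| :=
          Finset.abs_sum_le_sum_abs _ _
      _ ≤ ∑ d ∈ Finset.Ioc 0 N, Λ d / N := by
          refine Finset.sum_le_sum fun d hd => ?_
          rw [Finset.mem_Ioc] at hd
          have hd0 : (0 : ℝ) < d := by exact_mod_cast hd.1
          rw [abs_mul, abs_mul]
          have a1 := abs_chi_le d
          have a2 : |Λ d / d| = Λ d / d :=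
            abs_of_nonneg (div_nonneg ArithmeticFunction.vonMangoldt_nonneg hd0.le)
          have a3 := abs_sum_chi_div_sub_le (N / d) N (Nat.div_le_self _ _)
          have a4 : (1 : ℝ) / ((N / d : ℕ) + 1) ≤ d / N := by
            rw [div_le_div_iff₀ (by positivity) hN', one_mul]
            have := Nat.lt_floor_add_one ((N : ℝ) / d)
            rw [Nat.floor_div_eq_div, div_lt_iff₀ hd0] at this
            linarith
          rw [a2]
          have hL : 0 ≤ Λ d / d := div_nonneg ArithmeticFunction.vonMangoldt_nonneg hd0.le
          calc |chi d| * (Λ d / d) * |c N - c (N / d)| ≤ 1 * (Λ d / d) * (d / N) := by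
                gcongr
                exact a3.trans a4
            _ = _ := by field_simp
      _ = (∑ d ∈ Finset.Ioc 0 N, Λ d) / N := by rw [Finset.sum_div]
      _ ≤ 6 := by
          rw [div_le_iff₀ hN']
          exact sum_vonMangoldt_le N
  have h3 : c N * ∑ n ∈ Finset.Ioc 0 N, chi n * (Λ n / n) =
      ∑ n ∈ Finset.Ioc 0 N, chi n * (Real.log n / n) +
      ∑ d ∈ Finset.Ioc 0 N, chi d * (Λ d / d) * (c N - c (N / d)) := by
    rw [h1, ← Finset.sum_add_distrib, Finset.mul_sum]
    refine Finset.sum_congr rfl fun d _ => ?_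
    ring
  have h4 : |c N * ∑ n ∈ Finset.Ioc 0 N, chi n * (Λ n / n)| ≤ 7 := by
    rw [h3]
    refine (abs_add_le _ _).trans ?_
    have := abs_sum_chi_log_div_le N
    linarith
  have h5 := two_thirds_le_sum_chi_div N hN
  rw [abs_mul, abs_of_nonneg (by linarith : 0 ≤ c N)] at h4
  have h6 : 2 / 3 * |∑ n ∈ Finset.Ioc 0 N, chi n * (Λ n / n)| ≤ 7 :=
    (mul_le_mul_of_nonneg_right h5 (abs_nonneg _)).trans h4
  linarith

end PrimeSums

section ChebyshevProgression

open scoped ArithmeticFunction.vonMangoldt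

/-- Partial summation against the weight `1 / log n`. -/
lemma sum_div_log_le {a : ℕ → ℝ} {κ C : ℝ} (hκ : 0 ≤ κ)
    (hs : ∀ N : ℕ, 2 ≤ N → ∑ n ∈ Finset.Ioc 1 N, a n ≤ κ * Real.log N + C) (N : ℕ) (hN : 2 ≤ N) :
    ∑ n ∈ Finset.Ioc 1 N, a n / Real.log n ≤
      κ * Real.log (Real.log N) + (C / Real.log 2 + κ - κ * Real.log (Real.log 2)) := by
  have hl : ∀ n : ℕ, 2 ≤ n → 0 < Real.log n := fun n hn =>
    Real.log_pos (by exact_mod_cast (by omega : 1 < n))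
  suffices h : ∑ n ∈ Finset.Ioc 1 N, a n / Real.log n +
      (κ * Real.log N + C - ∑ n ∈ Finset.Ioc 1 N, a n) / Real.log N ≤
      κ * Real.log (Real.log N) + (C / Real.log 2 + κ - κ * Real.log (Real.log 2)) by
    have := div_nonneg (sub_nonneg.2 (hs N hN)) (hl N hN).le
    linarith
  induction N, hN using Nat.le_induction with
  | base =>
    have := hl 2 le_rfl
    simp only [Finset.sum_Ioc_succ_top (show 1 ≤ 1 from le_rfl), Finset.Ioc_self,
      Finset.sum_empty, zero_add, Nat.reduceAdd]
    push_cast at this ⊢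
    apply le_of_eq
    field_simp
    ring
  | succ N hN ih =>
    rw [Finset.sum_Ioc_succ_top (by omega), Finset.sum_Ioc_succ_top (by omega)]
    have l1 := hl N hN
    have l2 := hl (N + 1) (by omega)
    set T := ∑ n ∈ Finset.Ioc 1 N, a n / Real.log n
    set s := ∑ n ∈ Finset.Ioc 1 N, a n
    have h12 : Real.log N ≤ Real.log (N + 1 : ℕ) :=
      Real.log_le_log (by exact_mod_cast (by omega : 0 < N)) (by push_cast; linarith)
    have hD : 0 ≤ κ * Real.log N + C - s := sub_nonneg.2 (hs N hN)
    have e1 : T + a (N + 1) / Real.log (N + 1 : ℕ) +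
        (κ * Real.log (N + 1 : ℕ) + C - (s + a (N + 1))) / Real.log (N + 1 : ℕ) =
        T + (κ * Real.log N + C - s) / Real.log (N + 1 : ℕ) +
        κ * (1 - Real.log N / Real.log (N + 1 : ℕ)) := by
      field_simp
      ring
    have e2 : (κ * Real.log N + C - s) / Real.log (N + 1 : ℕ) ≤
        (κ * Real.log N + C - s) / Real.log N := by gcongr
    have e3 : 1 - Real.log N / Real.log (N + 1 : ℕ) ≤
        Real.log (Real.log (N + 1 : ℕ)) - Real.log (Real.log N) := by
      have := Real.log_le_sub_one_of_pos (x := Real.log N / Real.log (N + 1 : ℕ)) (by positivity)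
      rw [Real.log_div l1.ne' l2.ne'] at this
      linarith
    rw [e1]
    have := mul_le_mul_of_nonneg_left e3 hκ
    rw [mul_sub] at this
    linarith

lemma sum_residue_le (N : ℕ) (hN : 1 ≤ N) (s : ℝ) (hs : |s| ≤ 1) :
    ∑ n ∈ Finset.Ioc 0 N, (1 + s * chi n) / 2 * (Λ n / n) ≤ 1 / 2 * Real.log N + 9 := by
  have h1 := sum_vonMangoldt_div_le N hN
  have h2 := abs_sum_chi_vonMangoldt_div_le N hN
  have e : ∑ n ∈ Finset.Ioc 0 N, (1 + s * chi n) / 2 * (Λ n / n) =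
      1 / 2 * ∑ n ∈ Finset.Ioc 0 N, Λ n / n +
      1 / 2 * (s * ∑ n ∈ Finset.Ioc 0 N, chi n * (Λ n / n)) := by
    rw [Finset.mul_sum, Finset.mul_sum, Finset.mul_sum, ← Finset.sum_add_distrib]
    refine Finset.sum_congr rfl fun d _ => ?_
    ring
  rw [e]
  have h3 : s * ∑ n ∈ Finset.Ioc 0 N, chi n * (Λ n / n) ≤ 12 := by
    refine (le_abs_self _).trans ?_
    rw [abs_mul]
    nlinarith [abs_nonneg s, abs_nonneg (∑ n ∈ Finset.Ioc 0 N, chi n * (Λ n / n))]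
  linarith

lemma exists_sum_inv_prime_residue_le (r : ℕ) (hr : r = 1 ∨ r = 3) :
    ∃ C : ℝ, ∀ N : ℕ, 2 ≤ N →
      ∑ p ∈ Finset.Ioc 0 N with p.Prime ∧ p % 4 = r, (1 : ℝ) / p ≤
        1 / 2 * Real.log (Real.log N) + C := by
  classical
  set s : ℝ := if r = 1 then 1 else -1 with hs
  have hs1 : |s| ≤ 1 := by rw [hs]; split_ifs <;> simp
  have hnn : ∀ n, 0 ≤ 1 + s * chi n := by
    intro n
    have : |s * chi n| ≤ 1 := by
      rw [abs_mul]; exact mul_le_one₀ hs1 (abs_nonneg _) (abs_chi_le n)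
    linarith [(abs_le.1 this).1]
  set a : ℕ → ℝ := fun n => if n.Prime ∧ n % 4 = r then Real.log n / n else 0 with ha
  have hle : ∀ n, a n ≤ (1 + s * chi n) / 2 * (Λ n / n) := by
    intro n
    simp only [ha]
    split_ifs with h
    · rw [ArithmeticFunction.vonMangoldt_apply_prime h.1]
      have : s * chi n = 1 := by
        rw [chi_eq, hs]
        have h2 : n % 2 = 1 := by omega
        rcases hr with rfl | rfl <;> simp [h.2, h2]
      rw [this]; norm_num
    · exact mul_nonneg (div_nonneg (hnn n) (by norm_num))
        (div_nonneg ArithmeticFunction.vonMangoldt_nonneg (Nat.cast_nonneg n))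
  have hbd : ∀ N : ℕ, 2 ≤ N → ∑ n ∈ Finset.Ioc 1 N, a n ≤ 1 / 2 * Real.log N + 9 := by
    intro N hN
    have e : ∑ n ∈ Finset.Ioc 0 N, a n = ∑ n ∈ Finset.Ioc 1 N, a n := by
      rw [← Finset.sum_Ioc_consecutive _ (Nat.zero_le 1) (by omega : 1 ≤ N)]
      simp [ha, Nat.not_prime_one]
    rw [← e]
    exact (Finset.sum_le_sum fun n _ => hle n).trans (sum_residue_le N (by omega) s hs1)
  refine ⟨_, fun N hN => le_trans (le_of_eq ?_) (sum_div_log_le (by norm_num) hbd N hN)⟩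
  rw [Finset.sum_filter, ← Finset.sum_Ioc_consecutive _ (Nat.zero_le 1) (by omega : 1 ≤ N)]
  have e0 : ∑ n ∈ Finset.Ioc 0 1, (if n.Prime ∧ n % 4 = r then (1 : ℝ) / n else 0) = 0 := by
    simp [Nat.not_prime_one]
  rw [e0, zero_add]
  refine Finset.sum_congr rfl fun n hn => ?_
  rw [Finset.mem_Ioc] at hn
  simp only [ha]
  split_ifs
  · have : 0 < Real.log n := Real.log_pos (by exact_mod_cast hn.1)
    field_simp
  · simp

lemma sum_even_vonMangoldt_div_le (N : ℕ) :
    ∑ d ∈ Finset.Ioc 0 N, (if d % 2 = 0 then Λ d / d else 0) ≤ 1 := by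
  have h1 : ∑ d ∈ Finset.Ioc 0 N, (if d % 2 = 0 then Λ d / d else 0) ≤
      ∑ d ∈ (Finset.Icc 1 N).image (fun k => 2 ^ k), Λ d / (d : ℝ) := by
    rw [← Finset.sum_filter, ← Finset.sum_filter_ne_zero]
    refine Finset.sum_le_sum_of_subset_of_nonneg ?_ fun _ _ _ =>
      div_nonneg ArithmeticFunction.vonMangoldt_nonneg (Nat.cast_nonneg _)
    intro d hd
    simp only [Finset.mem_filter, Finset.mem_Ioc] at hd
    obtain ⟨⟨⟨h0, hN⟩, h2⟩, hL⟩ := hd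
    have hpp : IsPrimePow d := by
      by_contra h
      rw [← ArithmeticFunction.vonMangoldt_eq_zero_iff] at h
      simp [h] at hL
    obtain ⟨p, k, hp, hk, rfl⟩ := hpp
    have hp2 : p = 2 := by
      have : 2 ∣ p ^ k := Nat.dvd_of_mod_eq_zero h2
      exact ((Nat.prime_dvd_prime_iff_eq Nat.prime_two hp.nat_prime).1
        (Nat.prime_two.dvd_of_dvd_pow this)).symm
    subst hp2
    rw [Finset.mem_image]
    exact ⟨k, Finset.mem_Icc.2 ⟨hk, (Nat.lt_two_pow_self).le.trans hN⟩, rfl⟩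
  refine h1.trans ?_
  rw [Finset.sum_image (fun a _ b _ h => Nat.pow_right_injective le_rfl h)]
  have h2 : ∀ k ∈ Finset.Icc 1 N, Λ (2 ^ k) / ((2 ^ k : ℕ) : ℝ) ≤ (1 / 2 : ℝ) ^ k := by
    intro k hk
    rw [Finset.mem_Icc] at hk
    rw [ArithmeticFunction.vonMangoldt_apply_pow (by omega),
      ArithmeticFunction.vonMangoldt_apply_prime Nat.prime_two]
    have : Real.log ((2 : ℕ) : ℝ) ≤ 1 := by
      have := Real.log_le_sub_one_of_pos (x := 2) (by norm_num)
      push_cast; linarith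
    push_cast at *
    rw [one_div, inv_pow, div_eq_mul_inv]
    exact mul_le_of_le_one_left (by positivity) this
  refine (Finset.sum_le_sum h2).trans ?_
  have h3 : ∀ M : ℕ, ∑ k ∈ Finset.Icc 1 M, (1 / 2 : ℝ) ^ k = 1 - (1 / 2) ^ M := by
    intro M
    induction M with
    | zero => simp
    | succ M ih => rw [Finset.sum_Icc_succ_top (by omega), ih]; ring
  rw [h3]
  have : (0 : ℝ) ≤ (1 / 2) ^ N := by positivity
  linarith

lemma exists_le_sum_vonMangoldt_one_mod_four :
    ∃ K : ℕ, 0 < K ∧ ∀ N : ℕ, K ≤ N →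
      (N : ℝ) / K ≤ ∑ d ∈ Finset.Ioc 0 N with d % 4 = 1, Λ d := by
  obtain ⟨K, hK⟩ := exists_nat_ge (Real.exp 40)
  have hK0 : (0 : ℝ) < K := (Real.exp_pos _).trans_le hK
  have hlK : 40 ≤ Real.log K := by
    rw [Real.le_log_iff_exp_le hK0]; exact hK
  have hKn : 0 < K := by exact_mod_cast hK0
  refine ⟨K, hKn, fun N hKN => ?_⟩
  set m := N / K with hm
  have hm1 : 1 ≤ m := Nat.div_pos hKN hKn
  have hmN : m ≤ N := Nat.div_le_self _ _
  have hN1 : 1 ≤ N := hm1.trans hmN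
  have h1 := le_sum_vonMangoldt_div N hN1
  have h2 := abs_le.1 (abs_sum_chi_vonMangoldt_div_le N hN1)
  have h3 := sum_vonMangoldt_div_le m hm1
  have h4 := abs_le.1 (abs_sum_chi_vonMangoldt_div_le m hm1)
  rw [← Finset.sum_Ioc_consecutive _ (Nat.zero_le m) hmN] at h1 h2
  have hNm : (m : ℝ) + 1 ≥ N / K := by
    have := Nat.lt_floor_add_one ((N : ℝ) / K)
    rw [Nat.floor_div_eq_div] at this
    exact this.le
  have hmK : (m : ℝ) * K ≤ N := by exact_mod_cast Nat.div_mul_le_self N K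
  have hlog : Real.log m + Real.log K ≤ Real.log N := by
    have hm0 : (0 : ℝ) < m := by exact_mod_cast hm1
    rw [← Real.log_mul hm0.ne' hK0.ne']
    exact Real.log_le_log (by positivity) hmK
  have hN0 : (0 : ℝ) < N := by exact_mod_cast hN1
  have h5 : 2 ≤ ∑ d ∈ Finset.Ioc m N, (1 + chi d) / 2 * (Λ d / d) := by
    have e : ∑ n ∈ Finset.Ioc m N, (1 + chi n) / 2 * (Λ n / n) =
        1 / 2 * ∑ n ∈ Finset.Ioc m N, Λ n / n +
        1 / 2 * ∑ n ∈ Finset.Ioc m N, chi n * (Λ n / n) := by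
      rw [Finset.mul_sum, Finset.mul_sum, ← Finset.sum_add_distrib]
      refine Finset.sum_congr rfl fun d _ => ?_
      ring
    rw [e]
    linarith [h2.1, h4.2]
  have e2 : ∑ d ∈ Finset.Ioc m N, (1 + chi d) / 2 * (Λ d / d) ≤
      ∑ d ∈ Finset.Ioc m N, (if d % 4 = 1 then Λ d else 0) / (N / K) +
      ∑ d ∈ Finset.Ioc m N, (if d % 2 = 0 then Λ d / d else 0) / 2 := by
    rw [← Finset.sum_add_distrib]
    refine Finset.sum_le_sum fun d hd => ?_
    rw [Finset.mem_Ioc] at hd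
    have hd1 : (m : ℝ) + 1 ≤ d := by exact_mod_cast hd.1
    have hL := ArithmeticFunction.vonMangoldt_nonneg (n := d)
    rw [chi_eq]
    by_cases c1 : d % 2 = 0
    · rw [if_pos c1, if_pos c1, if_neg (by omega)]
      simp; ring_nf; rfl
    · rw [if_neg c1, if_neg c1]
      by_cases c2 : d % 4 = 1
      · rw [if_pos c2, if_pos c2]
        simp only [zero_div, add_zero]
        norm_num
        gcongr
        linarith
      · rw [if_neg c2, if_neg c2]
        simp
  have e3 : ∑ d ∈ Finset.Ioc m N, (if d % 2 = 0 then Λ d / d else 0) / 2 ≤ 1 := by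
    have hn : ∀ d : ℕ, 0 ≤ (if d % 2 = 0 then Λ d / d else 0) := fun d => by
      split_ifs
      · exact div_nonneg ArithmeticFunction.vonMangoldt_nonneg (Nat.cast_nonneg d)
      · exact le_rfl
    have := sum_even_vonMangoldt_div_le N
    rw [← Finset.sum_Ioc_consecutive _ (Nat.zero_le m) hmN] at this
    have h0 := Finset.sum_nonneg fun d (_ : d ∈ Finset.Ioc 0 m) => hn d
    rw [← Finset.sum_div]
    linarith
  have e4 : ∑ d ∈ Finset.Ioc m N, (if d % 4 = 1 then Λ d else 0) ≤
      ∑ d ∈ Finset.Ioc 0 N with d % 4 = 1, Λ d := by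
    rw [Finset.sum_filter]
    refine Finset.sum_le_sum_of_subset_of_nonneg (Finset.Ioc_subset_Ioc_left (Nat.zero_le m)) ?_
    intro d _ _
    split_ifs
    · exact ArithmeticFunction.vonMangoldt_nonneg
    · exact le_rfl
  refine le_trans ?_ e4
  rw [← Finset.sum_div] at e2
  have : 1 ≤ (∑ d ∈ Finset.Ioc m N, (if d % 4 = 1 then Λ d else 0)) / (N / K) := by linarith
  rwa [le_div_iff₀ (by positivity), one_mul] at this

end ChebyshevProgression

section MertensProgression

open scoped ArithmeticFunction.vonMangoldt

lemma mem_sumTwoSq_iff_nat {n : ℕ} : n ∈ sumTwoSq ↔ 0 < n ∧ ∃ x y : ℕ, n = x ^ 2 + y ^ 2 := by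
  refine and_congr_right fun _ => ⟨?_, ?_⟩
  · rintro ⟨a, b, h⟩
    refine ⟨a.natAbs, b.natAbs, ?_⟩
    zify
    simpa using h
  · rintro ⟨a, b, h⟩
    exact ⟨a, b, by exact_mod_cast h⟩

lemma mem_sumTwoSq_iff {n : ℕ} :
    n ∈ sumTwoSq ↔ 0 < n ∧ ∀ q : ℕ, q.Prime → q % 4 = 3 → Even (n.factorization q) := by
  rw [mem_sumTwoSq_iff_nat]
  refine and_congr_right fun h0 => ?_
  rw [Nat.eq_sq_add_sq_iff]
  constructor
  · intro h q hq h3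
    by_cases hd : q ∣ n
    · rw [Nat.factorization_def _ hq]
      exact h q (Nat.mem_primeFactors.2 ⟨hq, hd, h0.ne'⟩) h3
    · simp [Nat.factorization_eq_zero_of_not_dvd hd]
  · intro h q hq h3
    have hq' := Nat.prime_of_mem_primeFactors hq
    rw [← Nat.factorization_def _ hq']
    exact h q hq' h3

lemma sumTwoSq_mul {m n : ℕ} (hm : m ∈ sumTwoSq) (hn : n ∈ sumTwoSq) : m * n ∈ sumTwoSq := by
  rw [mem_sumTwoSq_iff] at *
  refine ⟨Nat.mul_pos hm.1 hn.1, fun q hq h3 => ?_⟩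
  rw [Nat.factorization_mul hm.1.ne' hn.1.ne']
  exact (hm.2 q hq h3).add (hn.2 q hq h3)

lemma sumTwoSq_one : 1 ∈ sumTwoSq := ⟨one_pos, 1, 0, by norm_num⟩

lemma sumTwoSq_sq {b : ℕ} (hb : 0 < b) : b ^ 2 ∈ sumTwoSq :=
  ⟨by positivity, b, 0, by push_cast; ring⟩

lemma sumTwoSq_prime {p : ℕ} (hp : p.Prime) (h : p % 4 ≠ 3) : p ∈ sumTwoSq := by
  have := Fact.mk hp
  obtain ⟨a, b, hab⟩ := Nat.Prime.sq_add_sq h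
  exact mem_sumTwoSq_iff_nat.2 ⟨hp.pos, a, b, hab.symm⟩

lemma sumTwoSq_isPrimePow {d : ℕ} (hd : IsPrimePow d) (h1 : d % 4 = 1) : d ∈ sumTwoSq := by
  obtain ⟨p, k, hp, hk, rfl⟩ := hd
  have hp' := hp.nat_prime
  have hpow : ∀ (p k : ℕ), p ∈ sumTwoSq → p ^ k ∈ sumTwoSq := by
    intro p k h
    induction k with
    | zero => exact sumTwoSq_one
    | succ k ih => rw [pow_succ]; exact sumTwoSq_mul ih h
  by_cases h3 : p % 4 = 3
  · obtain ⟨j, rfl | rfl⟩ := Nat.even_or_odd' k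
    · rw [mul_comm, pow_mul]
      exact sumTwoSq_sq (pow_pos hp'.pos _)
    · exfalso
      rw [pow_succ, pow_mul, Nat.mul_mod, Nat.pow_mod, Nat.pow_mod p, h3] at h1
      norm_num at h1
  · exact hpow p k (sumTwoSq_prime hp' h3)

open Classical in
/-- The elements of `S` up to `X`. -/
def SX (X : ℕ) : Finset ℕ := (Finset.Ioc 0 X).filter (· ∈ sumTwoSq)

lemma mem_SX {X n : ℕ} : n ∈ SX X ↔ n ∈ sumTwoSq ∧ n ≤ X := by
  simp only [SX, Finset.mem_filter, Finset.mem_Ioc]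
  exact ⟨fun h => ⟨h.2, h.1.2⟩, fun h => ⟨⟨h.1.1, h.2⟩, h.1⟩⟩

/-- The primes `≡ 3 mod 4` up to `Y`. -/
def inertPrimes (Y : ℕ) : Finset ℕ := (Finset.Ioc 0 Y).filter fun p => p.Prime ∧ p % 4 = 3

lemma exists_eq_prod_inert_mul (n : ℕ) (hn : 0 < n) :
    ∃ A : Finset ℕ, ∃ s : ℕ, A ⊆ inertPrimes n ∧ s ∈ SX n ∧ n = (∏ q ∈ A, q) * s := by
  obtain ⟨a, b, hab, ha⟩ := Nat.sq_mul_squarefree n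
  have ha0 : 0 < a := Nat.pos_of_ne_zero ha.ne_zero
  have hb0 : 0 < b := by
    rcases Nat.eq_zero_or_pos b with rfl | h
    · simp at hab; omega
    · exact h
  have hprod := Nat.prod_primeFactors_of_squarefree ha
  rw [← Finset.prod_filter_mul_prod_filter_not _ (fun q => q % 4 = 3)] at hprod
  have hS : ∏ q ∈ a.primeFactors with ¬ q % 4 = 3, q ∈ sumTwoSq := by
    refine Finset.prod_induction _ (· ∈ sumTwoSq) (fun _ _ => sumTwoSq_mul) sumTwoSq_one ?_
    intro q hq
    rw [Finset.mem_filter] at hq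
    exact sumTwoSq_prime (Nat.prime_of_mem_primeFactors hq.1) hq.2
  have hn' : n = (∏ q ∈ a.primeFactors with q % 4 = 3, q) *
      (b ^ 2 * ∏ q ∈ a.primeFactors with ¬ q % 4 = 3, q) := by
    conv_lhs => rw [← hab, ← hprod]
    ring
  refine ⟨_, _, ?_, ?_, hn'⟩
  · intro q hq
    rw [Finset.mem_filter] at hq
    have hqp := Nat.prime_of_mem_primeFactors hq.1
    rw [inertPrimes, Finset.mem_filter, Finset.mem_Ioc]
    refine ⟨⟨hqp.pos, Nat.le_of_dvd hn ?_⟩, hqp, hq.2⟩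
    rw [← hab]
    exact dvd_mul_of_dvd_right (Nat.dvd_of_mem_primeFactors hq.1) _
  · rw [mem_SX]
    exact ⟨sumTwoSq_mul (sumTwoSq_sq hb0) hS, Nat.le_of_dvd hn (Dvd.intro_left _ hn'.symm)⟩

lemma harmonic_eq_sum_Ioc (N : ℕ) : ((harmonic N : ℚ) : ℝ) = ∑ n ∈ Finset.Ioc 0 N, (1 : ℝ) / n := by
  induction N with
  | zero => simp
  | succ N ih => rw [harmonic_succ, Finset.sum_Ioc_succ_top (by omega)]; push_cast; rw [ih]; simp

lemma prod_one_add_inv_le_exp (Q : Finset ℕ) :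
    ∏ q ∈ Q, (1 + 1 / (q : ℝ)) ≤ Real.exp (∑ q ∈ Q, 1 / (q : ℝ)) := by
  rw [Real.exp_sum]
  refine Finset.prod_le_prod (fun q _ => by positivity) fun q _ => ?_
  rw [add_comm]
  exact Real.add_one_le_exp _

lemma log_le_sum_SX_mul (Y : ℕ) :
    Real.log (Y + 1) ≤ Real.exp (∑ q ∈ inertPrimes Y, 1 / (q : ℝ)) * ∑ s ∈ SX Y, 1 / (s : ℝ) := by
  have h0 := log_add_one_le_harmonic Y
  rw [harmonic_eq_sum_Ioc] at h0
  push_cast at h0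
  refine h0.trans ?_
  refine le_trans ?_ (mul_le_mul_of_nonneg_right (prod_one_add_inv_le_exp _)
    (Finset.sum_nonneg fun s _ => by positivity))
  rw [Finset.prod_one_add, Finset.sum_mul_sum, ← Finset.sum_product']
  choose! A s hA hs hn using exists_eq_prod_inert_mul
  have e : ∀ n ∈ Finset.Ioc 0 Y, (1 : ℝ) / n = (∏ i ∈ A n, 1 / (i : ℝ)) * (1 / (s n : ℝ)) := by
    intro n h
    rw [Finset.mem_Ioc] at h
    conv_lhs => rw [hn n h.1]
    push_cast
    rw [Finset.prod_div_distrib]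
    simp [mul_comm]
  rw [Finset.sum_congr rfl e]
  rw [← Finset.sum_image (f := fun x : Finset ℕ × ℕ => (∏ i ∈ x.1, 1 / (i : ℝ)) * (1 / (x.2 : ℝ)))
    (g := fun n => (A n, s n))]
  · refine Finset.sum_le_sum_of_subset_of_nonneg ?_ fun x _ _ =>
      mul_nonneg (Finset.prod_nonneg fun _ _ => by positivity) (by positivity)
    intro x hx
    rw [Finset.mem_image] at hx
    obtain ⟨n, h, rfl⟩ := hx
    rw [Finset.mem_Ioc] at h
    rw [Finset.mem_product, Finset.mem_powerset]
    refine ⟨(hA n h.1).trans fun q hq => ?_, ?_⟩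
    · simp only [inertPrimes, Finset.mem_filter, Finset.mem_Ioc] at hq ⊢
      exact ⟨⟨hq.1.1, hq.1.2.trans h.2⟩, hq.2⟩
    · have := mem_SX.1 (hs n h.1)
      exact mem_SX.2 ⟨this.1, this.2.trans h.2⟩
  · intro m hm n hn' h
    rw [Finset.mem_coe, Finset.mem_Ioc] at hm hn'
    simp only [Prod.mk.injEq] at h
    rw [hn m hm.1, hn n hn'.1, h.1, h.2]

lemma exists_sqrt_log_le_sum_SX :
    ∃ c : ℝ, 0 < c ∧ ∀ Y : ℕ, 2 ≤ Y → c * √(Real.log Y) ≤ ∑ s ∈ SX Y, 1 / (s : ℝ) := by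
  obtain ⟨C, hC⟩ := exists_sum_inv_prime_residue_le 3 (Or.inr rfl)
  refine ⟨Real.exp (-C), Real.exp_pos _, fun Y hY => ?_⟩
  have hl : 0 < Real.log Y := Real.log_pos (by exact_mod_cast hY)
  have h1 := log_le_sum_SX_mul Y
  have h2 : Real.log Y ≤ Real.log (Y + 1) := Real.log_le_log (by positivity) (by linarith)
  have h3 : Real.exp (∑ q ∈ inertPrimes Y, 1 / (q : ℝ)) ≤ √(Real.log Y) * Real.exp C := by
    calc _ ≤ Real.exp (1 / 2 * Real.log (Real.log Y) + C) := Real.exp_le_exp.2 (hC Y hY)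
      _ = _ := by
        rw [Real.exp_add, mul_comm (1 / 2 : ℝ), Real.exp_mul, Real.exp_log hl,
          Real.sqrt_eq_rpow]
  have h4 : (0 : ℝ) ≤ ∑ s ∈ SX Y, 1 / (s : ℝ) := Finset.sum_nonneg fun s _ => by positivity
  have h5 : √(Real.log Y) * √(Real.log Y) ≤
      √(Real.log Y) * Real.exp C * ∑ s ∈ SX Y, 1 / (s : ℝ) := by
    rw [Real.mul_self_sqrt hl.le]
    exact (h2.trans h1).trans (mul_le_mul_of_nonneg_right h3 h4)
  rw [mul_assoc] at h5
  have h6 := le_of_mul_le_mul_left h5 (Real.sqrt_pos.2 hl)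
  rw [Real.exp_neg, inv_mul_le_iff₀ (Real.exp_pos _)]
  exact h6

lemma sum_Ioc_div_comm (h : ℕ → ℕ → ℝ) (N : ℕ) :
    ∑ d ∈ Finset.Ioc 0 N, ∑ m ∈ Finset.Ioc 0 (N / d), h d m =
      ∑ m ∈ Finset.Ioc 0 N, ∑ d ∈ Finset.Ioc 0 (N / m), h d m := by
  refine Finset.sum_comm' fun d m => ?_
  simp only [Finset.mem_Ioc]
  constructor
  · rintro ⟨⟨h1, h2⟩, h3, h4⟩
    rw [Nat.le_div_iff_mul_le h1] at h4
    exact ⟨⟨h1, (Nat.le_div_iff_mul_le h3).2 (by rwa [mul_comm])⟩, h3,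
      (Nat.le_mul_of_pos_right m h1).trans h4⟩
  · rintro ⟨⟨h1, h2⟩, h3, h4⟩
    rw [Nat.le_div_iff_mul_le h3] at h2
    exact ⟨⟨h1, (Nat.le_mul_of_pos_right d h3).trans h2⟩, h3,
      (Nat.le_div_iff_mul_le h1).2 (by rwa [mul_comm])⟩

lemma sum_SX_log_ge (X : ℕ) :
    ∑ m ∈ SX X, ∑ d ∈ Finset.Ioc 0 (X / m) with d % 4 = 1, Λ d ≤ ∑ n ∈ SX X, Real.log n := by
  classical
  have e1 : ∑ n ∈ SX X, Real.log n = ∑ m ∈ Finset.Ioc 0 X, ∑ d ∈ Finset.Ioc 0 (X / m),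
      (if d * m ∈ sumTwoSq then Λ d else 0) := by
    rw [← sum_Ioc_div_comm, ← sum_Ioc_sum_divisors, SX, Finset.sum_filter]
    refine Finset.sum_congr rfl fun n hn => ?_
    have : ∀ d ∈ n.divisors, (if d * (n / d) ∈ sumTwoSq then Λ d else 0) =
        if n ∈ sumTwoSq then Λ d else 0 := fun d hd => by
      rw [Nat.mul_div_cancel' (Nat.dvd_of_mem_divisors hd)]
    rw [Finset.sum_congr rfl this]
    split_ifs
    · exact ArithmeticFunction.vonMangoldt_sum.symm
    · simp
  rw [e1, SX, Finset.sum_filter]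
  refine Finset.sum_le_sum fun m hm => ?_
  have hnn : ∀ d : ℕ, 0 ≤ (if d * m ∈ sumTwoSq then Λ d else 0) := fun d => by
    split_ifs
    · exact ArithmeticFunction.vonMangoldt_nonneg
    · exact le_rfl
  split_ifs with hmS
  · rw [Finset.sum_filter]
    refine Finset.sum_le_sum fun d hd => ?_
    split_ifs with h1 h2
    · exact le_rfl
    · by_contra hL
      push Not at hL
      have : Λ d ≠ 0 := hL.ne'
      rw [ArithmeticFunction.vonMangoldt_ne_zero_iff] at this
      exact h2 (sumTwoSq_mul (sumTwoSq_isPrimePow this h1) hmS)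
    · exact ArithmeticFunction.vonMangoldt_nonneg
    · exact le_rfl
  · exact Finset.sum_nonneg fun d _ => hnn d

/-- Lower bound of the right order for the counting function of sums of two squares. -/
lemma exists_card_SX_ge :
    ∃ c : ℝ, 0 < c ∧ ∃ X₀ : ℕ, ∀ X : ℕ, X₀ ≤ X → c * X / √(Real.log X) ≤ (SX X).card := by
  obtain ⟨c, hc, h1⟩ := exists_sqrt_log_le_sum_SX
  obtain ⟨K, hK, h2⟩ := exists_le_sum_vonMangoldt_one_mod_four
  refine ⟨c / (4 * K), by positivity, (2 * K) ^ 2 + 4, fun X hX => ?_⟩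
  have hK1 : (1 : ℝ) ≤ K := by exact_mod_cast hK
  have hX0 : 0 < X := by omega
  have hXr : (0 : ℝ) < X := by exact_mod_cast hX0
  have hY : 2 ≤ X / K := by
    rw [Nat.le_div_iff_mul_le hK]; nlinarith
  have hlX : 0 < Real.log X := Real.log_pos (by exact_mod_cast (by omega : 1 < X))
  have a1 : ∑ n ∈ SX X, Real.log n ≤ (SX X).card * Real.log X := by
    rw [← nsmul_eq_mul]
    refine Finset.sum_le_card_nsmul _ _ _ fun n hn => ?_
    rw [mem_SX] at hn
    exact Real.log_le_log (by exact_mod_cast hn.1.1) (by exact_mod_cast hn.2)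
  have a2 : X / (2 * K) * ∑ m ∈ SX (X / K), 1 / (m : ℝ) ≤
      ∑ m ∈ SX X, ∑ d ∈ Finset.Ioc 0 (X / m) with d % 4 = 1, Λ d := by
    rw [Finset.mul_sum]
    refine le_trans (Finset.sum_le_sum fun m hm => ?_)
      (Finset.sum_le_sum_of_subset_of_nonneg (s := SX (X / K)) ?_ fun m _ _ =>
        Finset.sum_nonneg fun d _ => ArithmeticFunction.vonMangoldt_nonneg)
    · rw [mem_SX] at hm
      have hm0 : 0 < m := hm.1.1
      have hKm : K ≤ X / m := by
        rw [Nat.le_div_iff_mul_le hm0, mul_comm]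
        exact (Nat.le_div_iff_mul_le hK).1 hm.2
      refine le_trans ?_ (h2 _ hKm)
      have b1 := Nat.lt_floor_add_one ((X : ℝ) / m)
      rw [Nat.floor_div_eq_div] at b1
      have b2 : (1 : ℝ) ≤ (X / m : ℕ) := by exact_mod_cast hK.trans_le hKm
      have b3 : (X : ℝ) / m / 2 ≤ (X / m : ℕ) := by linarith
      calc (X : ℝ) / (2 * K) * (1 / m) = X / m / 2 / K := by field_simp
        _ ≤ _ := by gcongr
    · intro m hm
      rw [mem_SX] at *
      exact ⟨hm.1, hm.2.trans (Nat.div_le_self _ _)⟩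
  have a3 := sum_SX_log_ge X
  have a4 := h1 _ hY
  have a5 : √(Real.log X) / 2 ≤ √(Real.log ((X / K : ℕ) : ℝ)) := by
    have b1 : Real.log X / 2 ≤ Real.log ((X / K : ℕ) : ℝ) := by
      have c1 : (X : ℝ) / (2 * K) ≤ (X / K : ℕ) := by
        have b1 := Nat.lt_floor_add_one ((X : ℝ) / K)
        rw [Nat.floor_div_eq_div] at b1
        have b2 : (1 : ℝ) ≤ (X / K : ℕ) := by exact_mod_cast (by omega : 1 ≤ X / K)
        have : (X : ℝ) / (2 * K) = X / K / 2 := by field_simp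
        linarith
      have c2 : √(X : ℝ) ≤ X / (2 * K) := by
        rw [le_div_iff₀ (by positivity)]
        have d1 : (2 * K : ℝ) ≤ √X := by
          apply Real.le_sqrt_of_sq_le
          exact_mod_cast (by omega : (2 * K) ^ 2 ≤ X)
        calc √(X : ℝ) * (2 * K) ≤ √X * √X := by gcongr
          _ = X := Real.mul_self_sqrt hXr.le
      rw [← Real.log_sqrt hXr.le]
      exact Real.log_le_log (Real.sqrt_pos.2 hXr) (c2.trans c1)
    calc √(Real.log X) / 2 ≤ √(Real.log X / 2) := by
          apply Real.le_sqrt_of_sq_le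
          rw [div_pow, Real.sq_sqrt hlX.le]
          linarith
      _ ≤ _ := Real.sqrt_le_sqrt b1
  have a6 : X / (2 * K) * (c * (√(Real.log X) / 2)) ≤ (SX X).card * Real.log X := by
    refine le_trans ?_ ((a2.trans a3).trans a1)
    gcongr
    exact le_trans (by gcongr) a4
  rw [div_le_iff₀ (Real.sqrt_pos.2 hlX)]
  have hs := Real.mul_self_sqrt hlX.le
  have a7 : c / (4 * K) * X * √(Real.log X) ≤
      (SX X).card * √(Real.log X) * √(Real.log X) := by
    rw [mul_assoc _ √(Real.log X) √(Real.log X), hs]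
    refine le_trans (le_of_eq ?_) a6
    field_simp
    norm_num
  exact le_of_mul_le_mul_right a7 (Real.sqrt_pos.2 hlX)

end MertensProgression

section SumsOfTwoSquares

open scoped ArithmeticFunction.vonMangoldt ArithmeticFunction.Omega

lemma log_le_sum_unitary {n : ℕ} (hn : n ≠ 0) :
    Real.log n ≤ ∑ d ∈ n.divisors, if d.Coprime (n / d) then (Ω d : ℝ) * Λ d else 0 := by
  have hnn : ∀ d : ℕ, 0 ≤ (Ω d : ℝ) * Λ d := fun d =>
    mul_nonneg (Nat.cast_nonneg _) ArithmeticFunction.vonMangoldt_nonneg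
  have hinj : Set.InjOn (fun p => p ^ n.factorization p) (n.primeFactors : Set ℕ) := by
    intro p hp q hq h
    have hp' := Nat.prime_of_mem_primeFactors hp
    have hq' := Nat.prime_of_mem_primeFactors hq
    have hfp : n.factorization p ≠ 0 :=
      (hp'.factorization_pos_of_dvd hn (Nat.dvd_of_mem_primeFactors hp)).ne'
    have h1 : p ∣ q ^ n.factorization q := by
      rw [← show p ^ n.factorization p = q ^ n.factorization q from h]
      exact dvd_pow_self p hfp
    exact (Nat.prime_dvd_prime_iff_eq hp' hq').1 (hp'.dvd_of_dvd_pow h1)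
  have h1 : Real.log n = ∑ d ∈ n.primeFactors.image (fun p => p ^ n.factorization p),
      (Ω d : ℝ) * Λ d := by
    rw [Finset.sum_image hinj]
    conv_lhs => rw [← Nat.prod_factorization_pow_eq_self hn]
    rw [Finsupp.prod, Nat.support_factorization, Nat.cast_prod, Real.log_prod]
    · refine Finset.sum_congr rfl fun p hp => ?_
      have hp' := Nat.prime_of_mem_primeFactors hp
      have hfp : n.factorization p ≠ 0 :=
        (hp'.factorization_pos_of_dvd hn (Nat.dvd_of_mem_primeFactors hp)).ne'
      rw [ArithmeticFunction.cardFactors_apply_prime_pow hp',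
        ArithmeticFunction.vonMangoldt_apply_pow hfp,
        ArithmeticFunction.vonMangoldt_apply_prime hp', Nat.cast_pow, Real.log_pow]
    · intro p hp
      exact_mod_cast (pow_pos (Nat.prime_of_mem_primeFactors hp).pos _).ne'
  rw [h1, ← Finset.sum_filter]
  refine Finset.sum_le_sum_of_subset_of_nonneg ?_ fun d _ _ => hnn d
  intro d hd
  rw [Finset.mem_image] at hd
  obtain ⟨p, hp, rfl⟩ := hd
  have hp' := Nat.prime_of_mem_primeFactors hp
  rw [Finset.mem_filter, Nat.mem_divisors]
  exact ⟨⟨Nat.ordProj_dvd n p, hn⟩, (Nat.coprime_ordCompl hp' hn).pow_left _⟩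

lemma log_le_four_mul_sqrt_sqrt (N : ℕ) (hN : 1 ≤ N) : Real.log N ≤ 4 * √(√(N : ℝ)) := by
  have h0 : (0 : ℝ) < N := by exact_mod_cast hN
  have h1 := Real.log_le_sub_one_of_pos (x := √(√(N : ℝ))) (by positivity)
  rw [Real.log_sqrt (Real.sqrt_nonneg _), Real.log_sqrt h0.le] at h1
  linarith

lemma exists_sum_cardFactors_vonMangoldt_le :
    ∃ C : ℝ, 0 < C ∧ ∀ N : ℕ,
      ∑ d ∈ Finset.Ioc 0 N, (Ω d : ℝ) * Λ d * ((Ω d : ℝ) + 1) ≤ C * N := by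
  obtain ⟨C, hC⟩ := Chebyshev.psi_sub_theta_le_mul_sqrt
  refine ⟨12 + 42 * |C|, by positivity, fun N => ?_⟩
  rcases Nat.eq_zero_or_pos N with rfl | hN
  · simp
  have hN0 : (0 : ℝ) < N := by exact_mod_cast hN
  set t := √(√(N : ℝ)) with ht
  have ht1 : 1 ≤ t := by
    rw [ht]
    exact Real.one_le_sqrt.2 (Real.one_le_sqrt.2 (by exact_mod_cast hN))
  have ht2 : t ^ 2 = √(N : ℝ) := Real.sq_sqrt (Real.sqrt_nonneg _)
  have hlog : Real.log N ≤ 4 * t := log_le_four_mul_sqrt_sqrt N hN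
  rw [← Finset.sum_filter_add_sum_filter_not _ (fun d => d.Prime)]
  have h1 : ∑ d ∈ Finset.Ioc 0 N with d.Prime, (Ω d : ℝ) * Λ d * ((Ω d : ℝ) + 1) ≤ 12 * N := by
    calc _ = ∑ d ∈ Finset.Ioc 0 N with d.Prime, 2 * Λ d := by
          refine Finset.sum_congr rfl fun d hd => ?_
          rw [Finset.mem_filter] at hd
          rw [ArithmeticFunction.cardFactors_apply_prime hd.2]
          push_cast; ring
      _ ≤ ∑ d ∈ Finset.Ioc 0 N, 2 * Λ d :=
          Finset.sum_le_sum_of_subset_of_nonneg (Finset.filter_subset _ _) fun d _ _ =>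
            mul_nonneg (by norm_num) ArithmeticFunction.vonMangoldt_nonneg
      _ ≤ _ := by
          rw [← Finset.mul_sum]
          linarith [sum_vonMangoldt_le N]
  have h2 : ∑ d ∈ Finset.Ioc 0 N with ¬ d.Prime, (Ω d : ℝ) * Λ d * ((Ω d : ℝ) + 1) ≤
      42 * |C| * N := by
    have hψ := hC N
    rw [Chebyshev.psi_sub_theta_eq_sum_not_prime, Nat.floor_natCast] at hψ
    calc _ ≤ ∑ d ∈ Finset.Ioc 0 N with ¬ d.Prime, 42 * t ^ 2 * Λ d := by
          refine Finset.sum_le_sum fun d hd => ?_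
          rw [Finset.mem_filter, Finset.mem_Ioc] at hd
          by_cases hpp : IsPrimePow d
          · obtain ⟨p, k, hp, hk, rfl⟩ := hpp
            have hp' := hp.nat_prime
            rw [ArithmeticFunction.cardFactors_apply_prime_pow hp']
            have a1 : (k : ℝ) * Real.log 2 ≤ Real.log N := by
              rw [← Real.log_pow]
              refine Real.log_le_log (by positivity) ?_
              exact_mod_cast (Nat.pow_le_pow_left hp'.two_le k).trans hd.1.2
            have a2 : (k : ℝ) ≤ 6 * t := by
              have := Real.log_two_gt_d9
              have hk0 : (0 : ℝ) ≤ k := Nat.cast_nonneg k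
              nlinarith
            have a3 : (k : ℝ) * (k + 1) ≤ 42 * t ^ 2 := by nlinarith [Nat.cast_nonneg (α := ℝ) k]
            have := mul_le_mul_of_nonneg_right a3
              (ArithmeticFunction.vonMangoldt_nonneg (n := p ^ k))
            linarith
          · rw [ArithmeticFunction.vonMangoldt_eq_zero_iff.2 hpp]
            simp
      _ = 42 * t ^ 2 * ∑ d ∈ Finset.Ioc 0 N with ¬ d.Prime, Λ d := by rw [Finset.mul_sum]
      _ ≤ 42 * t ^ 2 * (|C| * √(N : ℝ)) := by
          gcongr
          exact hψ.trans (mul_le_mul_of_nonneg_right (le_abs_self C) (Real.sqrt_nonneg _))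
      _ = 42 * |C| * (√(N : ℝ) * √(N : ℝ)) := by rw [ht2]; ring
      _ = _ := by rw [Real.mul_self_sqrt hN0.le]
  linarith

/-- Hall's inequality: the mean value of a multiplicatively bounded function is controlled by
its logarithmic mean. -/
lemma exists_hall :
    ∃ C : ℝ, 0 < C ∧ ∀ g : ℕ → ℝ, (∀ n, 0 ≤ g n) →
      (∀ p j m : ℕ, p.Prime → 0 < j → ¬ p ∣ m → g (p ^ j * m) ≤ ((j : ℝ) + 1) * g m) →
      ∀ X : ℕ, Real.log X * ∑ n ∈ Finset.Ioc 0 X, g n ≤ C * X * ∑ n ∈ Finset.Ioc 0 X, g n / n := by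
  obtain ⟨C, hC0, hC⟩ := exists_sum_cardFactors_vonMangoldt_le
  refine ⟨C + 1, by positivity, fun g g0 hg X => ?_⟩
  have hw : ∀ d : ℕ, 0 ≤ (Ω d : ℝ) * Λ d := fun d =>
    mul_nonneg (Nat.cast_nonneg _) ArithmeticFunction.vonMangoldt_nonneg
  have h1 : ∑ n ∈ Finset.Ioc 0 X, g n * Real.log n ≤ C * X * ∑ n ∈ Finset.Ioc 0 X, g n / n := by
    calc ∑ n ∈ Finset.Ioc 0 X, g n * Real.log n
        ≤ ∑ n ∈ Finset.Ioc 0 X, ∑ d ∈ n.divisors,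
          if d.Coprime (n / d) then (Ω d : ℝ) * Λ d * g (d * (n / d)) else 0 := by
          refine Finset.sum_le_sum fun n hn => ?_
          rw [Finset.mem_Ioc] at hn
          refine (mul_le_mul_of_nonneg_left (log_le_sum_unitary hn.1.ne') (g0 n)).trans ?_
          rw [Finset.mul_sum]
          refine Finset.sum_le_sum fun d hd => ?_
          rw [Nat.mul_div_cancel' (Nat.dvd_of_mem_divisors hd), mul_ite, mul_zero, mul_comm (g n)]
      _ = ∑ d ∈ Finset.Ioc 0 X, ∑ m ∈ Finset.Ioc 0 (X / d),
          if d.Coprime m then (Ω d : ℝ) * Λ d * g (d * m) else 0 :=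
          sum_Ioc_sum_divisors
            (fun d m => if d.Coprime m then (Ω d : ℝ) * Λ d * g (d * m) else 0) X
      _ ≤ ∑ d ∈ Finset.Ioc 0 X, ∑ m ∈ Finset.Ioc 0 (X / d),
          (Ω d : ℝ) * Λ d * ((Ω d : ℝ) + 1) * g m := by
          refine Finset.sum_le_sum fun d hd => Finset.sum_le_sum fun m hm => ?_
          have hr : 0 ≤ (Ω d : ℝ) * Λ d * ((Ω d : ℝ) + 1) * g m :=
            mul_nonneg (mul_nonneg (hw d) (by positivity)) (g0 m)
          split_ifs with hcop
          · by_cases hpp : IsPrimePow d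
            · obtain ⟨p, k, hp, hk, rfl⟩ := hpp
              have hp' := hp.nat_prime
              rw [mul_assoc _ _ (g m)]
              refine mul_le_mul_of_nonneg_left ?_ (hw _)
              rw [ArithmeticFunction.cardFactors_apply_prime_pow hp']
              refine hg p k m hp' hk fun hdvd => ?_
              have := (Nat.coprime_pow_left_iff hk p m).1 hcop
              exact hp'.one_lt.ne' (Nat.Coprime.eq_one_of_dvd this hdvd)
            · rw [ArithmeticFunction.vonMangoldt_eq_zero_iff.2 hpp]
              simp
          · exact hr
      _ = ∑ m ∈ Finset.Ioc 0 X, g m * ∑ d ∈ Finset.Ioc 0 (X / m),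
          (Ω d : ℝ) * Λ d * ((Ω d : ℝ) + 1) := by
          rw [sum_Ioc_div_comm]
          refine Finset.sum_congr rfl fun m _ => ?_
          rw [Finset.mul_sum]
          exact Finset.sum_congr rfl fun d _ => mul_comm _ _
      _ ≤ ∑ m ∈ Finset.Ioc 0 X, C * X * (g m / m) := by
          refine Finset.sum_le_sum fun m hm => ?_
          have : ((X / m : ℕ) : ℝ) ≤ X / m := Nat.cast_div_le
          calc g m * ∑ d ∈ Finset.Ioc 0 (X / m), (Ω d : ℝ) * Λ d * ((Ω d : ℝ) + 1)
              ≤ g m * (C * (X / m)) := by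
                refine mul_le_mul_of_nonneg_left ((hC _).trans ?_) (g0 m)
                gcongr
            _ = _ := by ring
      _ = _ := by rw [Finset.mul_sum]
  have h2 : ∑ n ∈ Finset.Ioc 0 X, g n * (Real.log X - Real.log n) ≤
      X * ∑ n ∈ Finset.Ioc 0 X, g n / n := by
    rw [Finset.mul_sum]
    refine Finset.sum_le_sum fun n hn => ?_
    rw [Finset.mem_Ioc] at hn
    have hn0 : (0 : ℝ) < n := by exact_mod_cast hn.1
    have hX0 : (0 : ℝ) < X := by exact_mod_cast hn.1.trans_le hn.2
    have := Real.log_le_sub_one_of_pos (x := (X : ℝ) / n) (by positivity)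
    rw [Real.log_div hX0.ne' hn0.ne'] at this
    calc _ ≤ g n * ((X : ℝ) / n) := mul_le_mul_of_nonneg_left (by linarith) (g0 n)
      _ = _ := by ring
  have h3 : Real.log X * ∑ n ∈ Finset.Ioc 0 X, g n =
      ∑ n ∈ Finset.Ioc 0 X, g n * Real.log n +
      ∑ n ∈ Finset.Ioc 0 X, g n * (Real.log X - Real.log n) := by
    rw [← Finset.sum_add_distrib, Finset.mul_sum]
    exact Finset.sum_congr rfl fun n _ => by ring
  rw [h3]
  linarith

lemma sum_succ_mul_pow_le (x : ℝ) (hx : 0 ≤ x) (hx2 : x ≤ 1 / 2) (J : ℕ) :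
    ∑ j ∈ Finset.Ioc 1 J, ((j : ℝ) + 1) * x ^ j ≤ 8 * x ^ 2 := by
  have key : ∀ J : ℕ, 1 ≤ J →
      ∑ j ∈ Finset.Ioc 1 J, ((j : ℝ) + 1) * x ^ j ≤ 8 * x ^ 2 - (2 * J + 6) * x ^ (J + 1) := by
    intro J hJ
    induction J, hJ using Nat.le_induction with
    | base => simp; linarith
    | succ J hJ ih =>
      rw [Finset.sum_Ioc_succ_top (by omega)]
      have hp : 0 ≤ x ^ (J + 1) := by positivity
      have : (2 * ((J : ℝ) + 1) + 6) * x * x ^ (J + 1) ≤ (J + 4) * x ^ (J + 1) := by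
        refine mul_le_mul_of_nonneg_right ?_ hp
        nlinarith [Nat.cast_nonneg (α := ℝ) J]
      rw [pow_succ x (J + 1)]
      push_cast
      nlinarith
  rcases Nat.lt_or_ge J 1 with h | h
  · interval_cases J; simp; positivity
  · have : 0 ≤ (2 * J + 6) * x ^ (J + 1) := by positivity
    linarith [key J h]

/-- Rankin-type bound for the logarithmic mean by an Euler product. -/
lemma sum_div_le_prod (g κ : ℕ → ℝ) (g0 : ∀ n, 0 ≤ g n) (κ0 : ∀ p, 0 ≤ κ p)
    (hg : ∀ p j m : ℕ, p.Prime → 0 < j → ¬ p ∣ m → g (p ^ j * m) ≤ ((j : ℝ) + 1) * g m)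
    (hκ : ∀ p m : ℕ, p.Prime → ¬ p ∣ m → g (p * m) ≤ κ p * g m) (X : ℕ) (T : Finset ℕ)
    (hT : ∀ p ∈ T, p.Prime) :
    ∑ n ∈ Finset.Ioc 0 X with n.primeFactors ⊆ T, g n / n ≤
      g 1 * ∏ p ∈ T, (1 + κ p / p + 8 / (p : ℝ) ^ 2) := by
  classical
  induction T using Finset.induction_on with
  | empty =>
    rw [Finset.prod_empty, mul_one]
    refine (Finset.sum_le_sum_of_subset_of_nonneg (t := {1}) ?_ fun n _ _ =>
      div_nonneg (g0 n) (Nat.cast_nonneg n)).trans ?_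
    · intro n hn
      simp only [Finset.mem_filter, Finset.mem_Ioc, Finset.subset_empty,
        Nat.primeFactors_eq_empty] at hn
      rw [Finset.mem_singleton]; omega
    · simp
  | insert p T hpT ih =>
    have hp : p.Prime := hT p (Finset.mem_insert_self _ _)
    have ih' := ih fun q hq => hT q (Finset.mem_insert_of_mem hq)
    set N := (Finset.Ioc 0 X).filter fun n => n.primeFactors ⊆ T with hN
    have hp0 : (0 : ℝ) < p := by exact_mod_cast hp.pos
    have hpN : ∀ m ∈ N, ¬ p ∣ m := by
      intro m hm hdvd
      simp only [hN, Finset.mem_filter, Finset.mem_Ioc] at hm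
      exact hpT (hm.2 (Nat.mem_primeFactors.2 ⟨hp, hdvd, hm.1.1.ne'⟩))
    have h1 : ∑ n ∈ Finset.Ioc 0 X with n.primeFactors ⊆ insert p T, g n / n ≤
        ∑ j ∈ Finset.range (X + 2), ∑ m ∈ N, g (p ^ j * m) / ((p ^ j * m : ℕ) : ℝ) := by
      rw [← Finset.sum_product']
      rw [← Finset.sum_image (f := fun n : ℕ => g n / (n : ℝ))
        (g := fun x : ℕ × ℕ => p ^ x.1 * x.2)]
      · refine Finset.sum_le_sum_of_subset_of_nonneg ?_ fun n _ _ =>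
          div_nonneg (g0 n) (Nat.cast_nonneg n)
        intro n hn
        simp only [Finset.mem_filter, Finset.mem_Ioc] at hn
        obtain ⟨⟨hn0, hnX⟩, hsub⟩ := hn
        rw [Finset.mem_image]
        refine ⟨(n.factorization p, n / p ^ n.factorization p), ?_,
          Nat.ordProj_mul_ordCompl_eq_self n p⟩
        simp only [Finset.mem_product, Finset.mem_range, hN, Finset.mem_filter, Finset.mem_Ioc]
        have hpos : 0 < n / p ^ n.factorization p := Nat.ordCompl_pos p hn0.ne'
        refine ⟨?_, ⟨hpos, (Nat.div_le_self _ _).trans hnX⟩, ?_⟩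
        · have := Nat.factorization_lt p hn0.ne'
          omega
        · intro q hq
          have hq' := Nat.mem_primeFactors.1 hq
          have hqn : q ∈ n.primeFactors := Nat.mem_primeFactors.2
            ⟨hq'.1, hq'.2.1.trans (Nat.ordCompl_dvd n p), hn0.ne'⟩
          rcases Finset.mem_insert.1 (hsub hqn) with rfl | h
          · exact absurd hq'.2.1 (Nat.not_dvd_ordCompl hp hn0.ne')
          · exact h
      · rintro ⟨i, m⟩ hi ⟨j, k⟩ hj h
        simp only [Finset.coe_product, Set.mem_prod, Finset.mem_coe] at hi hj
        have a1 := hpN m hi.2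
        have a2 := hpN k hj.2
        have hm0 : m ≠ 0 := fun h => a1 (h ▸ dvd_zero p)
        have hk0 : k ≠ 0 := fun h => a2 (h ▸ dvd_zero p)
        have hf := congrArg (fun n => n.factorization p) h
        simp only at hf
        rw [Nat.factorization_mul (pow_pos hp.pos _).ne' hm0,
          Nat.factorization_mul (pow_pos hp.pos _).ne' hk0] at hf
        simp only [Finsupp.add_apply, hp.factorization_pow, Finsupp.single_eq_same,
          Nat.factorization_eq_zero_of_not_dvd a1, Nat.factorization_eq_zero_of_not_dvd a2,
          add_zero] at hf
        subst hf
        rw [Nat.mul_right_inj (pow_pos hp.pos _).ne'] at h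
        simp only [Prod.mk.injEq, true_and]
        exact h
    refine h1.trans ?_
    have hS0 : 0 ≤ ∑ m ∈ N, g m / m :=
      Finset.sum_nonneg fun m _ => div_nonneg (g0 m) (Nat.cast_nonneg m)
    have hj : ∀ (c : ℝ) (j : ℕ), (∀ m ∈ N, g (p ^ j * m) ≤ c * g m) →
        ∑ m ∈ N, g (p ^ j * m) / ((p ^ j * m : ℕ) : ℝ) ≤ c * (1 / p) ^ j * ∑ m ∈ N, g m / m := by
      intro c j hcj
      rw [Finset.mul_sum]
      refine Finset.sum_le_sum fun m hm => ?_
      calc g (p ^ j * m) / ((p ^ j * m : ℕ) : ℝ) ≤ c * g m / ((p ^ j * m : ℕ) : ℝ) := by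
            gcongr
            exact hcj m hm
        _ = _ := by push_cast; rw [one_div, inv_pow]; field_simp
    rw [Finset.range_eq_Ico, Finset.sum_eq_sum_Ico_succ_bot (by omega),
      Finset.sum_eq_sum_Ico_succ_bot (by omega)]
    have b0 := hj 1 0 (fun m _ => by simp)
    have b1 := hj (κ p) 1 (fun m hm => by simpa using hκ p m hp (hpN m hm))
    have b2 : ∑ j ∈ Finset.Ico (0 + 1 + 1) (X + 2),
        ∑ m ∈ N, g (p ^ j * m) / ((p ^ j * m : ℕ) : ℝ) ≤ 8 * (1 / p : ℝ) ^ 2 * ∑ m ∈ N, g m / m := by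
      calc _ ≤ ∑ j ∈ Finset.Ico (0 + 1 + 1) (X + 2),
            ((j : ℝ) + 1) * (1 / p) ^ j * ∑ m ∈ N, g m / m := by
            refine Finset.sum_le_sum fun j hjm => hj _ j fun m hm => ?_
            rw [Finset.mem_Ico] at hjm
            exact hg p j m hp (by omega) (hpN m hm)
        _ = (∑ j ∈ Finset.Ioc 1 (X + 1), ((j : ℝ) + 1) * (1 / p) ^ j) * ∑ m ∈ N, g m / m := by
            rw [Finset.sum_mul]
            rfl
        _ ≤ _ := by
            gcongr
            refine sum_succ_mul_pow_le _ (by positivity) ?_ _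
            exact one_div_le_one_div_of_le (by norm_num) (by exact_mod_cast hp.two_le)
    rw [Finset.prod_insert hpT]
    have hF : 0 ≤ 1 + κ p / p + 8 / (p : ℝ) ^ 2 := by
      have := κ0 p
      positivity
    calc _ ≤ (1 + κ p / p + 8 / (p : ℝ) ^ 2) * ∑ m ∈ N, g m / m := by
          have : (1 + κ p / p + 8 / (p : ℝ) ^ 2) * ∑ m ∈ N, g m / m =
            1 * (1 / (p : ℝ)) ^ 0 * ∑ m ∈ N, g m / m + (κ p * (1 / (p : ℝ)) ^ 1 * ∑ m ∈ N, g m / m +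
              8 * (1 / p : ℝ) ^ 2 * ∑ m ∈ N, g m / m) := by
            rw [one_div, inv_pow]; ring
          rw [this]
          exact add_le_add b0 (add_le_add b1 b2)
      _ ≤ (1 + κ p / p + 8 / (p : ℝ) ^ 2) * (g 1 * ∏ q ∈ T, (1 + κ q / q + 8 / (q : ℝ) ^ 2)) :=
          mul_le_mul_of_nonneg_left ih' hF
      _ = _ := by ring

lemma sum_inv_sq_le (N : ℕ) : ∑ n ∈ Finset.Ioc 0 N, 1 / (n : ℝ) ^ 2 ≤ 2 := by
  have key : ∀ N : ℕ, 1 ≤ N → ∑ n ∈ Finset.Ioc 0 N, 1 / (n : ℝ) ^ 2 ≤ 2 - 1 / (N : ℝ) := by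
    intro N hN
    induction N, hN using Nat.le_induction with
    | base => norm_num
    | succ N hN ih =>
      rw [Finset.sum_Ioc_succ_top (by omega)]
      have h0 : (0 : ℝ) < N := by exact_mod_cast hN
      have : 1 / ((N + 1 : ℕ) : ℝ) ^ 2 ≤ 1 / N - 1 / (N + 1 : ℕ) := by
        push_cast
        rw [div_sub_div _ _ h0.ne' (by positivity), div_le_div_iff₀ (by positivity) (by positivity)]
        nlinarith
      linarith
  rcases Nat.eq_zero_or_pos N with rfl | h
  · simp
  · have : (0 : ℝ) ≤ 1 / N := by positivity
    linarith [key N h]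

lemma exists_sum_le_mul_exp :
    ∃ C : ℝ, 0 < C ∧ ∀ g κ : ℕ → ℝ, (∀ n, 0 ≤ g n) → (∀ p, 0 ≤ κ p) → g 1 = 1 →
      (∀ p j m : ℕ, p.Prime → 0 < j → ¬ p ∣ m → g (p ^ j * m) ≤ ((j : ℝ) + 1) * g m) →
      (∀ p m : ℕ, p.Prime → ¬ p ∣ m → g (p * m) ≤ κ p * g m) →
      ∀ X : ℕ, Real.log X * ∑ n ∈ Finset.Ioc 0 X, g n ≤
        C * X * Real.exp (∑ p ∈ Finset.Ioc 0 X with p.Prime, κ p / p) := by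
  obtain ⟨C, hC, h⟩ := exists_hall
  refine ⟨C * Real.exp 16, by positivity, fun g κ g0 κ0 g1 hg hκ X => ?_⟩
  refine (h g g0 hg X).trans ?_
  have h1 := sum_div_le_prod g κ g0 κ0 hg hκ X ((Finset.Ioc 0 X).filter fun p => p.Prime)
    (fun p hp => (Finset.mem_filter.1 hp).2)
  rw [Finset.filter_true_of_mem, g1, one_mul] at h1
  · have h2 : ∏ p ∈ Finset.Ioc 0 X with p.Prime, (1 + κ p / p + 8 / (p : ℝ) ^ 2) ≤
        Real.exp 16 * Real.exp (∑ p ∈ Finset.Ioc 0 X with p.Prime, κ p / p) := by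
      calc _ ≤ ∏ p ∈ Finset.Ioc 0 X with p.Prime, Real.exp (κ p / p + 8 / (p : ℝ) ^ 2) := by
            refine Finset.prod_le_prod (fun p _ => ?_) fun p _ => ?_
            · have := κ0 p
              positivity
            · have := Real.add_one_le_exp (κ p / p + 8 / (p : ℝ) ^ 2)
              linarith
        _ = Real.exp (∑ p ∈ Finset.Ioc 0 X with p.Prime, 8 / (p : ℝ) ^ 2) *
            Real.exp (∑ p ∈ Finset.Ioc 0 X with p.Prime, κ p / p) := by
            rw [← Real.exp_sum, Finset.sum_add_distrib, Real.exp_add, mul_comm]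
        _ ≤ _ := by
            gcongr
            calc ∑ p ∈ Finset.Ioc 0 X with p.Prime, 8 / (p : ℝ) ^ 2
                ≤ ∑ p ∈ Finset.Ioc 0 X, 8 / (p : ℝ) ^ 2 :=
                  Finset.sum_le_sum_of_subset_of_nonneg (Finset.filter_subset _ _)
                    fun _ _ _ => by positivity
              _ = 8 * ∑ p ∈ Finset.Ioc 0 X, 1 / (p : ℝ) ^ 2 := by
                  rw [Finset.mul_sum]
                  exact Finset.sum_congr rfl fun _ _ => by ring
              _ ≤ 16 := by linarith [sum_inv_sq_le X]
    calc C * X * ∑ n ∈ Finset.Ioc 0 X, g n / n ≤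
          C * X * (Real.exp 16 * Real.exp (∑ p ∈ Finset.Ioc 0 X with p.Prime, κ p / p)) := by
          gcongr
          exact h1.trans h2
      _ = _ := by ring
  · intro n hn q hq
    rw [Finset.mem_Ioc] at hn
    have hq' := Nat.mem_primeFactors.1 hq
    rw [Finset.mem_filter, Finset.mem_Ioc]
    exact ⟨⟨hq'.1.pos, (Nat.le_of_dvd hn.1 hq'.2.1).trans hn.2⟩, hq'.1⟩

end SumsOfTwoSquares

/-- The product of the weights `w p (v_p n)` over the primes `p ≡ 1 mod 4` dividing `n`. -/
def splitProd (w : ℕ → ℕ → ℝ) (n : ℕ) : ℝ :=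
  ∏ p ∈ n.primeFactors with p % 4 = 1, w p (n.factorization p)

lemma splitProd_nonneg {w : ℕ → ℕ → ℝ} (hw : ∀ p j, 0 ≤ w p j) (n : ℕ) : 0 ≤ splitProd w n :=
  Finset.prod_nonneg fun p _ => hw p _

lemma splitProd_pow_mul (w : ℕ → ℕ → ℝ) {p j m : ℕ} (hp : p.Prime) (hj : 0 < j) (hm : ¬ p ∣ m) :
    splitProd w (p ^ j * m) = (if p % 4 = 1 then w p j else 1) * splitProd w m := by
  have hm0 : m ≠ 0 := fun h => hm (h ▸ dvd_zero p)
  have hpj : p ^ j ≠ 0 := (pow_pos hp.pos _).ne'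
  have hpf : p ∉ m.primeFactors := fun h => hm (Nat.dvd_of_mem_primeFactors h)
  have h1 : (p ^ j * m).primeFactors = insert p m.primeFactors := by
    rw [Nat.primeFactors_mul hpj hm0, Nat.primeFactors_prime_pow hj.ne' hp]
    rfl
  have h2 : ∀ q ∈ m.primeFactors, (p ^ j * m).factorization q = m.factorization q := by
    intro q hq
    have : p ≠ q := fun h => hpf (h ▸ hq)
    rw [Nat.factorization_mul hpj hm0, hp.factorization_pow]
    simp [this]
  have h3 : (p ^ j * m).factorization p = j := by
    rw [Nat.factorization_mul hpj hm0, hp.factorization_pow]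
    simp [Nat.factorization_eq_zero_of_not_dvd hm]
  have h4 : ∏ q ∈ m.primeFactors with q % 4 = 1, w q ((p ^ j * m).factorization q) =
      splitProd w m :=
    Finset.prod_congr rfl fun q hq => by rw [h2 q (Finset.mem_filter.1 hq).1]
  rw [splitProd, h1, Finset.filter_insert]
  split_ifs with h
  · rw [Finset.prod_insert (fun h => hpf (Finset.mem_filter.1 h).1), h3, h4]
  · rw [one_mul, h4]

lemma mem_sumTwoSq_of_pow_mul {p j m : ℕ} (hp : p.Prime) (hm : ¬ p ∣ m)
    (h : p ^ j * m ∈ sumTwoSq) : m ∈ sumTwoSq := by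
  have hm0 : m ≠ 0 := fun h => hm (h ▸ dvd_zero p)
  rw [mem_sumTwoSq_iff] at h ⊢
  refine ⟨Nat.pos_of_ne_zero hm0, fun q hq h3 => ?_⟩
  by_cases hqp : q = p
  · rw [hqp, Nat.factorization_eq_zero_of_not_dvd hm]
    exact Even.zero
  · have := h.2 q hq h3
    rwa [Nat.factorization_mul (pow_pos hp.pos _).ne' hm0, hp.factorization_pow,
      Finsupp.add_apply, Finsupp.single_eq_of_ne hqp, zero_add] at this

lemma not_mem_sumTwoSq_mul {p m : ℕ} (hp : p.Prime) (h3 : p % 4 = 3) (hm : ¬ p ∣ m) :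
    p * m ∉ sumTwoSq := by
  intro h
  have hm0 : m ≠ 0 := fun h => hm (h ▸ dvd_zero p)
  have := (mem_sumTwoSq_iff.1 h).2 p hp h3
  rw [Nat.factorization_mul hp.ne_zero hm0, Finsupp.add_apply, hp.factorization_self,
    Nat.factorization_eq_zero_of_not_dvd hm] at this
  exact absurd this (by decide)

lemma exists_sum_splitProd_le :
    ∃ C : ℝ, 0 < C ∧ ∀ w : ℕ → ℕ → ℝ, (∀ p j, 0 ≤ w p j) → (∀ p j, w p j ≤ j + 1) →
      ∀ X : ℕ, Real.log X * ∑ n ∈ SX X, splitProd w n ≤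
        C * X * Real.exp (∑ p ∈ Finset.Ioc 0 X with p.Prime ∧ p % 4 = 1, w p 1 / p) := by
  classical
  obtain ⟨C, hC, h⟩ := exists_sum_le_mul_exp
  refine ⟨C * Real.exp 1, by positivity, fun w w0 w1 X => ?_⟩
  set g : ℕ → ℝ := fun n => if n ∈ sumTwoSq then splitProd w n else 0 with hg
  set κ : ℕ → ℝ := fun p => if p % 4 = 1 then w p 1 else if p = 2 then 1 else 0 with hκ
  have g0 : ∀ n, 0 ≤ g n := by
    intro n
    simp only [hg]
    split_ifs
    · exact splitProd_nonneg w0 n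
    · exact le_rfl
  have κ0 : ∀ n, 0 ≤ κ n := by
    intro n
    simp only [hκ]
    split_ifs
    · exact w0 n 1
    · exact zero_le_one
    · exact le_rfl
  have key := h g κ g0 κ0 ?_ ?_ ?_ X
  · have e1 : ∑ n ∈ Finset.Ioc 0 X, g n = ∑ n ∈ SX X, splitProd w n := by
      rw [SX, Finset.sum_filter]
    have e2 : ∑ p ∈ Finset.Ioc 0 X with p.Prime, κ p / p ≤
        1 + ∑ p ∈ Finset.Ioc 0 X with p.Prime ∧ p % 4 = 1, w p 1 / p := by
      have : ∀ p ∈ (Finset.Ioc 0 X).filter Nat.Prime, κ p / p ≤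
          (if p = 2 then 1 else 0) + (if p % 4 = 1 then w p 1 / p else 0) := by
        intro p _
        simp only [hκ]
        split_ifs with h1 h2
        · subst h2; omega
        · simp
        · norm_num [*]
        · simp
      refine (Finset.sum_le_sum this).trans ?_
      rw [Finset.sum_add_distrib, ← Finset.sum_filter (fun p => p % 4 = 1), Finset.filter_filter]
      gcongr
      rw [Finset.sum_ite_eq']
      split_ifs <;> simp
    rw [e1] at key
    refine key.trans ?_
    calc C * X * Real.exp (∑ p ∈ Finset.Ioc 0 X with p.Prime, κ p / p) ≤
        C * X * Real.exp (1 + ∑ p ∈ Finset.Ioc 0 X with p.Prime ∧ p % 4 = 1, w p 1 / p) := by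
          gcongr
      _ = _ := by rw [Real.exp_add]; ring
  · simp [hg, sumTwoSq_one, splitProd]
  · intro p j m hp hj hm
    simp only [hg]
    split_ifs with h1 h2 h2
    · rw [splitProd_pow_mul w hp hj hm]
      refine mul_le_mul_of_nonneg_right ?_ (splitProd_nonneg w0 m)
      split_ifs
      · exact w1 p j
      · linarith [(Nat.cast_nonneg j : (0 : ℝ) ≤ j)]
    · exact absurd (mem_sumTwoSq_of_pow_mul hp hm h1) h2
    · have := splitProd_nonneg w0 m
      positivity
    · simp
  · intro p m hp hm
    have hs := splitProd_pow_mul w hp one_pos hm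
    rw [pow_one] at hs
    have hn : 0 ≤ κ p * g m := mul_nonneg (κ0 p) (g0 m)
    by_cases h1 : p * m ∈ sumTwoSq
    · have h2 : m ∈ sumTwoSq := mem_sumTwoSq_of_pow_mul (j := 1) hp hm (by rwa [pow_one])
      simp only [hg, if_pos h1, if_pos h2, hs]
      refine mul_le_mul_of_nonneg_right ?_ (splitProd_nonneg w0 m)
      by_cases h4 : p % 4 = 1
      · simp [hκ, h4]
      · have : p = 2 := by
          rcases hp.eq_two_or_odd with h | h
          · exact h
          · exact absurd h1 (not_mem_sumTwoSq_mul hp (by omega) hm)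
        simp [hκ, this]
    · simpa only [hg, if_neg h1] using hn

/-- The number of primes `p ≡ 1 mod 4` dividing `n`. -/
def omegaOne (n : ℕ) : ℕ := (n.primeFactors.filter fun p => p % 4 = 1).card

/-- The number of divisors of `n` composed of primes `p ≡ 1 mod 4` with `p ≤ P`. -/
def smallSplit (P n : ℕ) : ℕ :=
  ∏ p ∈ n.primeFactors with p % 4 = 1 ∧ p ≤ P, (n.factorization p + 1)

lemma card_filter_mul_le {s : Finset ℕ} {g : ℕ → ℝ} (g0 : ∀ n ∈ s, 0 ≤ g n) {t : ℝ}
    (q : ℕ → Prop) [DecidablePred q] (h : ∀ n ∈ s, q n → t ≤ g n) :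
    ((s.filter q).card : ℝ) * t ≤ ∑ n ∈ s, g n := by
  calc ((s.filter q).card : ℝ) * t = ∑ n ∈ s.filter q, t := by simp
    _ ≤ ∑ n ∈ s.filter q, g n := Finset.sum_le_sum fun n hn => by
        rw [Finset.mem_filter] at hn
        exact h n hn.1 hn.2
    _ ≤ _ := Finset.sum_le_sum_of_subset_of_nonneg (Finset.filter_subset _ _)
        fun n hn _ => g0 n hn

open scoped Classical in
/-- Few sums of two squares have few prime factors `p ≡ 1 mod 4`. -/
lemma exists_card_omegaOne_le :
    ∃ C : ℝ, 0 < C ∧ ∀ X : ℕ, 3 ≤ X →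
      (((SX X).filter fun n => (2 : ℝ) ^ omegaOne n ≤ Real.log X ^ (1 / 8 : ℝ)).card : ℝ) ≤
        C * X * Real.log X ^ (-(5 / 8) : ℝ) := by
  obtain ⟨C, hC, h⟩ := exists_sum_splitProd_le
  obtain ⟨D, hD⟩ := exists_sum_inv_prime_residue_le 1 (Or.inl rfl)
  refine ⟨C * Real.exp (D / 2), by positivity, fun X hX => ?_⟩
  have hl : 0 < Real.log X := Real.log_pos (by exact_mod_cast (by omega : 1 < X))
  set w : ℕ → ℕ → ℝ := fun _ _ => 1 / 2
  have hw : ∀ n, splitProd w n = (1 / 2 : ℝ) ^ omegaOne n := by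
    intro n; simp [splitProd, omegaOne, w]
  have h1 := h w (fun _ _ => by norm_num [w])
    (fun _ j => by have : (0 : ℝ) ≤ j := Nat.cast_nonneg j; simp only [w]; linarith) X
  have h2 : ∑ p ∈ Finset.Ioc 0 X with p.Prime ∧ p % 4 = 1, w p 1 / p ≤
      1 / 4 * Real.log (Real.log X) + D / 2 := by
    have := hD X (by omega)
    calc _ = 1 / 2 * ∑ p ∈ Finset.Ioc 0 X with p.Prime ∧ p % 4 = 1, (1 : ℝ) / p := by
          rw [Finset.mul_sum]
          exact Finset.sum_congr rfl fun p _ => by simp only [w]; ring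
      _ ≤ _ := by linarith
  have h3 := card_filter_mul_le (s := SX X) (g := splitProd w)
    (t := Real.log X ^ (-(1 / 8) : ℝ)) (fun n _ => splitProd_nonneg (fun _ _ => by norm_num [w]) n)
    (fun n => (2 : ℝ) ^ omegaOne n ≤ Real.log X ^ (1 / 8 : ℝ)) ?_
  · set c : ℝ := (((SX X).filter fun n => (2 : ℝ) ^ omegaOne n ≤
      Real.log X ^ (1 / 8 : ℝ)).card : ℝ)
    have h4 : Real.log X * (c * Real.log X ^ (-(1 / 8) : ℝ)) ≤
        C * X * (Real.log X ^ (1 / 4 : ℝ) * Real.exp (D / 2)) := by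
      calc _ ≤ _ := mul_le_mul_of_nonneg_left h3 hl.le
        _ ≤ _ := h1
        _ ≤ C * X * Real.exp (1 / 4 * Real.log (Real.log X) + D / 2) := by gcongr
        _ = _ := by
          rw [Real.exp_add, Real.rpow_def_of_pos hl, mul_comm (1 / 4 : ℝ)]
    have h5 : c = Real.log X ^ (-(7 / 8) : ℝ) *
        (Real.log X * (c * Real.log X ^ (-(1 / 8) : ℝ))) := by
      have : Real.log X ^ (-(7 / 8) : ℝ) * (Real.log X ^ (1 : ℝ) * Real.log X ^ (-(1 / 8) : ℝ)) = 1 := by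
        rw [← Real.rpow_add hl, ← Real.rpow_add hl]
        norm_num
      rw [Real.rpow_one] at this
      linear_combination -c * this
    rw [h5]
    refine (mul_le_mul_of_nonneg_left h4 (by positivity)).trans (le_of_eq ?_)
    have : Real.log X ^ (-(7 / 8) : ℝ) * Real.log X ^ (1 / 4 : ℝ) =
        Real.log X ^ (-(5 / 8) : ℝ) := by
      rw [← Real.rpow_add hl]; norm_num
    linear_combination (C * X * Real.exp (D / 2)) * this
  · intro n _ hn
    rw [hw, Real.rpow_neg hl.le, div_pow, one_pow, one_div (2 ^ omegaOne n : ℝ)]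
    exact inv_anti₀ (by positivity) hn

open scoped Classical in
/-- Few sums of two squares have many divisors composed of small primes `p ≡ 1 mod 4`. -/
lemma exists_card_smallSplit_le :
    ∃ C : ℝ, 0 < C ∧ ∀ X P : ℕ, 3 ≤ X → 3 ≤ P →
      (((SX X).filter fun n => Real.log P ≤ (smallSplit P n : ℝ)).card : ℝ) ≤
        C * X * Real.log X ^ (-(1 / 2) : ℝ) * Real.log P ^ (-(1 / 2) : ℝ) := by
  obtain ⟨C, hC, h⟩ := exists_sum_splitProd_le
  obtain ⟨D, hD⟩ := exists_sum_inv_prime_residue_le 1 (Or.inl rfl)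
  refine ⟨C * Real.exp (D + D), by positivity, fun X P hX hP => ?_⟩
  have hl : 0 < Real.log X := Real.log_pos (by exact_mod_cast (by omega : 1 < X))
  have hl' : 0 < Real.log P := Real.log_pos (by exact_mod_cast (by omega : 1 < P))
  set w : ℕ → ℕ → ℝ := fun p j => if p ≤ P then j + 1 else 1 with hwdef
  have w0 : ∀ p j, 0 ≤ w p j := by
    intro p j; simp only [w]; split_ifs <;> positivity
  have hw : ∀ n, splitProd w n = (smallSplit P n : ℝ) := by
    intro n
    rw [splitProd, smallSplit, ← Finset.filter_filter, Finset.prod_filter (fun p => p ≤ P)]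
    push_cast
    exact Finset.prod_congr rfl fun p _ => by simp [w]
  have h1 := h w w0 (fun p j => by
    have : (0 : ℝ) ≤ j := Nat.cast_nonneg j
    simp only [w]; split_ifs <;> linarith) X
  have h2 : ∑ p ∈ Finset.Ioc 0 X with p.Prime ∧ p % 4 = 1, w p 1 / p ≤
      1 / 2 * Real.log (Real.log X) + 1 / 2 * Real.log (Real.log P) + (D + D) := by
    have a1 := hD X (by omega)
    have a2 := hD P (by omega)
    have : ∑ p ∈ Finset.Ioc 0 X with p.Prime ∧ p % 4 = 1, w p 1 / p ≤
        ∑ p ∈ Finset.Ioc 0 X with p.Prime ∧ p % 4 = 1, (1 : ℝ) / p +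
          ∑ p ∈ Finset.Ioc 0 P with p.Prime ∧ p % 4 = 1, (1 : ℝ) / p := by
      have e : ∀ p ∈ (Finset.Ioc 0 X).filter (fun p => p.Prime ∧ p % 4 = 1), w p 1 / p =
          (1 : ℝ) / p + if p ≤ P then (1 : ℝ) / p else 0 := by
        intro p _
        simp only [w]
        split_ifs
        · push_cast; ring
        · simp
      rw [Finset.sum_congr rfl e, Finset.sum_add_distrib, ← Finset.sum_filter]
      gcongr
      intro p hp
      simp only [Finset.mem_filter, Finset.mem_Ioc] at hp ⊢
      exact ⟨⟨hp.1.1.1, hp.2⟩, hp.1.2⟩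
    linarith
  have h3 := card_filter_mul_le (s := SX X) (g := splitProd w)
    (t := Real.log P) (fun n _ => splitProd_nonneg w0 n)
    (fun n => Real.log P ≤ (smallSplit P n : ℝ)) (fun n _ hn => by rwa [hw])
  set c : ℝ := (((SX X).filter fun n => Real.log P ≤ (smallSplit P n : ℝ)).card : ℝ)
  have h4 : Real.log X * (c * Real.log P) ≤
      C * X * (Real.log X ^ (1 / 2 : ℝ) * Real.log P ^ (1 / 2 : ℝ) * Real.exp (D + D)) := by
    calc _ ≤ _ := mul_le_mul_of_nonneg_left h3 hl.le
      _ ≤ _ := h1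
      _ ≤ C * X * Real.exp (1 / 2 * Real.log (Real.log X) + 1 / 2 * Real.log (Real.log P) +
          (D + D)) := by gcongr
      _ = _ := by
        rw [Real.exp_add, Real.exp_add, Real.rpow_def_of_pos hl, Real.rpow_def_of_pos hl',
          mul_comm (1 / 2 : ℝ), mul_comm (1 / 2 : ℝ)]
  have e1 : Real.log X ^ (-(1 / 2) : ℝ) = (Real.log X)⁻¹ * Real.log X ^ (1 / 2 : ℝ) := by
    rw [← Real.rpow_neg_one, ← Real.rpow_add hl]; norm_num
  have e2 : Real.log P ^ (-(1 / 2) : ℝ) = (Real.log P)⁻¹ * Real.log P ^ (1 / 2 : ℝ) := by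
    rw [← Real.rpow_neg_one, ← Real.rpow_add hl']; norm_num
  rw [e1, e2]
  have : c = (Real.log X)⁻¹ * (Real.log P)⁻¹ * (Real.log X * (c * Real.log P)) := by field_simp
  rw [this]
  refine (mul_le_mul_of_nonneg_left h4 (by positivity)).trans (le_of_eq ?_)
  ring

lemma mem_latticePts {n : ℕ} {ξ : ℤ × ℤ} : ξ ∈ latticePts n ↔ ξ.1 ^ 2 + ξ.2 ^ 2 = (n : ℤ) := by
  simp only [latticePts, Finset.mem_filter, Finset.mem_product, Finset.mem_Icc,
    and_iff_right_iff_imp]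
  intro h
  have h1 := Int.le_self_sq ξ.1
  have h2 := Int.le_self_sq ξ.2
  have h3 := Int.le_self_sq (-ξ.1)
  have h4 := Int.le_self_sq (-ξ.2)
  have h5 := sq_nonneg ξ.1
  have h6 := sq_nonneg ξ.2
  rw [neg_sq] at h3 h4
  refine ⟨⟨?_, ?_⟩, ?_, ?_⟩ <;> linarith

lemma sum_card_latticePts_le (X : ℕ) (hX : 1 ≤ X) :
    ∑ n ∈ SX X, (latticePts n).card ≤ 9 * X := by
  classical
  have hr : 1 ≤ Nat.sqrt X := Nat.le_sqrt.2 (by omega)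
  set B : Finset (ℤ × ℤ) := Finset.Icc (-(Nat.sqrt X : ℤ)) (Nat.sqrt X) ×ˢ
    Finset.Icc (-(Nat.sqrt X : ℤ)) (Nat.sqrt X) with hB
  have h1 : ∑ n ∈ SX X, (latticePts n).card = ((SX X).biUnion latticePts).card := by
    rw [Finset.card_biUnion]
    intro m _ n _ hmn
    rw [Function.onFun, Finset.disjoint_left]
    intro ξ h1 h2
    rw [mem_latticePts] at h1 h2
    exact hmn (by exact_mod_cast h1.symm.trans h2)
  have h2 : (SX X).biUnion latticePts ⊆ B := by
    intro ξ h
    rw [Finset.mem_biUnion] at h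
    obtain ⟨n, hn, h⟩ := h
    rw [mem_latticePts] at h
    have hn' := (mem_SX.1 hn).2
    have key : ∀ a b : ℤ, a ^ 2 + b ^ 2 = n → -(Nat.sqrt X : ℤ) ≤ a ∧ a ≤ Nat.sqrt X := by
      intro a b hab
      have : a.natAbs ≤ Nat.sqrt X := by
        rw [Nat.le_sqrt']
        zify
        rw [sq_abs]
        have : (n : ℤ) ≤ X := by exact_mod_cast hn'
        nlinarith [sq_nonneg b]
      omega
    simp only [hB, Finset.mem_product, Finset.mem_Icc]
    exact ⟨key _ _ h, key _ _ (by rw [add_comm]; exact h)⟩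
  rw [h1]
  refine (Finset.card_le_card h2).trans ?_
  rw [hB, Finset.card_product, Int.card_Icc]
  have e : ((Nat.sqrt X : ℤ) + 1 - -(Nat.sqrt X : ℤ)).toNat = 2 * Nat.sqrt X + 1 := by omega
  rw [e]
  have := Nat.sqrt_le' X
  nlinarith

/-- Few numbers have many representations as a sum of two squares. -/
lemma card_many_representations_le (X : ℕ) (hX : 1 ≤ X) (t : ℝ) :
    (((SX X).filter fun n => t ≤ ((latticePts n).card : ℝ)).card : ℝ) * t ≤ 9 * X := by
  refine (card_filter_mul_le (g := fun n => ((latticePts n).card : ℝ))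
    (fun _ _ => Nat.cast_nonneg _) _ fun n _ h => h).trans ?_
  exact_mod_cast sum_card_latticePts_le X hX

/-- There are two distinct lattice points on the circle of radius `√n` at distance at most `H`
in the sup norm. -/
def ClosePair (H n : ℕ) : Prop :=
  ∃ ξ ∈ latticePts n, ∃ η ∈ latticePts n, ξ ≠ η ∧ |ξ.1 - η.1| ≤ H ∧ |ξ.2 - η.2| ≤ H

lemma ClosePair.exists_nat {H n : ℕ} (h : ClosePair H n) :
    ∃ h k u w : ℕ, h * u = k * w ∧ ¬ (h = 0 ∧ k = 0) ∧ h ≤ H ∧ k ≤ H ∧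
      4 * n = h ^ 2 + u ^ 2 + k ^ 2 + w ^ 2 := by
  obtain ⟨ξ, hξ, η, hη, hne, h1, h2⟩ := h
  rw [mem_latticePts] at hξ hη
  refine ⟨(ξ.1 - η.1).natAbs, (ξ.2 - η.2).natAbs, (ξ.1 + η.1).natAbs, (ξ.2 + η.2).natAbs,
    ?_, ?_, ?_, ?_, ?_⟩
  · rw [← Int.natAbs_mul, ← Int.natAbs_mul, Int.natAbs_eq_natAbs_iff]
    right
    linear_combination hξ - hη
  · rw [Int.natAbs_eq_zero, Int.natAbs_eq_zero]
    rintro ⟨a, b⟩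
    exact hne (Prod.ext (by linarith) (by linarith))
  · zify; exact h1
  · zify; exact h2
  · zify
    simp only [sq_abs]
    linear_combination -2 * hξ - 2 * hη

/-- Few numbers have a close pair of representations. -/
lemma card_closePair_le (X H : ℕ) (hH : 1 ≤ H) (q : ℕ → Prop) [DecidablePred q]
    (hq : ∀ n, q n → ClosePair H n) :
    ((((Finset.Ioc 0 X).filter q).card : ℕ) : ℝ) ≤
      (H + 1) * (Nat.sqrt (4 * X) + 1) + H * Nat.sqrt (4 * X) * (1 + Real.log H) + H ^ 2 := by
  classical
  set U := Nat.sqrt (4 * X)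
  set A : Finset ℕ := (Finset.range (H + 1) ×ˢ Finset.range (U + 1)).image
    fun x => (x.1 ^ 2 + x.2 ^ 2) / 4
  set B : Finset ℕ := (Finset.Ioc 0 H).biUnion fun m =>
    (Finset.Ioc 0 m ×ˢ Finset.Ioc 0 (H / m) ×ˢ Finset.range (U / m + 1)).image
      fun x => (x.2.1 ^ 2 + x.2.2 ^ 2) * (m ^ 2 + x.1 ^ 2) / 4
  have hsub : (Finset.Ioc 0 X).filter q ⊆ A ∪ B := by
    intro n hn
    rw [Finset.mem_filter, Finset.mem_Ioc] at hn
    obtain ⟨h, k, u, w, e, hne, hh, hk, e4⟩ := (hq n hn.2).exists_nat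
    have hu : u ≤ U := Nat.le_sqrt'.2 (by nlinarith [sq_nonneg h, sq_nonneg k, sq_nonneg w])
    have hw : w ≤ U := Nat.le_sqrt'.2 (by nlinarith [sq_nonneg h, sq_nonneg k, sq_nonneg u])
    rw [Finset.mem_union]
    rcases Nat.eq_zero_or_pos h with rfl | h0
    · left
      have hk0 : k ≠ 0 := fun h => hne ⟨rfl, h⟩
      have hw0 : w = 0 := by
        rw [zero_mul, eq_comm, mul_eq_zero] at e
        exact e.resolve_left hk0
      refine Finset.mem_image.2 ⟨(k, u), ?_, ?_⟩
      · simp only [Finset.mem_product, Finset.mem_range]; omega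
      · subst hw0
        dsimp only
        omega
    rcases Nat.eq_zero_or_pos k with rfl | k0
    · left
      have hu0 : u = 0 := by
        rw [zero_mul, mul_eq_zero] at e
        exact e.resolve_left h0.ne'
      refine Finset.mem_image.2 ⟨(h, w), ?_, ?_⟩
      · simp only [Finset.mem_product, Finset.mem_range]; omega
      · subst hu0
        dsimp only
        omega
    right
    have hg0 : 0 < Nat.gcd h k := Nat.gcd_pos_of_pos_left _ h0
    obtain ⟨h', eh⟩ := Nat.gcd_dvd_left h k
    obtain ⟨k', ek⟩ := Nat.gcd_dvd_right h k
    set g := Nat.gcd h k with hg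
    have hco : Nat.Coprime h' k' := by
      have := Nat.coprime_div_gcd_div_gcd (m := h) (n := k) hg0
      rwa [← hg, Nat.div_eq_of_eq_mul_right hg0 eh, Nat.div_eq_of_eq_mul_right hg0 ek] at this
    have e' : h' * u = k' * w := by
      rw [eh, ek, mul_assoc, mul_assoc] at e
      exact Nat.eq_of_mul_eq_mul_left hg0 e
    have hh'0 : 0 < h' := Nat.pos_of_ne_zero (by rintro rfl; simp at eh; omega)
    have hk'0 : 0 < k' := Nat.pos_of_ne_zero (by rintro rfl; simp at ek; omega)
    obtain ⟨t, et⟩ : k' ∣ u := hco.symm.dvd_of_dvd_mul_left (Dvd.intro _ e'.symm)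
    have ew : w = h' * t := by
      rw [et] at e'
      exact Nat.eq_of_mul_eq_mul_left hk'0 (by linarith)
    have key : ∀ m j : ℕ, 0 < m → 0 < j → j ≤ m → g * m ≤ H → t * m ≤ U →
        4 * n = (g ^ 2 + t ^ 2) * (m ^ 2 + j ^ 2) → n ∈ B := by
      intro m j hm hj hjm h1 h2 h3
      refine Finset.mem_biUnion.2 ⟨m, ?_, Finset.mem_image.2 ⟨(j, g, t), ?_, ?_⟩⟩
      · rw [Finset.mem_Ioc]
        exact ⟨hm, by nlinarith⟩
      · simp only [Finset.mem_product, Finset.mem_Ioc, Finset.mem_range]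
        exact ⟨⟨hj, hjm⟩, ⟨hg0, (Nat.le_div_iff_mul_le hm).2 h1⟩,
          Nat.lt_succ_of_le ((Nat.le_div_iff_mul_le hm).2 h2)⟩
      · dsimp only
        rw [← h3]
        omega
    rcases le_total k' h' with hle | hle
    · refine key h' k' hh'0 hk'0 hle (by rw [← eh]; exact hh) (by rw [mul_comm, ← ew]; exact hw) ?_
      rw [e4, eh, ek, et, ew]
      ring
    · refine key k' h' hk'0 hh'0 hle (by rw [← ek]; exact hk) (by rw [mul_comm, ← et]; exact hu) ?_
      rw [e4, eh, ek, et, ew]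
      ring
  have hA : (A.card : ℝ) ≤ (H + 1) * (U + 1) := by
    have : A.card ≤ (H + 1) * (U + 1) := by
      refine Finset.card_image_le.trans ?_
      simp
    exact_mod_cast this
  have hB : (B.card : ℝ) ≤ H * U * (1 + Real.log H) + H ^ 2 := by
    have h1 : (B.card : ℝ) ≤ ∑ m ∈ Finset.Ioc 0 H, ((m * ((H / m) * (U / m + 1)) : ℕ) : ℝ) := by
      have : B.card ≤ ∑ m ∈ Finset.Ioc 0 H, (m * ((H / m) * (U / m + 1))) := by
        refine Finset.card_biUnion_le.trans (Finset.sum_le_sum fun m _ => ?_)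
        refine Finset.card_image_le.trans ?_
        simp
      exact_mod_cast this
    have h2 : ∀ m ∈ Finset.Ioc 0 H, ((m * ((H / m) * (U / m + 1)) : ℕ) : ℝ) ≤
        H * U * (1 / (m : ℝ)) + H := by
      intro m hm
      rw [Finset.mem_Ioc] at hm
      have hm0 : (0 : ℝ) < m := by exact_mod_cast hm.1
      have a1 : ((H / m : ℕ) : ℝ) ≤ H / m := Nat.cast_div_le
      have a2 : ((U / m : ℕ) : ℝ) ≤ U / m := Nat.cast_div_le
      push_cast
      calc (m : ℝ) * (((H / m : ℕ) : ℝ) * (((U / m : ℕ) : ℝ) + 1)) ≤ m * ((H / m) * (U / m + 1)) := by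
            gcongr
        _ = _ := by field_simp
    refine h1.trans ((Finset.sum_le_sum h2).trans ?_)
    rw [Finset.sum_add_distrib, ← Finset.mul_sum, ← harmonic_eq_sum_Ioc]
    have := harmonic_le_one_add_log H
    simp only [Finset.sum_const, Nat.card_Ioc, tsub_zero, nsmul_eq_mul]
    rw [sq]
    gcongr
  calc ((((Finset.Ioc 0 X).filter q).card : ℕ) : ℝ) ≤ ((A ∪ B).card : ℝ) := by
        exact_mod_cast Finset.card_le_card hsub
    _ ≤ (A.card : ℝ) + B.card := by exact_mod_cast Finset.card_union_le A B
    _ ≤ _ := by linarith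

/-- A lattice point as a Gaussian integer. -/
def toG : ℤ × ℤ →+ GaussianInt where
  toFun ξ := ⟨ξ.1, ξ.2⟩
  map_zero' := rfl
  map_add' _ _ := rfl

lemma toG_injective : Function.Injective toG := fun ξ η h => by
  have h1 := congrArg Zsqrtd.re h
  have h2 := congrArg Zsqrtd.im h
  exact Prod.ext h1 h2

lemma norm_toG (ξ : ℤ × ℤ) : (toG ξ).norm = ξ.1 ^ 2 + ξ.2 ^ 2 := by
  rw [Zsqrtd.norm_def]
  change ξ.1 * ξ.1 - (-1) * ξ.2 * ξ.2 = _
  ring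

/-- The Gaussian integers of norm `n`. -/
def circ (n : ℕ) : Finset GaussianInt := (latticePts n).map ⟨toG, toG_injective⟩

lemma mem_circ {n : ℕ} {z : GaussianInt} : z ∈ circ n ↔ z.norm = n := by
  simp only [circ, Finset.mem_map, Function.Embedding.coeFn_mk, mem_latticePts, ← norm_toG]
  constructor
  · rintro ⟨ξ, h, rfl⟩
    exact h
  · intro h
    exact ⟨(z.re, z.im), h, rfl⟩

lemma card_circ (n : ℕ) : (circ n).card = (latticePts n).card := Finset.card_map _

lemma ne_zero_of_norm_eq {n : ℕ} (hn : 0 < n) {z : GaussianInt} (h : z.norm = n) : z ≠ 0 := by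
  rintro rfl
  rw [Zsqrtd.norm_zero] at h
  exact hn.ne (by exact_mod_cast h)

lemma prime_of_norm_eq_prime {p : ℕ} (hp : p.Prime) {ϖ : GaussianInt} (h : ϖ.norm = p) :
    Prime ϖ := by
  rw [← irreducible_iff_prime]
  refine ⟨fun hu => ?_, fun a b hab => ?_⟩
  · rw [← Zsqrtd.norm_eq_one_iff, h, Int.natAbs_natCast] at hu
    exact hp.ne_one hu
  · rw [← Zsqrtd.norm_eq_one_iff, ← Zsqrtd.norm_eq_one_iff]
    have : a.norm.natAbs * b.norm.natAbs = p := by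
      rw [← Int.natAbs_mul, ← Zsqrtd.norm_mul, ← hab, h, Int.natAbs_natCast]
    rcases (Nat.dvd_prime hp).1 (Dvd.intro _ this) with h1 | h1
    · exact Or.inl h1
    · right
      rw [h1] at this
      exact Nat.eq_of_mul_eq_mul_left hp.pos (by rw [this, mul_one])

lemma mul_star_eq {p : ℕ} {ϖ : GaussianInt} (h : ϖ.norm = p) : ϖ * star ϖ = (p : GaussianInt) := by
  rw [← Zsqrtd.norm_eq_mul_conj, h]
  simp

lemma dvd_or_star_dvd {p n : ℕ} (hp : p.Prime) {ϖ z : GaussianInt} (h : ϖ.norm = p)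
    (hz : z.norm = n) (hpn : p ∣ n) : ϖ ∣ z ∨ star ϖ ∣ z := by
  have h1 : ϖ ∣ z * star z := by
    rw [mul_star_eq hz]
    exact (Dvd.intro _ (mul_star_eq h)).trans (Nat.cast_dvd_cast hpn)
  rcases (prime_of_norm_eq_prime hp h).dvd_or_dvd h1 with h2 | ⟨c, hc⟩
  · exact Or.inl h2
  · right
    refine ⟨star c, ?_⟩
    rw [← star_mul', ← hc, star_star]

lemma norm_dvd_of_dvd {p n : ℕ} {ϖ z : GaussianInt} (h : ϖ.norm = p) (hz : z.norm = n)
    (hd : ϖ ∣ z) : p ∣ n := by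
  obtain ⟨c, rfl⟩ := hd
  rw [Zsqrtd.norm_mul, h] at hz
  exact_mod_cast Dvd.intro _ hz

lemma norm_eq_div {p n : ℕ} (hp : 0 < p) {ϖ z : GaussianInt} (h : ϖ.norm = p)
    (hz : (ϖ * z).norm = n) : z.norm = (n / p : ℕ) := by
  rw [Zsqrtd.norm_mul, h] at hz
  have : (p : ℤ) ≠ 0 := by exact_mod_cast hp.ne'
  push_cast
  rw [← hz, Int.mul_ediv_cancel_left _ this]

lemma not_star_dvd_self {p : ℕ} (hp : p.Prime) (h2 : p ≠ 2) {ϖ : GaussianInt} (h : ϖ.norm = p) :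
    ¬ star ϖ ∣ ϖ := by
  intro hd
  have hs : (star ϖ).norm = p := by rw [Zsqrtd.norm_conj, h]
  have h1 : star ϖ ∣ ((2 * ϖ.re : ℤ) : GaussianInt) := by
    have : ((2 * ϖ.re : ℤ) : GaussianInt) = ϖ + star ϖ := by
      ext <;> simp; ring
    rw [this]
    exact dvd_add hd dvd_rfl
  obtain ⟨c, hc⟩ := h1
  have h3 : (p : ℤ) ∣ (2 * ϖ.re) ^ 2 := by
    refine ⟨c.norm, ?_⟩
    rw [← hs, ← Zsqrtd.norm_mul, ← hc, Zsqrtd.norm_intCast]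
    ring
  have hpI : Prime (p : ℤ) := Nat.prime_iff_prime_int.1 hp
  have h4 := hpI.dvd_of_dvd_pow h3
  have h5 : (p : ℤ) ∣ ϖ.re := by
    rcases hpI.dvd_or_dvd h4 with h5 | h5
    · have : p ∣ 2 := by exact_mod_cast h5
      exact absurd ((Nat.prime_dvd_prime_iff_eq hp Nat.prime_two).1 this) h2
    · exact h5
  rw [Zsqrtd.norm_def] at h
  have h6 : (p : ℤ) ∣ ϖ.im := by
    refine hpI.dvd_of_dvd_pow (n := 2) ?_
    have : ϖ.im ^ 2 = p - ϖ.re * ϖ.re := by rw [← h]; ring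
    rw [this]
    exact dvd_sub dvd_rfl (h5.mul_left _)
  obtain ⟨a, ha⟩ := h5
  obtain ⟨b, hb⟩ := h6
  rw [ha, hb] at h
  have hp0 : (p : ℤ) ≠ 0 := by exact_mod_cast hp.ne_zero
  have : (p : ℤ) * (a * a + b * b) = 1 := by
    apply mul_left_cancel₀ hp0
    linear_combination h
  have h7 : (p : ℤ) ∣ 1 := Dvd.intro _ this
  have : p ∣ 1 := by exact_mod_cast h7
  exact hp.one_lt.ne' (Nat.dvd_one.1 this)

lemma exists_gaussian_norm_eq {p : ℕ} (hp : p.Prime) (h : p % 4 ≠ 3) : ∃ ϖ : GaussianInt, ϖ.norm = p := by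
  have := Fact.mk hp
  obtain ⟨a, b, hab⟩ := Nat.Prime.sq_add_sq h
  exact ⟨⟨a, b⟩, by rw [Zsqrtd.norm_def, ← hab]; push_cast; ring⟩

open scoped Classical in
/-- A Gaussian prime above `p`, for a prime `p` which is not `3` modulo `4`. -/
def gp (p : ℕ) : GaussianInt :=
  if h : p.Prime ∧ p % 4 ≠ 3 then (exists_gaussian_norm_eq h.1 h.2).choose else 0

lemma norm_gp {p : ℕ} (hp : p.Prime) (h : p % 4 ≠ 3) : (gp p).norm = p := by
  rw [gp, dif_pos ⟨hp, h⟩]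
  exact (exists_gaussian_norm_eq hp h).choose_spec

lemma dvd_gp_two {z : GaussianInt} {n : ℕ} (hz : z.norm = n) (h : 2 ∣ n) : gp 2 ∣ z := by
  have h2 := norm_gp Nat.prime_two (by norm_num)
  rcases dvd_or_star_dvd Nat.prime_two h2 hz h with h | h
  · exact h
  · refine dvd_trans ?_ h
    rw [Zsqrtd.norm_def] at h2
    have a1 : (gp 2).re ^ 2 ≤ 1 ∨ (gp 2).im ^ 2 ≤ 1 := by
      push_cast at h2
      by_contra! hc
      nlinarith
    have sq_one : ∀ a b : ℤ, a * a - (-1) * b * b = 2 → a ^ 2 ≤ 1 → a ^ 2 = 1 ∧ b ^ 2 = 1 := by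
      intro a b h h1
      have hb : b ^ 2 = 2 - a ^ 2 := by linear_combination h
      have h0 := sq_nonneg a
      rcases (by omega : a ^ 2 = 0 ∨ a ^ 2 = 1) with h3 | h3
      · rw [h3] at hb
        have : b.natAbs ^ 2 = 2 := by zify; rw [sq_abs, hb]; norm_num
        have hb2 : b.natAbs < 2 := by nlinarith
        interval_cases b.natAbs <;> omega
      · exact ⟨h3, by rw [hb, h3]; norm_num⟩
    have a2 : (gp 2).re ^ 2 = 1 ∧ (gp 2).im ^ 2 = 1 := by
      rcases a1 with h | h
      · exact sq_one _ _ h2 h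
      · exact (sq_one (gp 2).im (gp 2).re (by push_cast at h2; linear_combination h2) h).symm
    refine ⟨⟨0, -((gp 2).re * (gp 2).im)⟩, ?_⟩
    ext
    · simp
      linear_combination (-(gp 2).re) * a2.2
    · simp
      linear_combination -(gp 2).im * a2.1

lemma emultiplicity_ne_top_of_norm {p n : ℕ} (hp : p.Prime) (hn : 0 < n) {ϖ z : GaussianInt}
    (h : ϖ.norm = p) (hz : z.norm = n) : emultiplicity ϖ z ≠ ⊤ :=
  finiteMultiplicity_iff_emultiplicity_ne_top.1
    (FiniteMultiplicity.of_prime_left (prime_of_norm_eq_prime hp h) (ne_zero_of_norm_eq hn hz))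

/-- A Gaussian integer of norm `n` is determined up to units by its multiplicities at the chosen
primes above the split primes. -/
lemma associated_of_emultiplicity_eq (n : ℕ) (hn : 0 < n) (z w : GaussianInt) (hz : z.norm = n)
    (hw : w.norm = n)
    (h : ∀ p, p.Prime → p % 4 = 1 → p ∣ n → emultiplicity (gp p) z = emultiplicity (gp p) w) :
    Associated z w := by
  induction n using Nat.strong_induction_on generalizing z w with
  | _ n ih =>
  by_cases h1 : n = 1
  · subst h1
    have a1 : IsUnit z := Zsqrtd.norm_eq_one_iff.1 (by rw [hz]; rfl)
    have a2 : IsUnit w := Zsqrtd.norm_eq_one_iff.1 (by rw [hw]; rfl)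
    exact (associated_one_iff_isUnit.2 a1).trans (associated_one_iff_isUnit.2 a2).symm
  have step : ∀ (q : ℕ) (ϖ : GaussianInt), 1 < q → ϖ.norm = q → ϖ ∣ z → ϖ ∣ w →
      Associated z w := by
    rintro q ϖ hq hϖ ⟨z, rfl⟩ ⟨w, rfl⟩
    have hqn : q ∣ n := norm_dvd_of_dvd hϖ hz (Dvd.intro _ rfl)
    have hn' : 0 < n / q := Nat.div_pos (Nat.le_of_dvd hn hqn) (by omega)
    have hz' := norm_eq_div (by omega) hϖ hz
    have hw' := norm_eq_div (by omega) hϖ hw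
    refine (ih (n / q) (Nat.div_lt_self hn hq) hn' z w hz' hw' fun p hp h4 hpn => ?_).mul_left ϖ
    have := h p hp h4 (hpn.trans (Nat.div_dvd_of_dvd hqn))
    have hgp := norm_gp hp (by omega)
    rw [emultiplicity_mul (prime_of_norm_eq_prime hp hgp),
      emultiplicity_mul (prime_of_norm_eq_prime hp hgp)] at this
    exact (WithTop.add_left_inj
      (emultiplicity_ne_top_of_norm hp (by omega : 0 < q) hgp hϖ)).1 this
  set p := n.minFac with hpdef
  have hp : p.Prime := Nat.minFac_prime h1
  have hpn : p ∣ n := Nat.minFac_dvd n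
  have := Fact.mk hp
  by_cases h2 : p = 2
  · rw [h2] at hpn
    exact step 2 (gp 2) one_lt_two (norm_gp Nat.prime_two (by norm_num)) (dvd_gp_two hz hpn)
      (dvd_gp_two hw hpn)
  have hodd := hp.eq_two_or_odd.resolve_left h2
  by_cases h3 : p % 4 = 3
  · have hpr := GaussianInt.prime_of_nat_prime_of_mod_four_eq_three p h3
    have key : ∀ z : GaussianInt, z.norm = n → (p : GaussianInt) ∣ z := by
      intro z hz
      have hd : (p : GaussianInt) ∣ z * star z := by
        rw [mul_star_eq hz]
        exact Nat.cast_dvd_cast hpn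
      rcases hpr.dvd_or_dvd hd with h | ⟨c, hc⟩
      · exact h
      · refine ⟨star c, ?_⟩
        rw [← star_star z, hc, star_mul']
        simp
    refine step (p ^ 2) p (Nat.one_lt_pow two_ne_zero hp.one_lt) ?_ (key z hz) (key w hw)
    rw [Zsqrtd.norm_natCast]
    push_cast
    ring
  · have h4 : p % 4 = 1 := by omega
    have hgp := norm_gp hp h3
    have hm := h p hp h4 hpn
    by_cases hd : gp p ∣ z
    · have hd' : gp p ∣ w := by
        by_contra hd'
        rw [emultiplicity_eq_zero.2 hd', emultiplicity_eq_zero] at hm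
        exact hm hd
      exact step p _ hp.one_lt hgp hd hd'
    · have hd' : ¬ gp p ∣ w := by
        rw [emultiplicity_eq_zero.2 hd, eq_comm, emultiplicity_eq_zero] at hm
        exact hm
      exact step p (star (gp p)) hp.one_lt (by rw [Zsqrtd.norm_conj, hgp])
        ((dvd_or_star_dvd hp hgp hz hpn).resolve_left hd)
        ((dvd_or_star_dvd hp hgp hw hpn).resolve_left hd')

lemma card_latticePts_le_mul {p m : ℕ} (hp : p.Prime) (h : p % 4 ≠ 3) :
    (latticePts m).card ≤ (latticePts (p * m)).card := by
  have hgp := norm_gp hp h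
  rw [← card_circ, ← card_circ]
  refine Finset.card_le_card_of_injOn (fun z => gp p * z) (fun z hz => ?_)
    fun z _ w _ hzw => mul_left_cancel₀ (ne_zero_of_norm_eq hp.pos hgp) hzw
  rw [Finset.mem_coe, mem_circ] at hz ⊢
  rw [Zsqrtd.norm_mul, hgp, hz]
  push_cast
  rfl

lemma two_mul_card_latticePts_le {p j m : ℕ} (hp : p.Prime) (h : p % 4 = 1) (hj : 0 < j)
    (hm : ¬ p ∣ m) : 2 * (latticePts m).card ≤ (latticePts (p ^ j * m)).card := by
  have hgp := norm_gp hp (by omega)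
  have hst : (star (gp p)).norm = p := by rw [Zsqrtd.norm_conj, hgp]
  have hpr := prime_of_norm_eq_prime hp hst
  rw [← card_circ, ← card_circ]
  have hnorm : ∀ ϖ : GaussianInt, ϖ.norm = p → (ϖ ^ j).norm = (p ^ j : ℕ) := by
    intro ϖ h
    have := map_pow (Zsqrtd.normMonoidHom (d := -1)) ϖ j
    simp only [Zsqrtd.normMonoidHom, MonoidHom.coe_mk, OneHom.coe_mk] at this
    rw [this, h]
    push_cast
    rfl
  have himg : ∀ ϖ : GaussianInt, ϖ.norm = p →
      (circ m).image (fun z => ϖ ^ j * z) ⊆ circ (p ^ j * m) ∧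
      ((circ m).image (fun z => ϖ ^ j * z)).card = (circ m).card := by
    intro ϖ h
    constructor
    · intro w hw
      obtain ⟨z, hz, rfl⟩ := Finset.mem_image.1 hw
      rw [mem_circ] at hz ⊢
      rw [Zsqrtd.norm_mul, hnorm ϖ h, hz]
      push_cast
      rfl
    · exact Finset.card_image_of_injective _
        (mul_right_injective₀ (pow_ne_zero _ (ne_zero_of_norm_eq hp.pos h)))
  have hdisj : Disjoint ((circ m).image (fun z => gp p ^ j * z))
      ((circ m).image (fun z => star (gp p) ^ j * z)) := by
    rw [Finset.disjoint_left]
    rintro w h1 h2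
    obtain ⟨z, hz, rfl⟩ := Finset.mem_image.1 h1
    obtain ⟨y, hy, he⟩ := Finset.mem_image.1 h2
    rw [mem_circ] at hz
    have : star (gp p) ∣ gp p ^ j * z := by
      rw [← he]
      exact (dvd_pow_self _ hj.ne').mul_right y
    rcases hpr.dvd_or_dvd this with h3 | h3
    · exact not_star_dvd_self hp (by rintro rfl; omega) hgp (hpr.dvd_of_dvd_pow h3)
    · exact hm (norm_dvd_of_dvd hst hz h3)
  calc 2 * (circ m).card = ((circ m).image (fun z => gp p ^ j * z) ∪
        (circ m).image (fun z => star (gp p) ^ j * z)).card := by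
        rw [Finset.card_union_of_disjoint hdisj, (himg _ hgp).2, (himg _ hst).2, two_mul]
    _ ≤ _ := Finset.card_le_card (Finset.union_subset (himg _ hgp).1 (himg _ hst).1)

lemma two_pow_omegaOne_le (n : ℕ) (hn : n ∈ sumTwoSq) : 2 ^ omegaOne n ≤ (latticePts n).card := by
  induction n using Nat.strong_induction_on with
  | _ n ih =>
  by_cases h0 : ∃ p ∈ n.primeFactors, p % 4 = 1
  · obtain ⟨p, hpn, h1⟩ := h0
    have hp := Nat.prime_of_mem_primeFactors hpn
    have hn0 : n ≠ 0 := hn.1.ne'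
    obtain ⟨e, m, hm, hnm⟩ := Nat.exists_eq_pow_mul_and_not_dvd hn0 p hp.ne_one
    have he : 0 < e := Nat.pos_of_ne_zero (by
      rintro rfl
      rw [pow_zero, one_mul] at hnm
      exact hm (hnm ▸ Nat.dvd_of_mem_primeFactors hpn))
    have hmS : m ∈ sumTwoSq := mem_sumTwoSq_of_pow_mul hp hm (hnm ▸ hn)
    have hm0 : 0 < m := hmS.1
    have hlt : m < n := by
      rw [hnm]
      have := Nat.one_lt_pow he.ne' hp.one_lt
      nlinarith
    have ho : omegaOne n = omegaOne m + 1 := by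
      have key : ∀ n, splitProd (fun _ _ => 2) n = 2 ^ omegaOne n := by
        intro n; simp [splitProd, omegaOne]
      have := splitProd_pow_mul (fun _ _ => 2) hp he hm
      rw [key, key, if_pos h1, ← hnm, ← pow_succ'] at this
      have h2 : 2 ^ omegaOne n = 2 ^ (omegaOne m + 1) := by exact_mod_cast this
      exact Nat.pow_right_injective le_rfl h2
    rw [ho, pow_succ']
    refine (Nat.mul_le_mul_left 2 (ih m hlt hmS)).trans ?_
    rw [hnm]
    exact two_mul_card_latticePts_le hp h1 he hm
  · have : omegaOne n = 0 := by
      rw [omegaOne, Finset.card_eq_zero, Finset.filter_eq_empty_iff]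
      exact fun p hp h => h0 ⟨p, hp, h⟩
    rw [this, pow_zero, Nat.one_le_iff_ne_zero, Finset.card_ne_zero]
    obtain ⟨_, a, b, hab⟩ := hn
    exact ⟨(a, b), mem_latticePts.2 hab.symm⟩

open scoped Classical in
/-- The set of split primes `p > P` dividing `n` whose chosen Gaussian prime divides `ξ`. -/
def splitClass (P n : ℕ) (ξ : ℤ × ℤ) : Finset ℕ :=
  n.primeFactors.filter fun p => (p % 4 = 1 ∧ P < p) ∧ gp p ∣ toG ξ

lemma splitClass_neg (P n : ℕ) (ξ : ℤ × ℤ) : splitClass P n (-ξ) = splitClass P n ξ := by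
  classical
  exact Finset.filter_congr fun p _ => by rw [map_neg, dvd_neg]

lemma card_associated_le (s : Finset GaussianInt) (h : ∀ z ∈ s, ∀ w ∈ s, Associated z w) :
    s.card ≤ 4 := by
  rcases s.eq_empty_or_nonempty with rfl | ⟨z, hz⟩
  · simp
  have h4 : (circ 1).card = 4 := by rw [card_circ]; decide
  have hs : s ⊆ (circ 1).image fun u => z * u := by
    intro w hw
    obtain ⟨u, hu⟩ := h z hz w hw
    refine Finset.mem_image.2 ⟨u, ?_, hu⟩
    rw [mem_circ]
    have := Zsqrtd.norm_eq_one_iff.2 u.isUnit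
    have h0 := GaussianInt.norm_nonneg (u : GaussianInt)
    push_cast
    omega
  exact ((Finset.card_le_card hs).trans Finset.card_image_le).trans h4.le

/-- Bound for the number of lattice points in a class. -/
lemma card_splitClass_le {P n : ℕ} (hn : 0 < n)
    (hsq : ∀ p, p.Prime → p % 4 = 1 → P < p → ¬ p ^ 2 ∣ n) (σ : Finset ℕ) :
    ((latticePts n).filter fun ξ => splitClass P n ξ = σ).card ≤ 4 * smallSplit P n := by
  classical
  set s := (latticePts n).filter fun ξ => splitClass P n ξ = σ with hs
  set T : Finset ℕ := n.primeFactors.filter fun p => p % 4 = 1 ∧ p ≤ P with hT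
  set f : ℤ × ℤ → (p : ℕ) → p ∈ T → ℕ := fun ξ p _ => multiplicity (gp p) (toG ξ) with hf
  have hnorm : ∀ ξ ∈ latticePts n, (toG ξ).norm = n := by
    intro ξ h
    rw [norm_toG, mem_latticePts.1 h]
  have hfin : ∀ ξ ∈ latticePts n, ∀ p, p.Prime → p % 4 = 1 →
      FiniteMultiplicity (gp p) (toG ξ) := by
    intro ξ hξ p hp h4
    exact FiniteMultiplicity.of_prime_left (prime_of_norm_eq_prime hp (norm_gp hp (by omega)))
      (ne_zero_of_norm_eq hn (hnorm ξ hξ))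
  have hpow : ∀ ξ ∈ latticePts n, ∀ p, p.Prime → p % 4 = 1 → ∀ k, gp p ^ k ∣ toG ξ →
      p ^ k ∣ n := by
    intro ξ hξ p hp h4 k ⟨c, hc⟩
    have h1 := hnorm ξ hξ
    have h2 := map_pow (Zsqrtd.normMonoidHom (d := -1)) (gp p) k
    simp only [Zsqrtd.normMonoidHom, MonoidHom.coe_mk, OneHom.coe_mk] at h2
    rw [hc, Zsqrtd.norm_mul, h2, norm_gp hp (by omega)] at h1
    exact_mod_cast Dvd.intro _ h1
  have himg : s.image f ⊆ T.pi fun p => Finset.range (n.factorization p + 1) := by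
    intro g hg
    obtain ⟨ξ, hξ, rfl⟩ := Finset.mem_image.1 hg
    rw [Finset.mem_pi]
    intro p hpT
    rw [hT, Finset.mem_filter] at hpT
    have hp := Nat.prime_of_mem_primeFactors hpT.1
    rw [Finset.mem_range, Nat.lt_succ_iff, ← hp.pow_dvd_iff_le_factorization hn.ne']
    rw [hs, Finset.mem_filter] at hξ
    exact hpow ξ hξ.1 p hp hpT.2.1 _ (pow_multiplicity_dvd _ _)
  have hcard : (s.image f).card ≤ smallSplit P n := by
    refine (Finset.card_le_card himg).trans ?_
    rw [Finset.card_pi]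
    simp [smallSplit, hT]
  refine (Finset.card_le_mul_card_image (f := f) s 4 fun g _ => ?_).trans
    (Nat.mul_le_mul_left 4 hcard)
  rw [← Finset.card_map ⟨toG, toG_injective⟩]
  refine card_associated_le _ ?_
  intro z hz w hw
  simp only [Finset.mem_map, Finset.mem_filter, Function.Embedding.coeFn_mk, hs] at hz hw
  obtain ⟨ξ, ⟨⟨hξ, hσ⟩, hg⟩, rfl⟩ := hz
  obtain ⟨η, ⟨⟨hη, hσ'⟩, hg'⟩, rfl⟩ := hw
  refine associated_of_emultiplicity_eq n hn _ _ (hnorm ξ hξ) (hnorm η hη) fun p hp h4 hpn => ?_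
  have hpf : p ∈ n.primeFactors := Nat.mem_primeFactors.2 ⟨hp, hpn, hn.ne'⟩
  rcases le_or_gt p P with hle | hlt
  · have hpT : p ∈ T := by rw [hT, Finset.mem_filter]; exact ⟨hpf, h4, hle⟩
    have h1 := congrFun (congrFun (hg.trans hg'.symm) p) hpT
    simp only [hf] at h1
    rw [(hfin ξ hξ p hp h4).emultiplicity_eq_multiplicity,
      (hfin η hη p hp h4).emultiplicity_eq_multiplicity, h1]
  · have hiff : gp p ∣ toG ξ ↔ gp p ∣ toG η := by
      have : p ∈ splitClass P n ξ ↔ p ∈ splitClass P n η := by rw [hσ, hσ']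
      simpa only [splitClass, Finset.mem_filter, hpf, h4, hlt, true_and] using this
    have hone : ∀ ξ ∈ latticePts n, gp p ∣ toG ξ → emultiplicity (gp p) (toG ξ) = (1 : ℕ) := by
      intro ξ hξ hd
      rw [emultiplicity_eq_coe]
      exact ⟨by rwa [pow_one], fun h => hsq p hp h4 hlt (hpow ξ hξ p hp h4 2 h)⟩
    by_cases hd : gp p ∣ toG ξ
    · rw [hone ξ hξ hd, hone η hη (hiff.1 hd)]
    · rw [emultiplicity_eq_zero.2 hd, emultiplicity_eq_zero.2 fun h => hd (hiff.2 h)]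

/-- All sums of `k` elements of `insert 0 T`. -/
def sumSet (T : Finset GaussianInt) : ℕ → Finset GaussianInt
  | 0 => {0}
  | k + 1 => Finset.image₂ (· + ·) (insert 0 T) (sumSet T k)

lemma card_sumSet_le (T : Finset GaussianInt) (k : ℕ) : (sumSet T k).card ≤ (T.card + 1) ^ k := by
  induction k with
  | zero => simp [sumSet]
  | succ k ih =>
    rw [sumSet, pow_succ']
    exact (Finset.card_image₂_le _ _ _).trans (Nat.mul_le_mul (Finset.card_insert_le _ _) ih)

lemma sum_mem_sumSet {ι : Type*} (T : Finset GaussianInt) (s : Finset ι) (f : ι → GaussianInt)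
    (hf : ∀ i ∈ s, f i ∈ T) {k : ℕ} (hk : s.card ≤ k) : ∑ i ∈ s, f i ∈ sumSet T k := by
  classical
  induction k generalizing s with
  | zero =>
    rw [Finset.card_eq_zero.1 (Nat.le_zero.1 hk)]
    simp [sumSet]
  | succ k ih =>
    rw [sumSet, Finset.mem_image₂]
    rcases s.eq_empty_or_nonempty with rfl | ⟨i, hi⟩
    · exact ⟨0, Finset.mem_insert_self _ _, 0,
        by simpa using ih ∅ (by simp) (by simp), by simp⟩
    · refine ⟨f i, Finset.mem_insert_of_mem (hf i hi), _, ih (s.erase i)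
        (fun j hj => hf j (Finset.mem_of_mem_erase hj)) ?_, Finset.add_sum_erase s f hi⟩
      rw [Finset.card_erase_of_mem hi]
      omega

/-- `p` is exceptional for `m` if there is a nontrivial short relation `π A + π̄ B = 0` with `A`,
`B` sums of Gaussian integers of norm `m`. -/
def Exceptional (L m p : ℕ) : Prop :=
  ∃ A ∈ sumSet (circ m) L, ∃ B ∈ sumSet (circ m) L, A ≠ 0 ∧ gp p * A + star (gp p) * B = 0

lemma card_exceptional_le (L m : ℕ) (F : Finset ℕ)
    (hF : ∀ p ∈ F, p.Prime ∧ p % 4 = 1 ∧ Exceptional L m p) :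
    F.card ≤ ((latticePts m).card + 1) ^ (2 * L) := by
  have hch : ∀ p, ∃ AB : GaussianInt × GaussianInt, p ∈ F →
      AB.1 ∈ sumSet (circ m) L ∧ AB.2 ∈ sumSet (circ m) L ∧ AB.1 ≠ 0 ∧
        gp p * AB.1 + star (gp p) * AB.2 = 0 := by
    intro p
    by_cases hp : p ∈ F
    · obtain ⟨A, hA, B, hB, h1, h2⟩ := (hF p hp).2.2
      exact ⟨(A, B), fun _ => ⟨hA, hB, h1, h2⟩⟩
    · exact ⟨0, fun h => absurd h hp⟩
  choose AB hAB using hch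
  have hcard : F.card ≤ (sumSet (circ m) L ×ˢ sumSet (circ m) L).card := by
    refine Finset.card_le_card_of_injOn AB (fun p hp => ?_) fun p hp q hq h => ?_
    · exact Finset.mem_product.2 ⟨(hAB p hp).1, (hAB p hp).2.1⟩
    · obtain ⟨-, -, hA, h1⟩ := hAB p hp
      obtain ⟨-, -, -, h2⟩ := hAB q hq
      rw [← h] at h2
      have hp' := (hF p hp).1
      have hq' := (hF q hq).1
      have hgp := norm_gp hp' (by have := (hF p hp).2.1; omega)
      have hgq := norm_gp hq' (by have := (hF q hq).2.1; omega)
      by_contra hne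
      have e : gp p * star (gp q) = gp q * star (gp p) := by
        have hB : (gp p * star (gp q) - gp q * star (gp p)) * (AB p).1 = 0 := by
          linear_combination star (gp q) * h1 - star (gp p) * h2
        exact sub_eq_zero.1 ((mul_eq_zero.1 hB).resolve_right hA)
      have hd : star (gp p) ∣ gp p * star (gp q) := Dvd.intro_left _ e.symm
      have hst : (star (gp p)).norm = p := by rw [Zsqrtd.norm_conj, hgp]
      rcases (prime_of_norm_eq_prime hp' hst).dvd_or_dvd hd with h3 | h3
      · exact not_star_dvd_self hp' (by rintro rfl; have := (hF 2 hp).2.1; omega) hgp h3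
      · have := norm_dvd_of_dvd hst (by rw [Zsqrtd.norm_conj, hgq]) h3
        exact hne ((Nat.prime_dvd_prime_iff_eq hp' hq').1 this)
  refine hcard.trans ?_
  rw [Finset.card_product, two_mul, pow_add, ← card_circ]
  exact Nat.mul_le_mul (card_sumSet_le _ _) (card_sumSet_le _ _)

/-- Vanishing sums of at most `J` elements of `Λ` split into vanishing sums over the classes of
`cls`. -/
def Splits {κ : Type*} [DecidableEq κ] (Λ : Finset (ℤ × ℤ)) (cls : ℤ × ℤ → κ) (J : ℕ) : Prop :=
  (∀ ξ, cls (-ξ) = cls ξ) ∧ ∀ j ≤ J, ∀ ξ : Fin j → ℤ × ℤ, (∀ i, ξ i ∈ Λ) → ∑ i, ξ i = 0 →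
    ∀ σ, ∑ i with cls (ξ i) = σ, ξ i = 0

lemma sum_dvd_eq_zero {n p L : ℕ} (hp : p.Prime) (h4 : p % 4 = 1) (hpn : p ∣ n)
    (hE : ¬ Exceptional L (n / p) p) {ι : Type*} (s : Finset ι)
    (hs : s.card ≤ L) (z : ι → GaussianInt) (hz : ∀ i ∈ s, z i ∈ circ n) (h0 : ∑ i ∈ s, z i = 0)
    [DecidablePred fun i => gp p ∣ z i] :
    ∑ i ∈ s with gp p ∣ z i, z i = 0 := by
  have hgp := norm_gp hp (by omega)
  have hst : (star (gp p)).norm = p := by rw [Zsqrtd.norm_conj, hgp]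
  have hch : ∀ i, ∃ a, i ∈ s → a ∈ circ (n / p) ∧
      z i = (if gp p ∣ z i then gp p else star (gp p)) * a := by
    intro i
    by_cases hi : i ∈ s
    · have hzi := mem_circ.1 (hz i hi)
      split_ifs with hd
      · obtain ⟨a, ha⟩ := hd
        exact ⟨a, fun _ => ⟨mem_circ.2 (norm_eq_div hp.pos hgp (ha ▸ hzi)), ha⟩⟩
      · obtain ⟨a, ha⟩ := (dvd_or_star_dvd hp hgp hzi hpn).resolve_left hd
        exact ⟨a, fun _ => ⟨mem_circ.2 (norm_eq_div hp.pos hst (ha ▸ hzi)), ha⟩⟩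
    · exact ⟨0, fun h => absurd h hi⟩
  choose a ha using hch
  have h1 : ∑ i ∈ s with gp p ∣ z i, z i = gp p * ∑ i ∈ s with gp p ∣ z i, a i := by
    rw [Finset.mul_sum]
    refine Finset.sum_congr rfl fun i hi => ?_
    rw [Finset.mem_filter] at hi
    have := (ha i hi.1).2
    rwa [if_pos hi.2] at this
  have h2 : ∑ i ∈ s with ¬ gp p ∣ z i, z i = star (gp p) * ∑ i ∈ s with ¬ gp p ∣ z i, a i := by
    rw [Finset.mul_sum]
    refine Finset.sum_congr rfl fun i hi => ?_
    rw [Finset.mem_filter] at hi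
    have := (ha i hi.1).2
    rwa [if_neg hi.2] at this
  rw [h1]
  by_contra hne
  refine hE ⟨_, sum_mem_sumSet _ (s.filter fun i => gp p ∣ z i) a
    (fun i hi => (ha i (Finset.mem_filter.1 hi).1).1) ((Finset.card_filter_le _ _).trans hs), _,
    sum_mem_sumSet _ (s.filter fun i => ¬ gp p ∣ z i) a
    (fun i hi => (ha i (Finset.mem_filter.1 hi).1).1) ((Finset.card_filter_le _ _).trans hs),
    right_ne_zero_of_mul hne, ?_⟩
  rw [← h1, ← h2, Finset.sum_filter_add_sum_filter_not, h0]

lemma splits_splitClass {P n J : ℕ}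
    (hE : ∀ p, p.Prime → p % 4 = 1 → P < p → p ∣ n → ¬ Exceptional J (n / p) p) :
    Splits (latticePts n) (splitClass P n) J := by
  classical
  refine ⟨splitClass_neg P n, fun j hj ξ hξ h0 σ => ?_⟩
  have key : ∀ Q : Finset ℕ, (∀ p ∈ Q, p.Prime ∧ p % 4 = 1 ∧ P < p ∧ p ∣ n) →
      ∑ i with ∀ p ∈ Q, (gp p ∣ toG (ξ i) ↔ p ∈ σ), toG (ξ i) = 0 := by
    intro Q
    induction Q using Finset.induction_on with
    | empty =>
      intro _
      simp only [Finset.notMem_empty, false_implies, implies_true, Finset.filter_true]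
      rw [← map_sum, h0, map_zero]
    | insert p Q _ ih =>
      intro hQ
      have ih' := ih fun q hq => hQ q (Finset.mem_insert_of_mem hq)
      obtain ⟨hp, h4, hP, hpn⟩ := hQ p (Finset.mem_insert_self _ _)
      have h1 := sum_dvd_eq_zero hp h4 hpn (hE p hp h4 hP hpn) _
        ((Finset.card_filter_le _ _).trans (by simpa using hj)) (fun i => toG (ξ i))
        (fun i _ => mem_circ.2 (by rw [norm_toG, mem_latticePts.1 (hξ i)])) ih'
      have h2 := Finset.sum_filter_add_sum_filter_not
        (Finset.univ.filter fun i => ∀ p ∈ Q, (gp p ∣ toG (ξ i) ↔ p ∈ σ))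
        (fun i => gp p ∣ toG (ξ i)) (fun i => toG (ξ i))
      rw [h1, ih', zero_add] at h2
      rw [Finset.filter_filter] at h1 h2
      by_cases hpσ : p ∈ σ
      · rw [← h1]
        refine Finset.sum_congr (Finset.filter_congr fun i _ => ?_) fun _ _ => rfl
        rw [Finset.forall_mem_insert, and_comm]
        simp [hpσ]
      · rw [← h2]
        refine Finset.sum_congr (Finset.filter_congr fun i _ => ?_) fun _ _ => rfl
        rw [Finset.forall_mem_insert, and_comm]
        simp [hpσ]
  by_cases hσ : σ ⊆ n.primeFactors.filter fun p => p % 4 = 1 ∧ P < p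
  · have h1 := key (n.primeFactors.filter fun p => p % 4 = 1 ∧ P < p) fun p hp => by
      rw [Finset.mem_filter] at hp
      exact ⟨Nat.prime_of_mem_primeFactors hp.1, hp.2.1, hp.2.2, Nat.dvd_of_mem_primeFactors hp.1⟩
    apply toG_injective
    rw [map_zero, map_sum, ← h1]
    refine Finset.sum_congr (Finset.filter_congr fun i _ => ?_) fun _ _ => rfl
    constructor
    · rintro rfl p hp
      rw [Finset.mem_filter] at hp
      simp [splitClass, hp.1, hp.2.1, hp.2.2]
    · intro h
      ext p
      constructor
      · intro hp
        simp only [splitClass, Finset.mem_filter] at hp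
        exact (h p (Finset.mem_filter.2 ⟨hp.1, hp.2.1⟩)).1 hp.2.2
      · intro hp
        have hp' := Finset.mem_filter.1 (hσ hp)
        simp only [splitClass, Finset.mem_filter]
        exact ⟨hp'.1, hp'.2, (h p (hσ hp)).2 hp⟩
  · rw [Finset.sum_eq_zero]
    intro i hi
    rw [Finset.mem_filter] at hi
    refine absurd (fun p hp => ?_) hσ
    rw [← hi.2] at hp
    simp only [splitClass, Finset.mem_filter] at hp
    exact Finset.mem_filter.2 ⟨hp.1, hp.2.1⟩

lemma sum_inv_sq_Ioc_le {P : ℕ} (hP : 0 < P) (N : ℕ) :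
    ∑ n ∈ Finset.Ioc P N, 1 / (n : ℝ) ^ 2 ≤ 1 / (P : ℝ) := by
  have hP' : (0 : ℝ) < P := by exact_mod_cast hP
  have key : ∀ N : ℕ, P ≤ N →
      ∑ n ∈ Finset.Ioc P N, 1 / (n : ℝ) ^ 2 ≤ 1 / (P : ℝ) - 1 / (N : ℝ) := by
    intro N hN
    induction N, hN using Nat.le_induction with
    | base => simp
    | succ N hN ih =>
      rw [Finset.sum_Ioc_succ_top (by omega)]
      have h0 : (0 : ℝ) < N := by exact_mod_cast (hP.trans_le hN)
      have : 1 / ((N + 1 : ℕ) : ℝ) ^ 2 ≤ 1 / N - 1 / (N + 1 : ℕ) := by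
        push_cast
        rw [div_sub_div _ _ h0.ne' (by positivity), div_le_div_iff₀ (by positivity) (by positivity)]
        nlinarith
      linarith
  rcases le_total P N with h | h
  · have : (0 : ℝ) ≤ 1 / N := by positivity
    linarith [key N h]
  · rw [Finset.Ioc_eq_empty_of_le h, Finset.sum_empty]
    positivity

/-- The properties of `n` that make the classes of `splitClass P n` small and splitting. -/
def TierGood (P J n : ℕ) : Prop :=
  (∀ p, p.Prime → p % 4 = 1 → P < p → ¬ p ^ 2 ∣ n) ∧
  (∀ p, p.Prime → p % 4 = 1 → P < p → p ∣ n → ¬ Exceptional J (n / p) p) ∧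
  (smallSplit P n : ℝ) ≤ Real.log P

open scoped Classical in
lemma exists_card_not_tierGood_le :
    ∃ C : ℝ, 0 < C ∧ ∀ X P J t : ℕ, 3 ≤ X → 3 ≤ P →
      (((SX X).filter fun n => (latticePts n).card ≤ t ∧ ¬ TierGood P J n).card : ℝ) ≤
        X / P + X / P * ((t : ℝ) + 1) ^ (2 * J) +
          C * X * Real.log X ^ (-(1 / 2) : ℝ) * Real.log P ^ (-(1 / 2) : ℝ) := by
  obtain ⟨C, hC, h⟩ := exists_card_smallSplit_le
  refine ⟨C, hC, fun X P J t hX hP => ?_⟩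
  have hP0 : (0 : ℝ) < P := by exact_mod_cast (by omega : 0 < P)
  set A' : Finset ℕ := (Finset.Ioc P X).biUnion fun p => (Finset.Ioc 0 X).filter fun n => p ^ 2 ∣ n
    with hA'
  set B : Finset ℕ := (Finset.Ioc 0 (X / P)).biUnion fun m =>
    ((Finset.Ioc 0 X).filter fun p => (latticePts m).card ≤ t ∧ p.Prime ∧ p % 4 = 1 ∧
      Exceptional J m p).image fun p => p * m with hB
  set D : Finset ℕ := (SX X).filter fun n => Real.log P ≤ (smallSplit P n : ℝ) with hD
  have hsub : ((SX X).filter fun n => (latticePts n).card ≤ t ∧ ¬ TierGood P J n) ⊆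
      A' ∪ B ∪ D := by
    intro n hn
    rw [Finset.mem_filter] at hn
    obtain ⟨hnS, hnt, hng⟩ := hn
    obtain ⟨hS, hnX⟩ := mem_SX.1 hnS
    have hn0 : 0 < n := hS.1
    rw [Finset.mem_union, Finset.mem_union]
    by_contra hcon
    push Not at hcon
    obtain ⟨⟨h1, h2⟩, h3⟩ := hcon
    refine hng ⟨fun p hp h4 hPp hd => h1 ?_, fun p hp h4 hPp hd hE => h2 ?_, ?_⟩
    · rw [hA', Finset.mem_biUnion]
      refine ⟨p, Finset.mem_Ioc.2 ⟨hPp, ?_⟩, Finset.mem_filter.2 ⟨Finset.mem_Ioc.2 ⟨hn0, hnX⟩, hd⟩⟩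
      exact (Nat.le_of_dvd hn0 ((dvd_pow_self p two_ne_zero).trans hd)).trans hnX
    · rw [hB, Finset.mem_biUnion]
      obtain ⟨m, rfl⟩ := hd
      rw [Nat.mul_div_cancel_left _ hp.pos] at hE
      have hm0 : 0 < m := Nat.pos_of_mul_pos_left hn0
      refine ⟨m, Finset.mem_Ioc.2 ⟨hm0, ?_⟩, Finset.mem_image.2 ⟨p, Finset.mem_filter.2
        ⟨Finset.mem_Ioc.2 ⟨hp.pos, ?_⟩, ?_, hp, h4, hE⟩, rfl⟩⟩
      · rw [Nat.le_div_iff_mul_le (by omega)]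
        nlinarith
      · nlinarith
      · exact (card_latticePts_le_mul hp (by omega)).trans hnt
    · by_contra hlt
      exact h3 (Finset.mem_filter.2 ⟨hnS, (not_le.1 hlt).le⟩)
  have cA : (A'.card : ℝ) ≤ X / P := by
    have h1 : (A'.card : ℝ) ≤ ∑ p ∈ Finset.Ioc P X, ((X / p ^ 2 : ℕ) : ℝ) := by
      have : A'.card ≤ ∑ p ∈ Finset.Ioc P X, X / p ^ 2 := by
        refine Finset.card_biUnion_le.trans (Finset.sum_le_sum fun p _ => ?_)
        rw [Nat.Ioc_filter_dvd_card_eq_div]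
      exact_mod_cast this
    refine h1.trans ?_
    calc ∑ p ∈ Finset.Ioc P X, ((X / p ^ 2 : ℕ) : ℝ) ≤
        ∑ p ∈ Finset.Ioc P X, (X : ℝ) * (1 / (p : ℝ) ^ 2) := by
          refine Finset.sum_le_sum fun p _ => ?_
          refine Nat.cast_div_le.trans (le_of_eq ?_)
          push_cast
          ring
      _ ≤ X * (1 / P) := by
          rw [← Finset.mul_sum]
          gcongr
          exact sum_inv_sq_Ioc_le (by omega) X
      _ = _ := by ring
  have cB : (B.card : ℝ) ≤ X / P * ((t : ℝ) + 1) ^ (2 * J) := by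
    have h1 : B.card ≤ (X / P) * (t + 1) ^ (2 * J) := by
      refine Finset.card_biUnion_le.trans ?_
      refine (Finset.sum_le_card_nsmul _ _ ((t + 1) ^ (2 * J)) fun m _ => ?_).trans
        (by rw [Nat.card_Ioc, tsub_zero, smul_eq_mul])
      refine Finset.card_image_le.trans ?_
      by_cases hmt : (latticePts m).card ≤ t
      · refine (card_exceptional_le J m _ fun p hp => ?_).trans
          (Nat.pow_le_pow_left (Nat.succ_le_succ hmt) _)
        exact (Finset.mem_filter.1 hp).2.2
      · simp [hmt]
    calc (B.card : ℝ) ≤ ((X / P : ℕ) : ℝ) * ((t : ℝ) + 1) ^ (2 * J) := by exact_mod_cast h1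
      _ ≤ _ := by
        gcongr
        exact Nat.cast_div_le
  have cU : (((SX X).filter fun n => (latticePts n).card ≤ t ∧ ¬ TierGood P J n).card : ℝ) ≤
      A'.card + B.card + D.card := by
    have := (Finset.card_le_card hsub).trans ((Finset.card_union_le _ _).trans
      (Nat.add_le_add_right (Finset.card_union_le _ _) _))
    exact_mod_cast this
  linarith [h X P hX hP]

lemma TierGood.card_le {P J n : ℕ} (hn : 0 < n) (h : TierGood P J n) (σ : Finset ℕ) :
    (((latticePts n).filter fun ξ => splitClass P n ξ = σ).card : ℝ) ≤ 4 * Real.log P := by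
  have h1 : (((latticePts n).filter fun ξ => splitClass P n ξ = σ).card : ℝ) ≤
      4 * (smallSplit P n : ℝ) := by exact_mod_cast card_splitClass_le hn h.1 σ
  linarith [h.2.2]

/-- The arithmetic properties of the eigenvalue used in the analysis. -/
def Good (K₀ a J n : ℕ) : Prop :=
  ∃ K ≥ K₀, ∃ D : ℕ, ∃ cls₁ cls₂ : ℤ × ℤ → Finset ℕ,
    (∀ σ, ((latticePts n).filter fun ξ => cls₁ ξ = σ).card ≤ D) ∧
    Splits (latticePts n) cls₁ (32 * K ^ a) ∧
    1600 * K ^ a * D ^ 2 ≤ (latticePts n).card ∧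
    ((latticePts n).card : ℝ) ≤ Real.exp (4 * K) ∧
    (∀ ξ ∈ latticePts n, ∀ η ∈ latticePts n, ξ ≠ η →
      Real.exp (-(4 * K)) * √n ≤ |(ξ.1 : ℝ) - η.1| ∨ Real.exp (-(4 * K)) * √n ≤ |(ξ.2 : ℝ) - η.2|) ∧
    (∀ σ, ((latticePts n).filter fun ξ => cls₂ ξ = σ).card ≤ K ^ 3) ∧
    Splits (latticePts n) cls₂ J

open scoped Classical in
lemma exists_card_not_tierGood_exp_le :
    ∃ C : ℝ, 0 < C ∧ ∀ X K J t P : ℕ, ∀ E : ℝ, 3 ≤ X → 2 ≤ K → Real.exp K ≤ Real.log X →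
      Real.log X < Real.exp (K + 1) → t = ⌊Real.log X ^ 2⌋₊ → P = ⌈Real.exp E⌉₊ →
      12 * J * K + 2 * (K : ℝ) ≤ E →
      (((SX X).filter fun n => (latticePts n).card ≤ t ∧ ¬ TierGood P J n).card : ℝ) ≤
        C * (X * Real.log X ^ (-(1 / 2) : ℝ) * (K : ℝ) ^ (-(1 / 2) : ℝ)) := by
  obtain ⟨C, hC, h⟩ := exists_card_not_tierGood_le
  refine ⟨2 + C, by positivity, fun X K J t P E hX hK h1 h2 ht hP hE => ?_⟩
  have hK2 : (2 : ℝ) ≤ K := by exact_mod_cast hK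
  have hJ0 : (0 : ℝ) ≤ 12 * J * K := by positivity
  have hPE : Real.exp E ≤ P := by rw [hP]; exact Nat.le_ceil _
  have hE2 : (2 : ℝ) ≤ E := by linarith
  have hP3 : 3 ≤ P := by
    have : (3 : ℝ) ≤ P := by linarith [Real.add_one_le_exp E]
    exact_mod_cast this
  have hP0 : (0 : ℝ) < P := by exact_mod_cast (by omega : 0 < P)
  have hlP : E ≤ Real.log P := (Real.le_log_iff_exp_le hP0).2 hPE
  set x := Real.log X with hx
  have hx0 : 0 < x := (Real.exp_pos _).trans_le h1
  have ht1 : (t : ℝ) + 1 ≤ Real.exp (6 * K) := by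
    have h3 : (t : ℝ) ≤ x ^ 2 := by rw [ht]; exact Nat.floor_le (by positivity)
    have h4 : x ^ 2 ≤ Real.exp (2 * (K + 1)) := by
      calc x ^ 2 ≤ Real.exp (K + 1) ^ 2 := by gcongr
        _ = _ := by rw [← Real.exp_nat_mul]; norm_num
    have h5 : (1 : ℝ) ≤ Real.exp (2 * (K + 1)) := Real.one_le_exp (by positivity)
    have h6 : Real.exp (6 * K) = Real.exp (2 * (K + 1)) * Real.exp (4 * K - 2) := by
      rw [← Real.exp_add]; ring_nf
    have h7 := Real.add_one_le_exp (4 * (K : ℝ) - 2)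
    rw [h6]
    nlinarith
  have ht2 : ((t : ℝ) + 1) ^ (2 * J) ≤ Real.exp (12 * J * K) := by
    calc _ ≤ Real.exp (6 * K) ^ (2 * J) := by gcongr
      _ = _ := by rw [← Real.exp_nat_mul]; push_cast; ring_nf
  have hxh : Real.exp (-K) ≤ x ^ (-(1 / 2) : ℝ) := by
    calc Real.exp (-K) ≤ Real.exp (K + 1) ^ (-(1 / 2) : ℝ) := by
          rw [← Real.exp_mul, Real.exp_le_exp]; linarith
      _ ≤ _ := Real.rpow_le_rpow_of_nonpos hx0 h2.le (by norm_num)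
  have hKh : Real.exp (-K) ≤ (K : ℝ) ^ (-(1 / 2) : ℝ) := by
    have hK0 : (0 : ℝ) < K := by linarith
    rw [Real.rpow_def_of_pos hK0, Real.exp_le_exp]
    linarith [Real.log_le_sub_one_of_pos hK0]
  have hPh : Real.log P ^ (-(1 / 2) : ℝ) ≤ (K : ℝ) ^ (-(1 / 2) : ℝ) :=
    Real.rpow_le_rpow_of_nonpos (by linarith) (by linarith) (by norm_num)
  have hmain : (1 : ℝ) / P * Real.exp (12 * J * K) ≤
      x ^ (-(1 / 2) : ℝ) * (K : ℝ) ^ (-(1 / 2) : ℝ) := by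
    calc (1 : ℝ) / P * Real.exp (12 * J * K) ≤ 1 / Real.exp E * Real.exp (12 * J * K) := by gcongr
      _ = Real.exp (12 * J * K - E) := by rw [Real.exp_sub]; ring
      _ ≤ Real.exp (-K) * Real.exp (-K) := by
        rw [← Real.exp_add, Real.exp_le_exp]; linarith
      _ ≤ _ := by gcongr
  have hX0 : (0 : ℝ) ≤ X := Nat.cast_nonneg X
  have hx1 : 0 ≤ x ^ (-(1 / 2) : ℝ) := by positivity
  have e1 : (X : ℝ) / P ≤ X / P * Real.exp (12 * J * K) :=
    le_mul_of_one_le_right (by positivity) (Real.one_le_exp hJ0)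
  have e2 : (X : ℝ) / P * ((t : ℝ) + 1) ^ (2 * J) ≤ X / P * Real.exp (12 * J * K) := by gcongr
  have e3 : (X : ℝ) / P * Real.exp (12 * J * K) ≤
      X * (x ^ (-(1 / 2) : ℝ) * (K : ℝ) ^ (-(1 / 2) : ℝ)) := by
    calc _ = X * (1 / P * Real.exp (12 * J * K)) := by ring
      _ ≤ _ := by gcongr
  have e4 : C * X * x ^ (-(1 / 2) : ℝ) * Real.log P ^ (-(1 / 2) : ℝ) ≤
      C * X * x ^ (-(1 / 2) : ℝ) * (K : ℝ) ^ (-(1 / 2) : ℝ) := by gcongr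
  have := h X P J t hX hP3
  linarith

lemma log_ceil_exp_le {E : ℝ} (hE : 0 ≤ E) : Real.log (⌈Real.exp E⌉₊ : ℝ) ≤ E + 1 := by
  have h0 : (0 : ℝ) < ⌈Real.exp E⌉₊ := by
    exact_mod_cast Nat.ceil_pos.2 (Real.exp_pos E)
  rw [Real.log_le_iff_le_exp h0]
  have h1 := (Nat.ceil_lt_add_one (Real.exp_pos E).le).le
  have h2 : 1 ≤ Real.exp E := Real.one_le_exp hE
  have h3 := Real.add_one_le_exp (1 : ℝ)
  rw [Real.exp_add]
  nlinarith

lemma good_of_tierGood {K₀ a J n X K : ℕ} (hn : n ∈ sumTwoSq) (hnX : n ≤ X) (hK₀ : K₀ ≤ K)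
    (hK : 2 ≤ K) (hKJ : 8 * (12 * J + 2) ≤ K)
    (hKa : (1600 : ℝ) * K ^ a * (8 * K ^ (a + 2)) ^ 2 ≤ Real.exp (K / 8))
    (h1 : Real.exp K ≤ Real.log X) (h2 : Real.log X < Real.exp (K + 1))
    (hω : ¬ (2 : ℝ) ^ omegaOne n ≤ Real.log X ^ (1 / 8 : ℝ))
    (hN : ¬ Real.log X ^ 2 ≤ (latticePts n).card)
    (hc : ¬ ClosePair ⌊√X / Real.log X ^ 2⌋₊ n)
    (ht1 : TierGood ⌈Real.exp ((K : ℝ) ^ (a + 2))⌉₊ (32 * K ^ a) n)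
    (ht2 : TierGood ⌈Real.exp ((12 * J + 2) * (K : ℝ))⌉₊ J n) : Good K₀ a J n := by
  have hK2 : (2 : ℝ) ≤ K := by exact_mod_cast hK
  have hx0 : 0 < Real.log X := (Real.exp_pos _).trans_le h1
  refine ⟨K, hK₀, 8 * K ^ (a + 2), splitClass ⌈Real.exp ((K : ℝ) ^ (a + 2))⌉₊ n,
    splitClass ⌈Real.exp ((12 * J + 2) * (K : ℝ))⌉₊ n, fun σ => ?_,
    splits_splitClass ht1.2.1, ?_, ?_, fun ξ hξ η hη hne => ?_, fun σ => ?_,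
    splits_splitClass ht2.2.1⟩
  · have h3 := ht1.card_le hn.1 σ
    have h4 := log_ceil_exp_le (E := (K : ℝ) ^ (a + 2)) (by positivity)
    have h5 : (1 : ℝ) ≤ (K : ℝ) ^ (a + 2) := one_le_pow₀ (by linarith)
    have : (((latticePts n).filter fun ξ =>
        splitClass ⌈Real.exp ((K : ℝ) ^ (a + 2))⌉₊ n ξ = σ).card : ℝ) ≤
        ((8 * K ^ (a + 2) : ℕ) : ℝ) := by
      push_cast
      linarith
    exact_mod_cast this
  · have h3 : (2 : ℝ) ^ omegaOne n ≤ (latticePts n).card := by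
      exact_mod_cast two_pow_omegaOne_le n hn
    have h4 : Real.exp (K / 8) ≤ Real.log X ^ (1 / 8 : ℝ) := by
      calc Real.exp (K / 8) = Real.exp K ^ (1 / 8 : ℝ) := by rw [← Real.exp_mul]; ring_nf
        _ ≤ _ := by gcongr
    have : ((1600 * K ^ a * (8 * K ^ (a + 2)) ^ 2 : ℕ) : ℝ) ≤ (latticePts n).card := by
      push_cast
      linarith
    exact_mod_cast this
  · calc ((latticePts n).card : ℝ) ≤ Real.log X ^ 2 := (not_le.1 hN).le
      _ ≤ Real.exp (K + 1) ^ 2 := by gcongr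
      _ = Real.exp (2 * (K + 1)) := by rw [← Real.exp_nat_mul]; norm_num
      _ ≤ _ := Real.exp_le_exp.2 (by linarith)
  · have key : Real.exp (-(4 * K)) * √n ≤ √X / Real.log X ^ 2 := by
      have h3 : Real.log X ^ 2 ≤ Real.exp (4 * K) := by
        calc Real.log X ^ 2 ≤ Real.exp (K + 1) ^ 2 := by gcongr
          _ = Real.exp (2 * (K + 1)) := by rw [← Real.exp_nat_mul]; norm_num
          _ ≤ _ := Real.exp_le_exp.2 (by linarith)
      rw [Real.exp_neg, le_div_iff₀ (by positivity)]
      calc (Real.exp (4 * K))⁻¹ * √n * Real.log X ^ 2 ≤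
            (Real.exp (4 * K))⁻¹ * √X * Real.exp (4 * K) := by gcongr
        _ = √X := by field_simp
    by_contra hcon
    push Not at hcon
    refine hc ⟨ξ, hξ, η, hη, hne, ?_, ?_⟩
    · have := Int.floor_le_floor (hcon.1.le.trans key)
      rw [← Int.natCast_floor_eq_floor (a := √(X : ℝ) / _) (by positivity)] at this
      have e : ⌊|(ξ.1 : ℝ) - η.1|⌋ = |ξ.1 - η.1| := by
        rw [show |(ξ.1 : ℝ) - η.1| = ((|ξ.1 - η.1| : ℤ) : ℝ) by push_cast; rfl, Int.floor_intCast]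
      rwa [e] at this
    · have := Int.floor_le_floor (hcon.2.le.trans key)
      rw [← Int.natCast_floor_eq_floor (a := √(X : ℝ) / _) (by positivity)] at this
      have e : ⌊|(ξ.2 : ℝ) - η.2|⌋ = |ξ.2 - η.2| := by
        rw [show |(ξ.2 : ℝ) - η.2| = ((|ξ.2 - η.2| : ℤ) : ℝ) by push_cast; rfl, Int.floor_intCast]
      rwa [e] at this
  · have h3 := ht2.card_le hn.1 σ
    have h4 := log_ceil_exp_le (E := (12 * J + 2) * (K : ℝ)) (by positivity)
    have h6 : (8 : ℝ) * (12 * J + 2) ≤ K := by exact_mod_cast hKJ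
    have h7 : (1 : ℝ) ≤ (12 * J + 2) * (K : ℝ) := by
      have : (0 : ℝ) ≤ 12 * J * K := by positivity
      nlinarith
    have h8 : (8 : ℝ) * (12 * J + 2) * K ≤ K ^ 3 := by
      calc (8 : ℝ) * (12 * J + 2) * K ≤ K * K := by gcongr
        _ = (K : ℝ) ^ 2 := by ring
        _ ≤ _ := pow_le_pow_right₀ (by linarith) (by norm_num)
    have : (((latticePts n).filter fun ξ =>
        splitClass ⌈Real.exp ((12 * J + 2) * (K : ℝ))⌉₊ n ξ = σ).card : ℝ) ≤
        ((K ^ 3 : ℕ) : ℝ) := by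
      push_cast
      linarith
    exact_mod_cast this

open scoped Classical in
lemma card_closePair_floor_le {X : ℕ} (hx1 : 1 ≤ Real.log X) (hX : Real.log X ^ 2 ≤ √X) :
    (((Finset.Ioc 0 X).filter fun n => ClosePair ⌊√X / Real.log X ^ 2⌋₊ n).card : ℝ) ≤
      13 * X / Real.log X := by
  set x := Real.log X with hx
  set H := ⌊√X / x ^ 2⌋₊ with hH
  have hx0 : 0 < x := by linarith
  have hq1 : 1 ≤ √X / x ^ 2 := by rwa [one_le_div (by positivity)]
  have hH1 : 1 ≤ H := Nat.le_floor (by simpa using hq1)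
  have hHle : (H : ℝ) ≤ √X / x ^ 2 := Nat.floor_le (by positivity)
  have hX1 : 1 ≤ √(X : ℝ) := le_trans (one_le_pow₀ hx1) hX
  have hXp : (0 : ℝ) < X := by
    by_contra h
    have : √(X : ℝ) = 0 := Real.sqrt_eq_zero_of_nonpos (not_lt.1 h)
    linarith
  have hs : ((Nat.sqrt (4 * X) : ℕ) : ℝ) ≤ 2 * √X := by
    have : (Nat.sqrt (4 * X) : ℝ) ≤ √((4 * X : ℕ) : ℝ) := Real.nat_sqrt_le_real_sqrt
    refine this.trans (le_of_eq ?_)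
    push_cast
    rw [Real.sqrt_mul (by norm_num), show (4 : ℝ) = 2 ^ 2 by norm_num, Real.sqrt_sq (by norm_num)]
  have hH0 : (1 : ℝ) ≤ H := by exact_mod_cast hH1
  have hlH : Real.log H ≤ x := by
    refine Real.log_le_log (by linarith) (hHle.trans ?_)
    calc √(X : ℝ) / x ^ 2 ≤ √X / 1 := by
          gcongr
          exact one_le_pow₀ hx1
      _ ≤ √X * √X := by nlinarith
      _ = X := Real.mul_self_sqrt hXp.le
  have hlH0 : 0 ≤ Real.log H := Real.log_nonneg hH0
  have hss : √(X : ℝ) * √X = X := Real.mul_self_sqrt hXp.le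
  have hHX : (H : ℝ) * √X ≤ X / x ^ 2 := by
    calc (H : ℝ) * √X ≤ √X / x ^ 2 * √X := by gcongr
      _ = √X * √X / x ^ 2 := by ring
      _ = _ := by rw [hss]
  have hH2 : (H : ℝ) ≤ √X := by
    refine hHle.trans (div_le_self (by positivity) (one_le_pow₀ hx1))
  have hx2 : X / x ^ 2 ≤ X / x := by
    gcongr
    nlinarith
  have hx3 : X / x ^ 2 * x = X / x := by field_simp
  have := card_closePair_le X H hH1 (fun n => ClosePair H n) fun _ h => h
  refine this.trans ?_
  have e1 : ((H : ℝ) + 1) * ((Nat.sqrt (4 * X) : ℕ) + 1) ≤ 6 * (X / x) := by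
    calc ((H : ℝ) + 1) * ((Nat.sqrt (4 * X) : ℕ) + 1) ≤ (2 * H) * (3 * √X) := by
          gcongr <;> linarith
      _ = 6 * (H * √X) := by ring
      _ ≤ _ := by linarith
  have e2 : (H : ℝ) * (Nat.sqrt (4 * X) : ℕ) * (1 + Real.log H) ≤ 4 * (X / x) := by
    calc (H : ℝ) * (Nat.sqrt (4 * X) : ℕ) * (1 + Real.log H) ≤ H * (2 * √X) * (2 * x) := by
          gcongr
          linarith
      _ = 4 * (H * √X * x) := by ring
      _ ≤ 4 * (X / x ^ 2 * x) := by gcongr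
      _ = _ := by rw [hx3]
  have e3 : (H : ℝ) ^ 2 ≤ X / x := by
    calc (H : ℝ) ^ 2 ≤ H * √X := by rw [sq]; gcongr
      _ ≤ _ := hHX.trans hx2
  have e4 : 0 ≤ X / x := by positivity
  have e5 : 13 * (X : ℝ) / x = 13 * (X / x) := by ring
  rw [e5]
  linarith

open scoped Classical in
lemma exists_card_not_good_le (K₀ a J : ℕ) :
    ∃ C : ℝ, 0 < C ∧ ∃ X₀ : ℕ, ∀ X : ℕ, X₀ ≤ X →
      (((SX X).filter fun n => ¬ Good K₀ a J n).card : ℝ) ≤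
        C * (X * Real.log X ^ (-(1 / 2) : ℝ) *
          ((⌊Real.log (Real.log X)⌋₊ : ℕ) : ℝ) ^ (-(1 / 2) : ℝ)) := by
  obtain ⟨C₁, hC₁, hω⟩ := exists_card_omegaOne_le
  obtain ⟨C₂, hC₂, htg⟩ := exists_card_not_tierGood_exp_le
  have tl : Tendsto (fun X : ℕ => Real.log X) atTop atTop :=
    Real.tendsto_log_atTop.comp tendsto_natCast_atTop_atTop
  have tK : Tendsto (fun X : ℕ => ⌊Real.log (Real.log X)⌋₊) atTop atTop :=
    tendsto_nat_floor_atTop.comp (Real.tendsto_log_atTop.comp tl)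
  have eKa : ∀ᶠ K : ℕ in atTop,
      (1600 : ℝ) * K ^ a * (8 * K ^ (a + 2)) ^ 2 ≤ Real.exp (K / 8) := by
    have h := (isLittleO_pow_exp_pos_mul_atTop (3 * a + 4) (b := 1 / 8) (by norm_num)).bound
      (c := 1 / 102400) (by norm_num)
    filter_upwards [tendsto_natCast_atTop_atTop.eventually h] with K hK
    rw [Real.norm_of_nonneg (by positivity), Real.norm_of_nonneg (by positivity)] at hK
    have e : (1600 : ℝ) * K ^ a * (8 * K ^ (a + 2)) ^ 2 = 102400 * (K : ℝ) ^ (3 * a + 4) := by ring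
    rw [e, show (K : ℝ) / 8 = 1 / 8 * K by ring]
    linarith
  have eX : ∀ᶠ X : ℕ in atTop, Real.log X ^ 2 ≤ √X := by
    have h := (isLittleO_log_rpow_rpow_atTop 2 (s := 1 / 2) (by norm_num)).bound
      (c := 1) (by norm_num)
    filter_upwards [tendsto_natCast_atTop_atTop.eventually h, eventually_ge_atTop 1] with X hX h1
    have hl : 0 ≤ Real.log X := Real.log_natCast_nonneg X
    rw [Real.norm_of_nonneg (by positivity), Real.norm_of_nonneg (by positivity), one_mul,
      ← Real.sqrt_eq_rpow] at hX
    exact_mod_cast hX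
  have ev := (tl.eventually_ge_atTop 1).and (eX.and ((eventually_ge_atTop 3).and
    (tK.eventually (eKa.and ((eventually_ge_atTop K₀).and ((eventually_ge_atTop 400).and
      (eventually_ge_atTop (8 * (12 * J + 2)))))))))
  obtain ⟨X₀, hX₀⟩ := eventually_atTop.1 ev
  refine ⟨8 * C₁ + 9 + 26 + 2 * C₂, by positivity, X₀, fun X hX => ?_⟩
  obtain ⟨hx1, hXs, hX3, hKa, hK0, hK400, hKJ⟩ := hX₀ X hX
  set K := ⌊Real.log (Real.log X)⌋₊ with hK
  set x := Real.log X with hx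
  have hx0 : 0 < x := by linarith
  have hlx : 0 ≤ Real.log x := Real.log_nonneg hx1
  have h1 : Real.exp K ≤ x := by
    rw [← Real.le_log_iff_exp_le hx0]
    exact Nat.floor_le hlx
  have h2 : x < Real.exp (K + 1) := by
    rw [← Real.log_lt_iff_lt_exp hx0]
    exact Nat.lt_floor_add_one _
  have hX1 : 1 ≤ X := by omega
  have hK1 : (400 : ℝ) ≤ K := by exact_mod_cast hK400
  have hKp : (0 : ℝ) < K := by linarith
  have hXp : (0 : ℝ) < X := by exact_mod_cast hX1
  set y := (K : ℝ) ^ (-(1 / 2) : ℝ) with hy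
  set z := x ^ (-(1 / 2) : ℝ) with hz
  have hz0 : 0 < z := by positivity
  have hy0 : 0 < y := by positivity
  have hKy : (K : ℝ)⁻¹ ≤ y := by
    rw [← Real.rpow_neg_one]
    exact Real.rpow_le_rpow_of_exponent_le (by linarith) (by norm_num)
  have hpow : ∀ s : ℝ, 0 < s → x ^ (-s) ≤ 1 / s * y := by
    intro s hs
    have h3 : x ^ (-s) ≤ Real.exp (-(s * K)) := by
      calc x ^ (-s) ≤ Real.exp K ^ (-s) :=
            Real.rpow_le_rpow_of_nonpos (Real.exp_pos _) h1 (by linarith)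
        _ = _ := by rw [← Real.exp_mul]; ring_nf
    have h4 : Real.exp (-(s * K)) ≤ (s * K)⁻¹ := by
      rw [Real.exp_neg]
      gcongr
      linarith [Real.add_one_le_exp (s * (K : ℝ))]
    calc x ^ (-s) ≤ (s * K)⁻¹ := h3.trans h4
      _ = 1 / s * (K : ℝ)⁻¹ := by rw [mul_inv, one_div]
      _ ≤ _ := by gcongr
  have bω : (((SX X).filter fun n => (2 : ℝ) ^ omegaOne n ≤ x ^ (1 / 8 : ℝ)).card : ℝ) ≤
      8 * C₁ * (X * z * y) := by
    have e : x ^ (-(5 / 8) : ℝ) = z * x ^ (-(1 / 8) : ℝ) := by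
      rw [hz, ← Real.rpow_add hx0]; norm_num
    calc _ ≤ C₁ * X * x ^ (-(5 / 8) : ℝ) := hω X hX3
      _ = C₁ * X * z * x ^ (-(1 / 8) : ℝ) := by rw [e]; ring
      _ ≤ C₁ * X * z * (1 / (1 / 8) * y) := by gcongr; exact hpow _ (by norm_num)
      _ = _ := by ring
  have bN : (((SX X).filter fun n => x ^ 2 ≤ ((latticePts n).card : ℝ)).card : ℝ) ≤
      9 * (X * z * y) := by
    have h3 := card_many_representations_le X hX1 (x ^ 2)
    have e : (x ^ 2)⁻¹ = z * x ^ (-(3 / 2) : ℝ) := by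
      rw [hz, ← Real.rpow_add hx0, show (-(1 / 2) : ℝ) + -(3 / 2) = -((2 : ℕ) : ℝ) by norm_num,
        Real.rpow_neg hx0.le, Real.rpow_natCast]
    calc _ ≤ 9 * X * (x ^ 2)⁻¹ := by
          rw [← div_eq_mul_inv, le_div_iff₀ (by positivity)]; exact h3
      _ = 9 * X * z * x ^ (-(3 / 2) : ℝ) := by rw [e]; ring
      _ ≤ 9 * X * z * (1 / (3 / 2) * y) := by gcongr; exact hpow _ (by norm_num)
      _ ≤ _ := by
        have : 0 < X * z * y := by positivity
        linarith
  have bc : (((Finset.Ioc 0 X).filter fun n => ClosePair ⌊√X / x ^ 2⌋₊ n).card : ℝ) ≤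
      26 * (X * z * y) := by
    have e : x⁻¹ = z * x ^ (-(1 / 2) : ℝ) := by
      rw [hz, ← Real.rpow_add hx0, show (-(1 / 2) : ℝ) + -(1 / 2) = -1 by norm_num,
        Real.rpow_neg_one]
    calc _ ≤ 13 * X / x := card_closePair_floor_le hx1 hXs
      _ = 13 * X * z * x ^ (-(1 / 2) : ℝ) := by rw [div_eq_mul_inv, e]; ring
      _ ≤ 13 * X * z * (1 / (1 / 2) * y) := by gcongr; exact hpow _ (by norm_num)
      _ = _ := by ring
  have b1 := htg X K (32 * K ^ a) ⌊x ^ 2⌋₊ _ ((K : ℝ) ^ (a + 2)) hX3 (by omega) h1 h2 rfl rfl (by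
    push_cast
    have h5 : (1 : ℝ) ≤ (K : ℝ) ^ a := one_le_pow₀ (by linarith)
    rw [pow_add]
    nlinarith [mul_nonneg (by positivity : (0 : ℝ) ≤ K ^ a) hKp.le,
      mul_nonneg (mul_nonneg (by positivity : (0 : ℝ) ≤ K ^ a) hKp.le) (sub_nonneg.2 hK1)])
  have b2 := htg X K J ⌊x ^ 2⌋₊ _ ((12 * J + 2) * (K : ℝ)) hX3 (by omega) h1 h2 rfl rfl
    (by linarith)
  have hsub : ((SX X).filter fun n => ¬ Good K₀ a J n) ⊆
      ((SX X).filter fun n => (2 : ℝ) ^ omegaOne n ≤ x ^ (1 / 8 : ℝ)) ∪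
      (((SX X).filter fun n => x ^ 2 ≤ ((latticePts n).card : ℝ)) ∪
      (((Finset.Ioc 0 X).filter fun n => ClosePair ⌊√X / x ^ 2⌋₊ n) ∪
      (((SX X).filter fun n => (latticePts n).card ≤ ⌊x ^ 2⌋₊ ∧
        ¬ TierGood ⌈Real.exp ((K : ℝ) ^ (a + 2))⌉₊ (32 * K ^ a) n) ∪
      ((SX X).filter fun n => (latticePts n).card ≤ ⌊x ^ 2⌋₊ ∧
        ¬ TierGood ⌈Real.exp ((12 * J + 2) * (K : ℝ))⌉₊ J n)))) := by
    intro n hn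
    rw [Finset.mem_filter] at hn
    obtain ⟨hS, hb⟩ := hn
    obtain ⟨hnS, hnX⟩ := mem_SX.1 hS
    simp only [Finset.mem_union, Finset.mem_filter, hS, true_and, Finset.mem_Ioc, hnS.1, hnX]
    by_contra hcon
    push Not at hcon
    obtain ⟨g1, g2, g3, g4, g5⟩ := hcon
    have ht : (latticePts n).card ≤ ⌊x ^ 2⌋₊ := Nat.le_floor g2.le
    exact hb (good_of_tierGood hnS hnX hK0 (by omega) hKJ hKa h1 h2 (not_le.2 g1) (not_le.2 g2)
      g3 (g4 ht) (g5 ht))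
  have hcard := (Finset.card_le_card hsub).trans ((Finset.card_union_le _ _).trans
    (Nat.add_le_add_left ((Finset.card_union_le _ _).trans
    (Nat.add_le_add_left ((Finset.card_union_le _ _).trans
    (Nat.add_le_add_left (Finset.card_union_le _ _) _)) _)) _))
  have hcard' : (((SX X).filter fun n => ¬ Good K₀ a J n).card : ℝ) ≤ _ :=
    Nat.cast_le.2 hcard
  push_cast at hcard'
  linarith

lemma densityOne_good (K₀ a J : ℕ) : DensityOne {n | n ∈ sumTwoSq ∧ Good K₀ a J n} := by
  classical
  refine ⟨fun n hn => hn.1, ?_⟩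
  obtain ⟨C, hC, X₀, hb⟩ := exists_card_not_good_le K₀ a J
  obtain ⟨c, hc, X₁, hS⟩ := exists_card_SX_ge
  have tl : Tendsto (fun X : ℕ => Real.log X) atTop atTop :=
    Real.tendsto_log_atTop.comp tendsto_natCast_atTop_atTop
  have tK : Tendsto (fun X : ℕ => ((⌊Real.log (Real.log X)⌋₊ : ℕ) : ℝ) ^ (-(1 / 2) : ℝ))
      atTop (𝓝 0) :=
    (tendsto_rpow_neg_atTop (by norm_num : (0 : ℝ) < 1 / 2)).comp
      (tendsto_natCast_atTop_atTop.comp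
        (tendsto_nat_floor_atTop.comp (Real.tendsto_log_atTop.comp tl)))
  have e2 : ∀ X : ℕ, Nat.card {n : ℕ | n ∈ sumTwoSq ∧ n ≤ X} = (SX X).card := by
    intro X
    rw [← Set.ncard_coe_finset, Nat.card_coe_set_eq]
    congr 1
    ext n
    simp [mem_SX]
  have e1 : ∀ X : ℕ, Nat.card {n : ℕ | n ∈ {n | n ∈ sumTwoSq ∧ Good K₀ a J n} ∧ n ≤ X} =
      ((SX X).filter fun n => Good K₀ a J n).card := by
    intro X
    rw [← Set.ncard_coe_finset, Nat.card_coe_set_eq]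
    congr 1
    ext n
    simp [mem_SX, and_right_comm]
  simp only [e1, e2]
  have lim : Tendsto (fun X : ℕ => 1 - C / c *
      ((⌊Real.log (Real.log X)⌋₊ : ℕ) : ℝ) ^ (-(1 / 2) : ℝ)) atTop (𝓝 1) := by
    simpa using (tK.const_mul (C / c)).const_sub 1
  refine tendsto_of_tendsto_of_tendsto_of_le_of_le' lim tendsto_const_nhds ?_ ?_
  · filter_upwards [eventually_ge_atTop X₀, eventually_ge_atTop X₁, tl.eventually_ge_atTop 1,
      eventually_ge_atTop 1] with X h0 h1 hx hX1
    have hXp : (0 : ℝ) < X := by exact_mod_cast hX1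
    have hx0 : 0 < Real.log X := by linarith
    have hS' := hS X h1
    have hb' := hb X h0
    have hz : Real.log X ^ (-(1 / 2) : ℝ) = 1 / √(Real.log X) := by
      rw [Real.rpow_neg hx0.le, Real.sqrt_eq_rpow, ← one_div]
    set w := ((⌊Real.log (Real.log X)⌋₊ : ℕ) : ℝ) ^ (-(1 / 2) : ℝ) with hw
    have hw0 : 0 ≤ w := by positivity
    have hSp : (0 : ℝ) < (SX X).card := lt_of_lt_of_le (by positivity) hS'
    have hsplit : (((SX X).filter fun n => Good K₀ a J n).card : ℝ) +
        ((SX X).filter fun n => ¬ Good K₀ a J n).card = (SX X).card := by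
      exact_mod_cast Finset.card_filter_add_card_filter_not (s := SX X) fun n => Good K₀ a J n
    rw [le_div_iff₀ hSp, sub_mul, one_mul]
    have : (((SX X).filter fun n => ¬ Good K₀ a J n).card : ℝ) ≤ C / c * w * (SX X).card := by
      calc _ ≤ _ := hb'
        _ = C / c * w * (c * X / √(Real.log X)) := by rw [hz]; field_simp
        _ ≤ _ := by gcongr
    linarith
  · filter_upwards with X
    refine div_le_one_of_le₀ ?_ (Nat.cast_nonneg _)
    exact_mod_cast Finset.card_filter_le _ _

/-- The torus as an additive group. -/
abbrev Tor := AddCircle (1 : ℝ) × AddCircle (1 : ℝ)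

/-- The Haar probability measure on the torus. -/
def haarTor : Measure Tor :=
  (AddCircle.haarAddCircle : Measure (AddCircle (1 : ℝ))).prod AddCircle.haarAddCircle

instance : IsProbabilityMeasure haarTor := by unfold haarTor; infer_instance

instance : haarTor.IsAddRightInvariant := by unfold haarTor; infer_instance

/-- The character `x ↦ e(⟨ξ, x⟩)` of the torus. -/
def chr (ξ : ℤ × ℤ) (y : Tor) : ℂ := fourier ξ.1 y.1 * fourier ξ.2 y.2

lemma continuous_chr (ξ : ℤ × ℤ) : Continuous (chr ξ) := by
  unfold chr
  fun_prop

lemma chr_zero (y : Tor) : chr 0 y = 1 := by simp [chr]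

lemma chr_add (ξ η : ℤ × ℤ) (y : Tor) : chr (ξ + η) y = chr ξ y * chr η y := by
  simp only [chr, Prod.fst_add, Prod.snd_add, fourier_add]
  ring

lemma chr_neg (ξ : ℤ × ℤ) (y : Tor) : chr (-ξ) y = starRingEnd ℂ (chr ξ y) := by
  simp only [chr, Prod.fst_neg, Prod.snd_neg, fourier_neg, map_mul]

lemma chr_sum {ι : Type*} (s : Finset ι) (ξ : ι → ℤ × ℤ) (y : Tor) :
    chr (∑ i ∈ s, ξ i) y = ∏ i ∈ s, chr (ξ i) y := by
  classical
  induction s using Finset.induction_on with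
  | empty => simp [chr_zero]
  | insert i s hi ih => rw [Finset.sum_insert hi, Finset.prod_insert hi, chr_add, ih]

lemma norm_chr (ξ : ℤ × ℤ) (y : Tor) : ‖chr ξ y‖ = 1 := by
  simp only [chr, fourier_apply, norm_mul, Circle.norm_coe, mul_one]

lemma chr_apply_add (ξ : ℤ × ℤ) (y z : Tor) : chr ξ (y + z) = chr ξ y * chr ξ z := by
  simp only [chr, fourier_apply, Prod.fst_add, Prod.snd_add, smul_add, AddCircle.toCircle_add,
    Circle.coe_mul]
  ring

lemma integral_haarAddCircle_fourier (n : ℤ) :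
    ∫ t, fourier n t ∂(AddCircle.haarAddCircle : Measure (AddCircle (1 : ℝ))) =
      if n = 0 then 1 else 0 := by
  split_ifs with h
  · subst h
    simp
  · refine integral_eq_zero_of_add_right_eq_neg (g := ((1 / 2 / n : ℝ) : AddCircle (1 : ℝ)))
      fun x => ?_
    exact fourier_add_half_inv_index h one_pos x

lemma integral_chr (ξ : ℤ × ℤ) : ∫ y, chr ξ y ∂haarTor = if ξ = 0 then 1 else 0 := by
  unfold chr haarTor
  rw [integral_prod_mul, integral_haarAddCircle_fourier, integral_haarAddCircle_fourier]
  by_cases h1 : ξ.1 = 0 <;> by_cases h2 : ξ.2 = 0 <;> simp [h1, h2, Prod.ext_iff]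

lemma integrable_haarTor {E : Type*} [NormedAddCommGroup E] {f : Tor → E} (hf : Continuous f) :
    Integrable f haarTor :=
  hf.integrable_of_hasCompactSupport (HasCompactSupport.of_compactSpace f)

/-- The trigonometric polynomial with frequencies in `Λ` and coefficients `a`. -/
def trig (Λ : Finset (ℤ × ℤ)) (a : ℤ × ℤ → ℂ) (y : Tor) : ℂ := ∑ ξ ∈ Λ, a ξ * chr ξ y

lemma continuous_trig (Λ : Finset (ℤ × ℤ)) (a : ℤ × ℤ → ℂ) : Continuous (trig Λ a) :=
  continuous_finsetSum _ fun ξ _ => continuous_const.mul (continuous_chr ξ)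

lemma integral_trig (Λ : Finset (ℤ × ℤ)) (a : ℤ × ℤ → ℂ) :
    ∫ y, trig Λ a y ∂haarTor = if (0 : ℤ × ℤ) ∈ Λ then a 0 else 0 := by
  unfold trig
  rw [integral_finsetSum _ fun ξ _ => (integrable_haarTor (continuous_chr ξ)).const_mul _]
  simp_rw [integral_const_mul, integral_chr]
  simp

lemma norm_trig_le (Λ : Finset (ℤ × ℤ)) (a : ℤ × ℤ → ℂ) (y : Tor) :
    ‖trig Λ a y‖ ≤ ∑ ξ ∈ Λ, ‖a ξ‖ := by
  refine (norm_sum_le _ _).trans (le_of_eq (Finset.sum_congr rfl fun ξ _ => ?_))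
  rw [norm_mul, norm_chr, mul_one]

lemma conj_trig {Λ : Finset (ℤ × ℤ)} {a : ℤ × ℤ → ℂ} (hΛ : ∀ ξ ∈ Λ, -ξ ∈ Λ)
    (ha : ∀ ξ, a (-ξ) = starRingEnd ℂ (a ξ)) (y : Tor) :
    starRingEnd ℂ (trig Λ a y) = trig Λ a y := by
  unfold trig
  rw [map_sum]
  refine Finset.sum_nbij' (fun ξ => -ξ) (fun ξ => -ξ) (fun ξ h => hΛ ξ h) (fun ξ h => hΛ ξ h)
    (by simp) (by simp) fun ξ _ => ?_
  rw [map_mul, ha, chr_neg]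

lemma trig_mul_conj (Λ : Finset (ℤ × ℤ)) (a : ℤ × ℤ → ℂ) (y : Tor) :
    trig Λ a y * starRingEnd ℂ (trig Λ a y) =
      ∑ ξ ∈ Λ, ∑ η ∈ Λ, a ξ * starRingEnd ℂ (a η) * chr (ξ - η) y := by
  unfold trig
  rw [map_sum, Finset.sum_mul_sum]
  refine Finset.sum_congr rfl fun ξ _ => Finset.sum_congr rfl fun η _ => ?_
  rw [sub_eq_add_neg, chr_add, chr_neg, map_mul]
  ring

lemma integral_norm_trig_sq (Λ : Finset (ℤ × ℤ)) (a : ℤ × ℤ → ℂ) :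
    ∫ y, ‖trig Λ a y‖ ^ 2 ∂haarTor = ∑ ξ ∈ Λ, ‖a ξ‖ ^ 2 := by
  have h : ∫ y, ((‖trig Λ a y‖ ^ 2 : ℝ) : ℂ) ∂haarTor = ∑ ξ ∈ Λ, ((‖a ξ‖ ^ 2 : ℝ) : ℂ) := by
    have e : ∀ y, ((‖trig Λ a y‖ ^ 2 : ℝ) : ℂ) =
        ∑ ξ ∈ Λ, ∑ η ∈ Λ, a ξ * starRingEnd ℂ (a η) * chr (ξ - η) y := by
      intro y
      rw [← trig_mul_conj, Complex.mul_conj, Complex.normSq_eq_norm_sq]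
    simp_rw [e]
    have hi : ∀ ξ η, Integrable (fun y => a ξ * starRingEnd ℂ (a η) * chr (ξ - η) y) haarTor :=
      fun ξ η => (integrable_haarTor (continuous_chr _)).const_mul _
    rw [integral_finsetSum _ fun ξ _ => integrable_finsetSum _ fun η _ => hi ξ η]
    refine Finset.sum_congr rfl fun ξ hξ => ?_
    rw [integral_finsetSum _ fun η _ => hi ξ η]
    simp_rw [integral_const_mul, integral_chr, sub_eq_zero]
    rw [Finset.sum_eq_single ξ (fun η _ hne => by simp [hne.symm]) (fun h => absurd hξ h)]
    simp [Complex.mul_conj, Complex.normSq_eq_norm_sq]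
  rw [integral_complex_ofReal] at h
  exact_mod_cast h

lemma norm_cexp_sub_taylor_le (n : ℕ) (x : ℝ) :
    ‖Complex.exp (x * I) - ∑ j ∈ Finset.range n, ((x : ℂ) * I) ^ j / (j.factorial : ℂ)‖ ≤
      |x| ^ n / n.factorial := by
  have hpos : ∀ n : ℕ, ∀ x : ℝ, 0 ≤ x →
      ‖Complex.exp (x * I) - ∑ j ∈ Finset.range n, ((x : ℂ) * I) ^ j / (j.factorial : ℂ)‖ ≤
        x ^ n / n.factorial := by
    intro n
    induction n with
    | zero =>
      intro x _
      simp [Complex.norm_exp_ofReal_mul_I]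
    | succ n ih =>
      intro b hb
      have hd : ∀ x : ℝ, HasDerivAt (fun x : ℝ => Complex.exp (x * I) -
          ∑ j ∈ Finset.range (n + 1), ((x : ℂ) * I) ^ j / (j.factorial : ℂ))
          ((Complex.exp (x * I) -
            ∑ j ∈ Finset.range n, ((x : ℂ) * I) ^ j / (j.factorial : ℂ)) * I) x := by
        intro x
        have h0 : HasDerivAt (fun x : ℝ => (x : ℂ) * I) I x := by
          simpa using (Complex.ofRealCLM.hasDerivAt (x := x)).mul_const I
        have h1 : HasDerivAt (fun x : ℝ => ∑ j ∈ Finset.range (n + 1),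
            ((x : ℂ) * I) ^ j / (j.factorial : ℂ))
            (∑ j ∈ Finset.range (n + 1), (j * ((x : ℂ) * I) ^ (j - 1) * I) / (j.factorial : ℂ)) x :=
          HasDerivAt.fun_sum fun j _ => (h0.fun_pow j).div_const _
        have h2 := h0.cexp.sub h1
        refine h2.congr_deriv ?_
        rw [sub_mul, Finset.sum_range_succ', Finset.sum_mul]
        simp only [CharP.cast_eq_zero, zero_mul, zero_div, add_zero, Nat.add_sub_cancel]
        congr 1
        refine Finset.sum_congr rfl fun j _ => ?_
        rw [Nat.factorial_succ]
        push_cast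
        have : (j : ℂ) + 1 ≠ 0 := by exact_mod_cast j.succ_ne_zero
        have : (j.factorial : ℂ) ≠ 0 := by exact_mod_cast j.factorial_ne_zero
        field_simp
      have hB : ∀ x : ℝ, HasDerivAt (fun x : ℝ => x ^ (n + 1) / (n + 1).factorial)
          (x ^ n / n.factorial) x := by
        intro x
        refine ((hasDerivAt_pow (n + 1) x).div_const ((n + 1).factorial : ℝ)).congr_deriv ?_
        rw [Nat.factorial_succ]
        push_cast
        have : (n : ℝ) + 1 ≠ 0 := by positivity
        have : (n.factorial : ℝ) ≠ 0 := by positivity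
        field_simp
      refine image_norm_le_of_norm_deriv_right_le_deriv_boundary (a := 0) (b := b)
        (fun x _ => (hd x).continuousAt.continuousWithinAt) (fun x _ => (hd x).hasDerivWithinAt)
        ?_ hB (fun x hx => ?_) ⟨hb, le_rfl⟩
      · rw [Finset.sum_range_succ']
        simp
      · rw [norm_mul, Complex.norm_I, mul_one]
        exact ih x hx.1
  rcases le_total 0 x with h | h
  · rw [abs_of_nonneg h]
    exact hpos n x h
  · rw [abs_of_nonpos h, ← Complex.norm_conj]
    convert hpos n (-x) (by linarith) using 2
    rw [map_sub, ← Complex.exp_conj, map_sum]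
    simp

lemma integral_exp_le {f : Tor → ℝ} (hf : Continuous f) (h0 : ∫ y, f y ∂haarTor = 0) {u M : ℝ}
    (hM : ∀ y, |f y| ≤ M) (hu : |u| * M ≤ 1) :
    ∫ y, Real.exp (u * f y) ∂haarTor ≤ Real.exp (u ^ 2 * ∫ y, f y ^ 2 ∂haarTor) := by
  have h1 : ∀ y, Real.exp (u * f y) ≤ 1 + u * f y + u ^ 2 * f y ^ 2 := by
    intro y
    have h2 : |u * f y| ≤ 1 := by
      rw [abs_mul]
      exact (mul_le_mul_of_nonneg_left (hM y) (abs_nonneg u)).trans hu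
    have := Real.abs_exp_sub_one_sub_id_le h2
    rw [mul_pow] at this
    linarith [(abs_le.1 this).2]
  have i1 : Integrable (fun y => u * f y) haarTor := integrable_haarTor (by fun_prop)
  have i2 : Integrable (fun y => u ^ 2 * f y ^ 2) haarTor := integrable_haarTor (by fun_prop)
  calc ∫ y, Real.exp (u * f y) ∂haarTor ≤ ∫ y, (1 + u * f y + u ^ 2 * f y ^ 2) ∂haarTor :=
        integral_mono (integrable_haarTor (by fun_prop)) (integrable_haarTor (by fun_prop)) h1
    _ = 1 + u ^ 2 * ∫ y, f y ^ 2 ∂haarTor := by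
        rw [integral_add (f := fun y => 1 + u * f y) ((integrable_const _).add i1) i2,
          integral_add (integrable_const _) i1,
          integral_const_mul, integral_const_mul, h0]
        simp
    _ ≤ _ := by
        rw [add_comm]
        exact Real.add_one_le_exp _

lemma norm_integral_cexp_le {f : Tor → ℝ} (hf : Continuous f) (h0 : ∫ y, f y ∂haarTor = 0)
    {u M : ℝ} (hM : ∀ y, |f y| ≤ M) (hu : |u| * M ≤ 1) :
    ‖∫ y, Complex.exp (((u * f y : ℝ) : ℂ) * I) ∂haarTor‖ ≤
      Real.exp (-(u ^ 2 * ∫ y, f y ^ 2 ∂haarTor) / 3) := by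
  set v := ∫ y, f y ^ 2 ∂haarTor with hv
  have hv0 : 0 ≤ v := integral_nonneg fun y => sq_nonneg _
  have hufy : ∀ y, |u * f y| ≤ 1 := fun y => by
    rw [abs_mul]
    exact (mul_le_mul_of_nonneg_left (hM y) (abs_nonneg u)).trans hu
  have i2 : Integrable (fun y => (u * f y) ^ 2) haarTor := integrable_haarTor (by fun_prop)
  have e2 : ∫ y, (u * f y) ^ 2 ∂haarTor = u ^ 2 * v := by
    simp_rw [mul_pow]
    rw [integral_const_mul]
  have huv : u ^ 2 * v ≤ 1 := by
    rw [← e2]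
    calc ∫ y, (u * f y) ^ 2 ∂haarTor ≤ ∫ _, (1 : ℝ) ∂haarTor := by
          refine integral_mono i2 (integrable_const _) fun y => ?_
          have := hufy y
          rw [← sq_abs]
          exact pow_le_one₀ (abs_nonneg _) this
      _ = 1 := by simp
  have huv0 : 0 ≤ u ^ 2 * v := by positivity
  set g : Tor → ℂ := fun y => 1 + ((u * f y : ℝ) : ℂ) * I - (((u * f y) ^ 2 / 2 : ℝ) : ℂ) with hg
  have ig : Integrable g haarTor := integrable_haarTor (by fun_prop)
  have ie : Integrable (fun y => Complex.exp (((u * f y : ℝ) : ℂ) * I)) haarTor :=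
    integrable_haarTor (by fun_prop)
  have e1 : ∫ y, g y ∂haarTor = ((1 - u ^ 2 * v / 2 : ℝ) : ℂ) := by
    have j1 : Integrable (fun y => ((u * f y : ℝ) : ℂ) * I) haarTor :=
      integrable_haarTor (by fun_prop)
    have j2 : Integrable (fun y => (((u * f y) ^ 2 / 2 : ℝ) : ℂ)) haarTor :=
      integrable_haarTor (by fun_prop)
    simp only [hg]
    rw [integral_sub (f := fun y => 1 + ((u * f y : ℝ) : ℂ) * I) ((integrable_const _).add j1) j2,
      integral_add (integrable_const _) j1,
      integral_mul_const, integral_complex_ofReal, integral_complex_ofReal, integral_const_mul, h0,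
      integral_div, e2]
    simp
  have h3 : ‖∫ y, Complex.exp (((u * f y : ℝ) : ℂ) * I) ∂haarTor - ∫ y, g y ∂haarTor‖ ≤
      u ^ 2 * v / 6 := by
    rw [← integral_sub ie ig]
    refine (norm_integral_le_integral_norm _).trans ?_
    rw [← e2, ← integral_div]
    refine integral_mono (ie.sub ig).norm (i2.div_const 6) fun y => ?_
    have h4 := norm_cexp_sub_taylor_le 3 (u * f y)
    have h5 : |u * f y| ^ 3 ≤ (u * f y) ^ 2 := by
      rw [pow_succ, sq_abs]
      exact mul_le_of_le_one_right (sq_nonneg _) (hufy y)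
    have h6 : ∑ j ∈ Finset.range 3, (((u * f y : ℝ) : ℂ) * I) ^ j / (j.factorial : ℂ) = g y := by
      simp only [Finset.sum_range_succ, Finset.range_zero, Finset.sum_empty, hg]
      simp only [mul_pow, Complex.I_sq, Nat.factorial]
      push_cast
      ring
    rw [h6] at h4
    refine h4.trans ?_
    rw [show ((Nat.factorial 3 : ℕ) : ℝ) = 6 by norm_num [Nat.factorial]]
    gcongr
  calc ‖∫ y, Complex.exp (((u * f y : ℝ) : ℂ) * I) ∂haarTor‖
      ≤ ‖∫ y, Complex.exp (((u * f y : ℝ) : ℂ) * I) ∂haarTor - ∫ y, g y ∂haarTor‖ +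
        ‖∫ y, g y ∂haarTor‖ := by
        simpa using norm_add_le (∫ y, Complex.exp (((u * f y : ℝ) : ℂ) * I) ∂haarTor -
          ∫ y, g y ∂haarTor) (∫ y, g y ∂haarTor)
    _ ≤ u ^ 2 * v / 6 + (1 - u ^ 2 * v / 2) := by
        refine add_le_add h3 (le_of_eq ?_)
        rw [e1, Complex.norm_real, Real.norm_of_nonneg (by linarith)]
    _ = -(u ^ 2 * v) / 3 + 1 := by ring
    _ ≤ _ := Real.add_one_le_exp _

lemma sum_exp_neg_sq_le (J j : ℕ) (hj : j < J) :
    ∑ k ∈ Finset.range J, Real.exp (-((j : ℝ) - k) ^ 2 / 3) ≤ 8 := by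
  have hr : Real.exp (-(1 / 3)) ≤ 3 / 4 := by
    rw [Real.exp_neg, inv_le_comm₀ (Real.exp_pos _) (by norm_num)]
    linarith [Real.add_one_le_exp (1 / 3 : ℝ)]
  have hpow : ∀ m : ℕ, Real.exp (-(m : ℝ) ^ 2 / 3) ≤ (3 / 4) ^ m := by
    intro m
    calc Real.exp (-(m : ℝ) ^ 2 / 3) ≤ Real.exp (m * (-(1 / 3))) := by
          rw [Real.exp_le_exp]
          have : (m : ℝ) ≤ (m : ℝ) ^ 2 := by exact_mod_cast Nat.le_self_pow two_ne_zero m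
          linarith
      _ = Real.exp (-(1 / 3)) ^ m := Real.exp_nat_mul _ _
      _ ≤ _ := by gcongr
  have hgeom : ∀ n : ℕ, ∑ i ∈ Finset.range n, (3 / 4 : ℝ) ^ i ≤ 4 := by
    intro n
    have h1 := geom_sum_eq (by norm_num : (3 / 4 : ℝ) ≠ 1) n
    have h2 : (0 : ℝ) ≤ (3 / 4) ^ n := by positivity
    rw [h1, div_le_iff_of_neg (by norm_num)]
    linarith
  have hsplit : Finset.range J = Finset.range j ∪ Finset.Ico j J := by
    ext k
    simp only [Finset.mem_range, Finset.mem_union, Finset.mem_Ico]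
    omega
  rw [hsplit, Finset.sum_union (by
    rw [Finset.disjoint_left]
    intro k h1 h2
    simp only [Finset.mem_range, Finset.mem_Ico] at h1 h2
    omega)]
  have h1 : ∑ k ∈ Finset.range j, Real.exp (-((j : ℝ) - k) ^ 2 / 3) ≤ 4 := by
    calc _ ≤ ∑ k ∈ Finset.range j, (3 / 4 : ℝ) ^ (j - 1 - k) := by
          refine Finset.sum_le_sum fun k hk => ?_
          have hk' := Finset.mem_range.1 hk
          rw [← Nat.cast_sub hk'.le]
          exact (hpow _).trans
            (pow_le_pow_of_le_one (by norm_num) (by norm_num) (by omega))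
      _ = ∑ k ∈ Finset.range j, (3 / 4 : ℝ) ^ k := Finset.sum_range_reflect _ j
      _ ≤ 4 := hgeom j
  have h2 : ∑ k ∈ Finset.Ico j J, Real.exp (-((j : ℝ) - k) ^ 2 / 3) ≤ 4 := by
    rw [Finset.sum_Ico_eq_sum_range]
    refine (Finset.sum_le_sum fun k _ => ?_).trans (hgeom (J - j))
    refine le_trans (le_of_eq ?_) (hpow k)
    push_cast
    ring_nf
  linarith

/-- A discrete Esseen inequality. -/
lemma measure_abs_le_inv_le {F : Tor → ℝ} (hF : Continuous F) {J : ℕ} (hJ : 1 ≤ J) {δ : ℝ}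
    (h : ∀ j < J, ∀ k < J, ‖∫ y, Complex.exp (((((j : ℝ) - k) * F y : ℝ) : ℂ) * I) ∂haarTor‖ ≤
      Real.exp (-((j : ℝ) - k) ^ 2 / 3) + δ) :
    haarTor.real {y | |F y| ≤ 1 / (J : ℝ)} ≤ 32 / J + 4 * δ := by
  have hJ0 : (0 : ℝ) < J := by exact_mod_cast hJ
  set S : Tor → ℂ := fun y => ∑ j ∈ Finset.range J, Complex.exp (((j * F y : ℝ) : ℂ) * I) with hS
  have hSc : Continuous S := by
    rw [hS]
    fun_prop
  set E : Set Tor := {y | |F y| ≤ 1 / (J : ℝ)} with hE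
  have hEm : MeasurableSet E := (isClosed_le hF.abs continuous_const).measurableSet
  have hlow : ∀ y ∈ E, (J / 2 : ℝ) ≤ ‖S y‖ := by
    intro y hy
    refine le_trans ?_ (Complex.re_le_norm _)
    simp only [hS, Complex.re_sum, Complex.exp_ofReal_mul_I_re]
    have : ∀ j ∈ Finset.range J, (1 / 2 : ℝ) ≤ Real.cos (j * F y) := by
      intro j hj
      have hj' : (j : ℝ) ≤ J := by exact_mod_cast (Finset.mem_range.1 hj).le
      have h1 : |j * F y| ≤ 1 := by
        rw [abs_mul, Nat.abs_cast]
        calc (j : ℝ) * |F y| ≤ J * (1 / J) := mul_le_mul hj' hy (abs_nonneg _) hJ0.le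
          _ = 1 := by field_simp
      have h2 := Real.one_sub_sq_div_two_le_cos (x := j * F y)
      have h3 : (j * F y) ^ 2 ≤ 1 := by
        rw [← sq_abs]
        exact pow_le_one₀ (abs_nonneg _) h1
      linarith
    calc (J / 2 : ℝ) = ∑ j ∈ Finset.range J, (1 / 2 : ℝ) := by
          rw [Finset.sum_const, Finset.card_range, nsmul_eq_mul]; ring
      _ ≤ _ := Finset.sum_le_sum this
  have hup : ∫ y, ‖S y‖ ^ 2 ∂haarTor ≤ J * 8 + J * (J * δ) := by
    have e : ∀ y, ((‖S y‖ ^ 2 : ℝ) : ℂ) = ∑ j ∈ Finset.range J, ∑ k ∈ Finset.range J,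
        Complex.exp (((((j : ℝ) - k) * F y : ℝ) : ℂ) * I) := by
      intro y
      rw [← Complex.normSq_eq_norm_sq, ← Complex.mul_conj]
      simp only [hS]
      rw [map_sum, Finset.sum_mul_sum]
      refine Finset.sum_congr rfl fun j _ => Finset.sum_congr rfl fun k _ => ?_
      rw [← Complex.exp_conj, ← Complex.exp_add]
      congr 1
      simp only [map_mul, Complex.conj_ofReal, Complex.conj_I]
      push_cast
      ring
    have hi : ∀ j k : ℕ, Integrable
        (fun y => Complex.exp (((((j : ℝ) - k) * F y : ℝ) : ℂ) * I)) haarTor :=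
      fun j k => integrable_haarTor (by fun_prop)
    have h1 : ((∫ y, ‖S y‖ ^ 2 ∂haarTor : ℝ) : ℂ) = ∑ j ∈ Finset.range J, ∑ k ∈ Finset.range J,
        ∫ y, Complex.exp (((((j : ℝ) - k) * F y : ℝ) : ℂ) * I) ∂haarTor := by
      rw [← integral_complex_ofReal]
      simp_rw [e]
      rw [integral_finsetSum _ fun j _ => integrable_finsetSum _ fun k _ => hi j k]
      exact Finset.sum_congr rfl fun j _ => integral_finsetSum _ fun k _ => hi j k
    have h2 : ∫ y, ‖S y‖ ^ 2 ∂haarTor ≤ ‖((∫ y, ‖S y‖ ^ 2 ∂haarTor : ℝ) : ℂ)‖ := by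
      rw [Complex.norm_real]
      exact le_abs_self _
    refine h2.trans ?_
    rw [h1]
    calc _ ≤ ∑ j ∈ Finset.range J, ∑ k ∈ Finset.range J,
          (Real.exp (-((j : ℝ) - k) ^ 2 / 3) + δ) := by
          refine (norm_sum_le _ _).trans (Finset.sum_le_sum fun j hj => ?_)
          refine (norm_sum_le _ _).trans (Finset.sum_le_sum fun k hk => ?_)
          exact h j (Finset.mem_range.1 hj) k (Finset.mem_range.1 hk)
      _ ≤ ∑ j ∈ Finset.range J, (8 + J * δ) := by
          refine Finset.sum_le_sum fun j hj => ?_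
          rw [Finset.sum_add_distrib, Finset.sum_const, Finset.card_range, nsmul_eq_mul]
          gcongr
          exact sum_exp_neg_sq_le J j (Finset.mem_range.1 hj)
      _ = _ := by
          rw [Finset.sum_const, Finset.card_range, nsmul_eq_mul]
          ring
  have hmarkov : (J / 2 : ℝ) ^ 2 * haarTor.real E ≤ ∫ y, ‖S y‖ ^ 2 ∂haarTor := by
    calc (J / 2 : ℝ) ^ 2 * haarTor.real E = ∫ y in E, (J / 2 : ℝ) ^ 2 ∂haarTor := by
          rw [setIntegral_const, smul_eq_mul, mul_comm]
      _ ≤ ∫ y in E, ‖S y‖ ^ 2 ∂haarTor := by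
          refine setIntegral_mono_on (integrable_const _)
            (integrable_haarTor (by fun_prop)).integrableOn hEm fun y hy => ?_
          have := hlow y hy
          gcongr
      _ ≤ _ := setIntegral_le_integral (integrable_haarTor (by fun_prop))
          (Eventually.of_forall fun y => by positivity)
  have : haarTor.real E ≤ (J * 8 + J * (J * δ)) / (J / 2 : ℝ) ^ 2 := by
    rw [le_div_iff₀ (by positivity), mul_comm]
    exact hmarkov.trans hup
  refine this.trans (le_of_eq ?_)
  field_simp
  ring

lemma integrable_pi {κ E : Type*} [Fintype κ] [NormedAddCommGroup E] {f : (κ → Tor) → E}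
    (hf : Continuous f) : Integrable f (Measure.pi fun _ : κ => haarTor) :=
  hf.integrable_of_hasCompactSupport (HasCompactSupport.of_compactSpace f)

section Decoupling

variable {κ : Type*} [Fintype κ] [DecidableEq κ]

/-- The component of a trigonometric polynomial along a class of frequencies. -/
def comp (Λ : Finset (ℤ × ℤ)) (cls : ℤ × ℤ → κ) (a : ℤ × ℤ → ℂ) (σ : κ) : Tor → ℂ :=
  trig (Λ.filter fun ξ => cls ξ = σ) a

lemma sum_comp (Λ : Finset (ℤ × ℤ)) (cls : ℤ × ℤ → κ) (a : ℤ × ℤ → ℂ) (y : Tor) :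
    ∑ σ, comp Λ cls a σ y = trig Λ a y := by
  unfold comp trig
  exact Finset.sum_fiberwise _ _ _

lemma sum_comp_pi (Λ : Finset (ℤ × ℤ)) (cls : ℤ × ℤ → κ) (a : ℤ × ℤ → ℂ) (y : κ → Tor) :
    ∑ σ, comp Λ cls a σ (y σ) = ∑ ξ ∈ Λ, a ξ * chr ξ (y (cls ξ)) := by
  unfold comp trig
  rw [← Finset.sum_fiberwise Λ cls]
  refine Finset.sum_congr rfl fun σ _ => Finset.sum_congr rfl fun ξ hξ => ?_
  rw [(Finset.mem_filter.1 hξ).2]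

lemma integral_prod_chr_pi {j : ℕ} (cls : ℤ × ℤ → κ) (p : Fin j → ℤ × ℤ) :
    ∫ y : κ → Tor, ∏ i, chr (p i) (y (cls (p i))) ∂(Measure.pi fun _ => haarTor) =
      if ∀ σ, ∑ i with cls (p i) = σ, p i = 0 then 1 else 0 := by
  have e : ∀ y : κ → Tor, ∏ i, chr (p i) (y (cls (p i))) =
      ∏ σ, chr (∑ i with cls (p i) = σ, p i) (y σ) := by
    intro y
    rw [← Finset.prod_fiberwise Finset.univ fun i => cls (p i)]
    refine Finset.prod_congr rfl fun σ _ => ?_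
    rw [chr_sum]
    refine Finset.prod_congr rfl fun i hi => ?_
    rw [(Finset.mem_filter.1 hi).2]
  simp_rw [e]
  rw [integral_fintype_prod_eq_prod (fun σ y => chr (∑ i with cls (p i) = σ, p i) y)]
  simp_rw [integral_chr]
  rw [Finset.prod_ite_zero]
  simp

lemma integral_trig_pow_eq {Λ : Finset (ℤ × ℤ)} {cls : ℤ × ℤ → κ} {J : ℕ} (hs : Splits Λ cls J)
    (a : ℤ × ℤ → ℂ) {j : ℕ} (hj : j ≤ J) :
    ∫ y, trig Λ a y ^ j ∂haarTor =
      ∫ y : κ → Tor, (∑ σ, comp Λ cls a σ (y σ)) ^ j ∂(Measure.pi fun _ => haarTor) := by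
  have expand : ∀ b : ℤ × ℤ → ℂ, (∑ ξ ∈ Λ, b ξ) ^ j =
      ∑ p ∈ Fintype.piFinset fun _ : Fin j => Λ, ∏ i, b (p i) := by
    intro b
    rw [← Finset.prod_univ_sum]
    simp
  simp_rw [sum_comp_pi]
  unfold trig
  simp_rw [expand, Finset.prod_mul_distrib]
  rw [integral_finsetSum _ fun p _ => integrable_haarTor (by
      have := continuous_chr
      fun_prop),
    integral_finsetSum _ fun p _ => integrable_pi (by
      have := continuous_chr
      fun_prop)]
  refine Finset.sum_congr rfl fun p hp => ?_
  rw [integral_const_mul, integral_const_mul, integral_prod_chr_pi]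
  simp_rw [← chr_sum]
  rw [integral_chr]
  congr 1
  refine if_congr ⟨fun h => hs.2 j hj p (fun i => Fintype.mem_piFinset.1 hp i) h, fun h => ?_⟩
    rfl rfl
  rw [← Finset.sum_fiberwise Finset.univ fun i => cls (p i)]
  exact Finset.sum_eq_zero fun σ _ => h σ

end Decoupling

lemma four_mul_le_four_pow {L : ℕ} (hL : 1 ≤ L) : 4 * L ≤ 4 ^ L := by
  obtain ⟨m, rfl⟩ : ∃ m, L = m + 1 := ⟨L - 1, by omega⟩
  have := Nat.lt_pow_self (n := m) (show 1 < 4 by norm_num)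
  rw [pow_succ]
  omega

/-- If a real random variable on the torus has the same moments as a sum of many small independent
variables, it is unlikely to be small. -/
lemma measure_abs_trig_le {κ : Type*} [Fintype κ] [DecidableEq κ] {Λ : Finset (ℤ × ℤ)}
    {cls : ℤ × ℤ → κ} {a : ℤ × ℤ → ℂ} {Q D : ℕ} {F : Tor → ℝ}
    (hF : ∀ y, (F y : ℂ) = trig Λ a y) (hΛ : ∀ ξ ∈ Λ, -ξ ∈ Λ) (h0 : (0 : ℤ × ℤ) ∉ Λ)
    (ha : ∀ ξ, a (-ξ) = starRingEnd ℂ (a ξ)) (h1 : ∑ ξ ∈ Λ, ‖a ξ‖ ^ 2 = 1)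
    (hflat : ∀ ξ ∈ Λ, ‖a ξ‖ ^ 2 * Λ.card ≤ 100)
    (hs : Splits Λ cls (32 * Q ^ 2)) (hcard : ∀ σ, (Λ.filter fun ξ => cls ξ = σ).card ≤ D)
    (hD : 1600 * Q ^ 2 * D ^ 2 ≤ Λ.card) {J : ℕ} (hJ : 1 ≤ J) (hJQ : J ≤ Q) :
    haarTor.real {y | |F y| ≤ 1 / (J : ℝ)} ≤ 40 / J := by
  have hQ0 : (1 : ℝ) ≤ Q := by exact_mod_cast hJ.trans hJQ
  have hJ0 : (0 : ℝ) < J := by exact_mod_cast hJ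
  set φ : κ → Tor → ℝ := fun σ y => (comp Λ cls a σ y).re with hφ
  have hφc : ∀ σ, Continuous (φ σ) := fun σ =>
    Complex.continuous_re.comp (continuous_trig _ _)
  have hφC : ∀ σ y, (φ σ y : ℂ) = comp Λ cls a σ y := by
    intro σ y
    refine Complex.conj_eq_iff_re.1 (conj_trig (fun ξ hξ => ?_) ha y)
    rw [Finset.mem_filter] at hξ ⊢
    exact ⟨hΛ ξ hξ.1, (hs.1 ξ).trans hξ.2⟩
  have hFsum : ∀ y, F y = ∑ σ, φ σ y := by
    intro y
    have : (F y : ℂ) = ((∑ σ, φ σ y : ℝ) : ℂ) := by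
      rw [hF, Complex.ofReal_sum]
      simp_rw [hφC]
      exact (sum_comp _ _ _ _).symm
    exact_mod_cast this
  have hFc : Continuous F := by
    rw [show F = fun y => ∑ σ, φ σ y from funext hFsum]
    exact continuous_finsetSum _ fun σ _ => hφc σ
  have hNpos : (0 : ℝ) < Λ.card := by
    rcases Finset.eq_empty_or_nonempty Λ with h | h
    · rw [h] at h1; simp at h1
    · exact_mod_cast h.card_pos
  have hφ0 : ∀ σ, ∫ y, φ σ y ∂haarTor = 0 := by
    intro σ
    have : ((∫ y, φ σ y ∂haarTor : ℝ) : ℂ) = 0 := by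
      rw [← integral_complex_ofReal]
      simp_rw [hφC]
      unfold comp
      rw [integral_trig, if_neg]
      simp [h0]
    exact_mod_cast this
  have hφ2 : ∑ σ, ∫ y, φ σ y ^ 2 ∂haarTor = 1 := by
    refine Eq.trans ?_ ((Finset.sum_fiberwise Λ cls fun ξ => ‖a ξ‖ ^ 2).trans h1)
    refine Finset.sum_congr rfl fun σ _ => ?_
    rw [← integral_norm_trig_sq]
    refine integral_congr_ae (Eventually.of_forall fun y => ?_)
    change φ σ y ^ 2 = ‖comp Λ cls a σ y‖ ^ 2
    rw [← hφC, Complex.norm_real, Real.norm_eq_abs, sq_abs]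
  set M : ℝ := 1 / (4 * Q) with hM
  have hφM : ∀ σ y, |φ σ y| ≤ M := by
    intro σ y
    rw [← Real.norm_eq_abs, ← Complex.norm_real, hφC]
    have hb : ∀ ξ ∈ Λ.filter (fun ξ => cls ξ = σ), ‖a ξ‖ ≤ 10 / √Λ.card := by
      intro ξ hξ
      have := hflat ξ (Finset.mem_filter.1 hξ).1
      refine abs_le_of_sq_le_sq' ?_ (by positivity) |>.2
      rw [div_pow, Real.sq_sqrt hNpos.le, le_div_iff₀ hNpos]
      linarith
    have hD' : (4 * Q : ℝ) * (10 * D) ≤ √Λ.card := by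
      refine Real.le_sqrt_of_sq_le ?_
      have : ((1600 * Q ^ 2 * D ^ 2 : ℕ) : ℝ) ≤ Λ.card := by exact_mod_cast hD
      push_cast at this
      linarith
    calc ‖comp Λ cls a σ y‖ ≤ ∑ ξ ∈ Λ.filter (fun ξ => cls ξ = σ), ‖a ξ‖ := norm_trig_le _ _ _
      _ ≤ (Λ.filter fun ξ => cls ξ = σ).card • (10 / √Λ.card) := Finset.sum_le_card_nsmul _ _ _ hb
      _ ≤ D * (10 / √Λ.card) := by
          rw [nsmul_eq_mul]
          gcongr
          exact hcard σ
      _ ≤ M := by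
          rw [hM, le_div_iff₀ (by positivity), ← mul_div_assoc, div_mul_eq_mul_div,
            div_le_one (by positivity)]
          linarith
  set G : (κ → Tor) → ℝ := fun y => ∑ σ, φ σ (y σ) with hG
  have hGc : Continuous G := by
    rw [hG]
    exact continuous_finsetSum _ fun σ _ => (hφc σ).comp (continuous_apply σ)
  set P := Measure.pi fun _ : κ => haarTor with hP
  set L : ℕ := 16 * Q ^ 2 with hL
  have hmom : ∀ j ≤ 2 * L, ∫ y, F y ^ j ∂haarTor = ∫ y, G y ^ j ∂P := by
    intro j hj
    have h2 := integral_trig_pow_eq hs a (j := j) (by omega)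
    have e1 : ∀ y, trig Λ a y ^ j = ((F y ^ j : ℝ) : ℂ) := fun y => by
      rw [← hF]; push_cast; rfl
    have e2 : ∀ y : κ → Tor, (∑ σ, comp Λ cls a σ (y σ)) ^ j = ((G y ^ j : ℝ) : ℂ) := fun y => by
      simp_rw [← hφC, hG]
      push_cast
      rfl
    simp_rw [e1, e2] at h2
    rw [integral_complex_ofReal, integral_complex_ofReal] at h2
    exact_mod_cast h2
  have huM : ∀ u : ℝ, |u| ≤ 4 * Q → |u| * M ≤ 1 := by
    intro u hu
    rw [hM, mul_one_div, div_le_one (by positivity)]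
    exact hu
  have hGexp : ∀ u : ℝ, |u| ≤ 4 * Q → ∫ y, Real.exp (u * G y) ∂P ≤ Real.exp (u ^ 2) := by
    intro u hu
    have e : ∀ y, Real.exp (u * G y) = ∏ σ, Real.exp (u * φ σ (y σ)) := by
      intro y
      rw [← Real.exp_sum, ← Finset.mul_sum]
    simp_rw [e]
    rw [hP, integral_fintype_prod_eq_prod (fun σ y => Real.exp (u * φ σ y))]
    calc _ ≤ ∏ σ, Real.exp (u ^ 2 * ∫ y, φ σ y ^ 2 ∂haarTor) :=
          Finset.prod_le_prod (fun σ _ => integral_nonneg fun y => (Real.exp_pos _).le)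
            fun σ _ => integral_exp_le (hφc σ) (hφ0 σ) (hφM σ) (huM u hu)
      _ = _ := by rw [← Real.exp_sum, ← Finset.mul_sum, hφ2, mul_one]
  have hGchar : ∀ u : ℝ, |u| ≤ 4 * Q →
      ‖∫ y, Complex.exp (((u * G y : ℝ) : ℂ) * I) ∂P‖ ≤ Real.exp (-u ^ 2 / 3) := by
    intro u hu
    have e : ∀ y, Complex.exp (((u * G y : ℝ) : ℂ) * I) =
        ∏ σ, Complex.exp (((u * φ σ (y σ) : ℝ) : ℂ) * I) := by
      intro y
      rw [← Complex.exp_sum, ← Finset.sum_mul, ← Complex.ofReal_sum, ← Finset.mul_sum]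
    simp_rw [e]
    rw [hP, integral_fintype_prod_eq_prod (fun σ y => Complex.exp (((u * φ σ y : ℝ) : ℂ) * I)),
      norm_prod]
    calc _ ≤ ∏ σ, Real.exp (-(u ^ 2 * ∫ y, φ σ y ^ 2 ∂haarTor) / 3) :=
          Finset.prod_le_prod (fun σ _ => norm_nonneg _)
            fun σ _ => norm_integral_cexp_le (hφc σ) (hφ0 σ) (hφM σ) (huM u hu)
      _ = _ := by
          rw [← Real.exp_sum, ← Finset.sum_div, Finset.sum_neg_distrib, ← Finset.mul_sum, hφ2,
            mul_one]
  have hL1 : 1 ≤ L := by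
    have : 1 ≤ Q := hJ.trans hJQ
    rw [hL]
    nlinarith
  have hLQ : (L : ℝ) = 16 * (Q : ℝ) ^ 2 := by rw [hL]; push_cast; ring
  have hmomb : (4 * Q : ℝ) ^ (2 * L) * (∫ y, G y ^ (2 * L) ∂P) / (2 * L).factorial ≤
      2 * Real.exp L := by
    have h2 : ∀ y, (4 * Q : ℝ) ^ (2 * L) * G y ^ (2 * L) / (2 * L).factorial ≤
        Real.exp ((4 * Q) * G y) + Real.exp (-(4 * Q) * G y) := by
      intro y
      have h3 := Real.pow_div_factorial_le_exp |4 * Q * G y| (abs_nonneg _) (2 * L)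
      rw [Even.pow_abs (even_two_mul L), mul_pow] at h3
      refine h3.trans ((Real.exp_abs_le _).trans (le_of_eq ?_))
      ring_nf
    have h4 := hGexp (4 * Q) (by rw [abs_of_nonneg (by positivity)])
    have h5 := hGexp (-(4 * Q)) (by rw [abs_neg, abs_of_nonneg (by positivity)])
    have h6 : (4 * (Q : ℝ)) ^ 2 = L := by rw [hLQ]; ring
    rw [neg_sq, h6] at h5
    rw [h6] at h4
    rw [← integral_const_mul, ← integral_div]
    have i1 : Integrable (fun y => Real.exp ((4 * Q) * G y)) P := integrable_pi (by fun_prop)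
    have i2 : Integrable (fun y => Real.exp (-(4 * Q) * G y)) P := integrable_pi (by fun_prop)
    calc _ ≤ ∫ y, (Real.exp ((4 * Q) * G y) + Real.exp (-(4 * Q) * G y)) ∂P :=
          integral_mono (integrable_pi (by fun_prop)) (i1.add i2) h2
      _ ≤ _ := by
          rw [integral_add i1 i2]
          linarith
  have hrem : ∀ u : ℝ, |u| ≤ Q →
      |u| ^ (2 * L) * (∫ y, G y ^ (2 * L) ∂P) / (2 * L).factorial ≤ 2 * (1 / 4) ^ L := by
    intro u hu
    have hG0 : 0 ≤ ∫ y, G y ^ (2 * L) ∂P :=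
      integral_nonneg fun y => Even.pow_nonneg (even_two_mul L) _
    have h2 : |u| ^ (2 * L) ≤ (1 / 4) ^ (2 * L) * (4 * Q : ℝ) ^ (2 * L) := by
      rw [← mul_pow]
      gcongr
      linarith
    have h3 : Real.exp L ≤ 4 ^ L := by
      rw [← Real.exp_one_pow]
      gcongr
      linarith [Real.exp_one_lt_d9]
    calc _ ≤ ((1 / 4) ^ (2 * L) * (4 * Q : ℝ) ^ (2 * L)) * (∫ y, G y ^ (2 * L) ∂P) /
          (2 * L).factorial := by gcongr
      _ = (1 / 4) ^ (2 * L) * ((4 * Q : ℝ) ^ (2 * L) * (∫ y, G y ^ (2 * L) ∂P) /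
          (2 * L).factorial) := by ring
      _ ≤ (1 / 4) ^ (2 * L) * (2 * Real.exp L) := by gcongr
      _ ≤ (1 / 4) ^ (2 * L) * (2 * 4 ^ L) := by gcongr
      _ = 2 * (1 / 4) ^ L := by
        rw [two_mul L, pow_add, show ((1 : ℝ) / 4) ^ L * (1 / 4) ^ L * (2 * 4 ^ L) =
          2 * (1 / 4) ^ L * ((1 / 4) * 4) ^ L by rw [mul_pow]; ring]
        norm_num
  have hchar : ∀ u : ℝ, |u| ≤ Q →
      ‖∫ y, Complex.exp (((u * F y : ℝ) : ℂ) * I) ∂haarTor‖ ≤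
        Real.exp (-u ^ 2 / 3) + 4 * (1 / 4) ^ L := by
    intro u hu
    set TF : ℝ → ℂ := fun x =>
      ∑ j ∈ Finset.range (2 * L), (((u * x : ℝ) : ℂ) * I) ^ j / (j.factorial : ℂ) with hTF
    have hTc : Continuous TF := by rw [hTF]; fun_prop
    have hT : ∫ y, TF (F y) ∂haarTor = ∫ y, TF (G y) ∂P := by
      simp only [hTF]
      rw [integral_finsetSum _ fun j _ => integrable_haarTor (by fun_prop),
        integral_finsetSum _ fun j _ => integrable_pi (by fun_prop)]
      refine Finset.sum_congr rfl fun j hj => ?_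
      have e : ∀ x : ℝ, (((u * x : ℝ) : ℂ) * I) ^ j / (j.factorial : ℂ) =
          (u * I) ^ j / (j.factorial : ℂ) * ((x ^ j : ℝ) : ℂ) := by
        intro x
        push_cast
        ring
      simp_rw [e]
      rw [integral_const_mul, integral_const_mul, integral_complex_ofReal,
        integral_complex_ofReal, hmom j (Finset.mem_range.1 hj).le]
    have hb : ∀ x : ℝ, ‖Complex.exp (((u * x : ℝ) : ℂ) * I) - TF x‖ ≤
        |u| ^ (2 * L) / (2 * L).factorial * x ^ (2 * L) := by
      intro x
      refine (norm_cexp_sub_taylor_le (2 * L) (u * x)).trans (le_of_eq ?_)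
      rw [abs_mul, mul_pow, Even.pow_abs (even_two_mul L) x]
      ring
    have hdF : ‖∫ y, Complex.exp (((u * F y : ℝ) : ℂ) * I) ∂haarTor - ∫ y, TF (F y) ∂haarTor‖ ≤
        2 * (1 / 4) ^ L := by
      rw [← integral_sub (integrable_haarTor (by fun_prop)) (integrable_haarTor (by fun_prop))]
      refine (norm_integral_le_integral_norm _).trans ((integral_mono
        (integrable_haarTor (by fun_prop)) (integrable_haarTor (by fun_prop))
        fun y => hb (F y)).trans ?_)
      rw [integral_const_mul, hmom _ le_rfl]
      refine le_trans (le_of_eq ?_) (hrem u hu)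
      ring
    have hdG : ‖∫ y, Complex.exp (((u * G y : ℝ) : ℂ) * I) ∂P - ∫ y, TF (G y) ∂P‖ ≤
        2 * (1 / 4) ^ L := by
      rw [← integral_sub (integrable_pi (by fun_prop)) (integrable_pi (by fun_prop))]
      refine (norm_integral_le_integral_norm _).trans ((integral_mono
        (integrable_pi (by fun_prop)) (integrable_pi (by fun_prop))
        fun y => hb (G y)).trans ?_)
      rw [integral_const_mul]
      refine le_trans (le_of_eq ?_) (hrem u hu)
      ring
    have hg := hGchar u (by linarith)
    rw [hT] at hdF
    have h3 := norm_sub_le_norm_sub_add_norm_sub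
      (∫ y, Complex.exp (((u * F y : ℝ) : ℂ) * I) ∂haarTor) (∫ y, TF (G y) ∂P)
      (∫ y, Complex.exp (((u * G y : ℝ) : ℂ) * I) ∂P)
    have h4 := norm_sub_norm_le (∫ y, Complex.exp (((u * F y : ℝ) : ℂ) * I) ∂haarTor)
      (∫ y, Complex.exp (((u * G y : ℝ) : ℂ) * I) ∂P)
    rw [norm_sub_rev (∫ y, TF (G y) ∂P)] at h3
    linarith
  have hfin := measure_abs_le_inv_le hFc hJ (δ := 4 * (1 / 4) ^ L) fun j hj k hk => by
    refine hchar _ ?_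
    have hj' : (j : ℝ) ≤ Q := by exact_mod_cast (hj.le.trans hJQ)
    have hk' : (k : ℝ) ≤ Q := by exact_mod_cast (hk.le.trans hJQ)
    have := Nat.cast_nonneg (α := ℝ) j
    have := Nat.cast_nonneg (α := ℝ) k
    rw [abs_le]
    constructor <;> linarith
  refine hfin.trans ?_
  have h7 : (4 : ℝ) * L ≤ 4 ^ L := by exact_mod_cast four_mul_le_four_pow hL1
  have h8 : (4 : ℝ) * (1 / 4) ^ L ≤ 1 / J := by
    rw [div_pow, one_pow, mul_one_div, div_le_div_iff₀ (by positivity) hJ0]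
    have : (J : ℝ) ≤ L := by
      rw [hLQ]
      have : (J : ℝ) ≤ Q := by exact_mod_cast hJQ
      nlinarith
    linarith
  have h9 : (40 : ℝ) / J = 32 / J + 8 * (1 / J) := by ring
  have h10 : (0 : ℝ) < 1 / J := by positivity
  rw [h9]
  linarith

/-- A finite-valued version of a classification, agreeing with it on a given finite set. -/
def finCls {κ : Type*} [DecidableEq κ] (Λ : Finset (ℤ × ℤ)) (cls : ℤ × ℤ → κ) (ξ : ℤ × ℤ) :
    Option {σ // σ ∈ Λ.image cls} :=
  if h : cls ξ ∈ Λ.image cls then some ⟨cls ξ, h⟩ else none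

section FinCls

variable {κ : Type*} [DecidableEq κ] {Λ : Finset (ℤ × ℤ)} {cls : ℤ × ℤ → κ}

lemma finCls_eq_some {ξ : ℤ × ℤ} {σ : {σ // σ ∈ Λ.image cls}} :
    finCls Λ cls ξ = some σ ↔ cls ξ = σ := by
  unfold finCls
  split_ifs with h
  · simp [Subtype.ext_iff]
  · simp only [false_iff]
    rintro h'
    exact h (h' ▸ σ.2)

lemma finCls_ne_none {ξ : ℤ × ℤ} (hξ : ξ ∈ Λ) : finCls Λ cls ξ ≠ none := by
  unfold finCls
  rw [dif_pos (Finset.mem_image_of_mem _ hξ)]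
  simp

lemma splits_finCls {J : ℕ} (hs : Splits Λ cls J) : Splits Λ (finCls Λ cls) J := by
  refine ⟨fun ξ => by simp only [finCls, hs.1], fun j hj ξ hξ h0 σ => ?_⟩
  cases σ with
  | none =>
    refine Finset.sum_eq_zero fun i hi => ?_
    exact absurd (Finset.mem_filter.1 hi).2 (finCls_ne_none (hξ i))
  | some σ =>
    simp_rw [finCls_eq_some]
    exact hs.2 j hj ξ hξ h0 σ

lemma card_finCls_le {D : ℕ} (h : ∀ σ, (Λ.filter fun ξ => cls ξ = σ).card ≤ D)
    (s : Option {σ // σ ∈ Λ.image cls}) : (Λ.filter fun ξ => finCls Λ cls ξ = s).card ≤ D := by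
  cases s with
  | none =>
    rw [Finset.filter_eq_empty_iff.2 fun ξ hξ => finCls_ne_none hξ]
    simp
  | some σ =>
    simp_rw [finCls_eq_some]
    exact h σ

end FinCls

/-- A real trigonometric polynomial with flat coefficients which splits along small classes is
unlikely to be small, down to the scale allowed by the length of the splitting. -/
lemma measure_abs_le_of_splits {κ : Type*} [DecidableEq κ] {Λ : Finset (ℤ × ℤ)}
    {cls : ℤ × ℤ → κ} {a : ℤ × ℤ → ℂ} {Q D : ℕ} {F : Tor → ℝ}
    (hF : ∀ y, (F y : ℂ) = trig Λ a y) (hΛ : ∀ ξ ∈ Λ, -ξ ∈ Λ) (h0 : (0 : ℤ × ℤ) ∉ Λ)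
    (ha : ∀ ξ, a (-ξ) = starRingEnd ℂ (a ξ)) (h1 : ∑ ξ ∈ Λ, ‖a ξ‖ ^ 2 = 1)
    (hflat : ∀ ξ ∈ Λ, ‖a ξ‖ ^ 2 * Λ.card ≤ 100)
    (hs : Splits Λ cls (32 * Q ^ 2)) (hcard : ∀ σ, (Λ.filter fun ξ => cls ξ = σ).card ≤ D)
    (hD : 1600 * Q ^ 2 * D ^ 2 ≤ Λ.card) {J : ℕ} (hJ : 1 ≤ J) (hJQ : J ≤ Q) :
    haarTor.real {y | |F y| ≤ 1 / (J : ℝ)} ≤ 40 / J :=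
  measure_abs_trig_le hF hΛ h0 ha h1 hflat (splits_finCls hs) (card_finCls_le hcard) hD hJ hJQ

section MixedNorm

variable {κ : Type*} [Fintype κ]

/-- The norm of one coordinate: quadratic if the flag is set, uniform otherwise. -/
def slotNorm (b : Bool) (g : κ → ℝ≥0) : ℝ≥0 :=
  if b then NNReal.sqrt (∑ t, g t ^ 2) else Finset.univ.sup g

/-- The mixed norm of a function of `r` coordinates: quadratic in the flagged coordinates and
uniform in the others. -/
def mixNorm : (r : ℕ) → (Fin r → Bool) → ((Fin r → κ) → ℝ≥0) → ℝ≥0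
  | 0, _, g => g Fin.elim0
  | r + 1, S, g => mixNorm r (fun i => S i.succ) fun x =>
      slotNorm (S 0) fun t => g (Fin.cons t x)

lemma slotNorm_mono (b : Bool) {g g' : κ → ℝ≥0} (h : ∀ t, g t ≤ g' t) :
    slotNorm b g ≤ slotNorm b g' := by
  unfold slotNorm
  split_ifs
  · exact NNReal.sqrt_le_sqrt.2 (Finset.sum_le_sum fun t _ => by gcongr; exact h t)
  · exact Finset.sup_mono_fun fun t _ => h t

lemma le_slotNorm (b : Bool) (g : κ → ℝ≥0) (t : κ) : g t ≤ slotNorm b g := by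
  unfold slotNorm
  split_ifs
  · rw [NNReal.le_sqrt_iff_sq_le]
    exact Finset.single_le_sum (f := fun t => g t ^ 2) (fun _ _ => zero_le) (Finset.mem_univ t)
  · exact Finset.le_sup (Finset.mem_univ t)

lemma slotNorm_const_le (c : ℝ≥0) : slotNorm false (fun _ : κ => c) ≤ c := by
  simp only [slotNorm, Bool.false_eq_true, if_false]
  exact Finset.sup_le fun _ _ => le_rfl

lemma mixNorm_mono {r : ℕ} (S : Fin r → Bool) {g g' : (Fin r → κ) → ℝ≥0} (h : ∀ x, g x ≤ g' x) :
    mixNorm r S g ≤ mixNorm r S g' := by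
  induction r with
  | zero => exact h _
  | succ r ih => exact ih _ fun x => slotNorm_mono _ fun t => h _

lemma sum_prod_le_prod_slotNorm {E : Type*} [Fintype E] [DecidableEq E] (S : E → Bool)
    (g : E → κ → ℝ≥0) (hS : ∃ e e', e ≠ e' ∧ S e = true ∧ S e' = true) :
    ∑ t, ∏ e, g e t ≤ ∏ e, slotNorm (S e) (g e) := by
  obtain ⟨e, e', hne, he, he'⟩ := hS
  have hmem : e' ∈ Finset.univ.erase e := Finset.mem_erase.2 ⟨hne.symm, Finset.mem_univ _⟩
  have split : ∀ u : E → ℝ≥0, ∏ e, u e = u e * u e' * ∏ i ∈ (Finset.univ.erase e).erase e', u i := by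
    intro u
    rw [← Finset.mul_prod_erase _ u (Finset.mem_univ e), ← Finset.mul_prod_erase _ u hmem, mul_assoc]
  simp_rw [split]
  calc _ ≤ ∑ t, g e t * g e' t *
        ∏ i ∈ (Finset.univ.erase e).erase e', slotNorm (S i) (g i) := by
        gcongr with t _ i _
        exact le_slotNorm _ _ _
    _ ≤ _ := by
        rw [← Finset.sum_mul]
        gcongr
        unfold slotNorm
        rw [if_pos he, if_pos he', ← NNReal.sqrt_mul, NNReal.le_sqrt_iff_sq_le]
        exact Finset.sum_mul_sq_le_sq_mul_sq _ _ _

lemma sum_fin_succ {r : ℕ} {M : Type*} [AddCommMonoid M] (f : (Fin (r + 1) → κ) → M) :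
    ∑ x, f x = ∑ x : Fin r → κ, ∑ t, f (Fin.cons t x) := by
  rw [Finset.sum_comm, ← Fintype.sum_prod_type',
    ← Fintype.sum_equiv (Fin.consEquiv fun _ : Fin (r + 1) => κ)]
  intro x
  rfl

/-- Finner's inequality for the counting measure with all exponents equal to two. -/
lemma sum_prod_le_prod_mixNorm {E : Type*} [Fintype E] [DecidableEq E] {r : ℕ}
    (S : E → Fin r → Bool) (g : E → (Fin r → κ) → ℝ≥0)
    (hS : ∀ v, ∃ e e', e ≠ e' ∧ S e v = true ∧ S e' v = true) :
    ∑ x, ∏ e, g e x ≤ ∏ e, mixNorm r (S e) (g e) := by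
  induction r with
  | zero =>
    rw [Fintype.sum_unique]
    exact le_of_eq (Finset.prod_congr rfl fun e _ => by
      rw [mixNorm]
      exact congrArg _ (Subsingleton.elim _ _))
  | succ r ih =>
    rw [sum_fin_succ]
    refine le_trans ?_ (ih (fun e i => S e i.succ)
      (fun e x => slotNorm (S e 0) fun t => g e (Fin.cons t x)) fun v => hS v.succ)
    exact Finset.sum_le_sum fun x _ =>
      sum_prod_le_prod_slotNorm (fun e => S e 0) (fun e t => g e (Fin.cons t x)) (hS 0)

lemma mixNorm_const_le {r : ℕ} (S : Fin r → Bool) (hS : ∀ v, S v = false) (c : ℝ≥0) :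
    mixNorm r S (fun _ : Fin r → κ => c) ≤ c := by
  induction r with
  | zero => exact le_rfl
  | succ r ih =>
    refine le_trans ?_ (ih (fun i => S i.succ) fun v => hS _)
    rw [mixNorm, hS 0]
    exact mixNorm_mono _ fun x => slotNorm_const_le c

lemma mixNorm_apply_le {r : ℕ} (S : Fin r → Bool) (u : Fin r) (hS : ∀ v, S v = decide (v = u))
    (h : κ → ℝ≥0) : mixNorm r S (fun x => h (x u)) ≤ NNReal.sqrt (∑ t, h t ^ 2) := by
  induction r with
  | zero => exact u.elim0
  | succ r ih =>
    rw [mixNorm]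
    obtain rfl | ⟨u, rfl⟩ := u.eq_zero_or_eq_succ
    · refine le_trans (mixNorm_mono _ fun x => le_of_eq ?_) (mixNorm_const_le _ (fun v => ?_) _)
      · rw [hS 0]
        simp [slotNorm]
      · simp [hS, Fin.succ_ne_zero]
    · refine le_trans (mixNorm_mono _ fun x => ?_) (ih _ u (fun v => ?_))
      · rw [hS 0, decide_eq_false (Fin.succ_ne_zero u).symm]
        simp only [Fin.cons_succ]
        exact slotNorm_const_le _
      · simp [hS]

lemma mixNorm_apply₂_le {r : ℕ} (S : Fin r → Bool) (u w : Fin r)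
    (hS : ∀ v, S v = decide (v = u ∨ v = w)) (c : κ → κ → ℝ≥0) :
    mixNorm r S (fun x => c (x u) (x w)) ≤ NNReal.sqrt (∑ s, ∑ t, c s t ^ 2) := by
  by_cases huw : u = w
  · subst huw
    refine (mixNorm_apply_le S u (by simpa using hS) fun t => c t t).trans
      (NNReal.sqrt_le_sqrt.2 (Finset.sum_le_sum fun t _ => ?_))
    exact Finset.single_le_sum (f := fun s => c t s ^ 2) (fun _ _ => zero_le) (Finset.mem_univ t)
  induction r with
  | zero => exact u.elim0
  | succ r ih =>
    rw [mixNorm]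
    obtain rfl | ⟨u, rfl⟩ := u.eq_zero_or_eq_succ <;> obtain rfl | ⟨w, rfl⟩ := w.eq_zero_or_eq_succ
    · exact absurd rfl huw
    · refine le_trans (mixNorm_mono _ fun x => le_of_eq ?_) ((mixNorm_apply_le _ w (fun v => ?_)
        fun t => NNReal.sqrt (∑ s, c s t ^ 2)).trans (le_of_eq ?_))
      · rw [hS 0]
        simp [slotNorm]
      · simp [hS, Fin.succ_ne_zero]
      · simp_rw [NNReal.sq_sqrt]
        rw [Finset.sum_comm]
    · refine le_trans (mixNorm_mono _ fun x => le_of_eq ?_) ((mixNorm_apply_le _ u (fun v => ?_)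
        fun s => NNReal.sqrt (∑ t, c s t ^ 2)).trans (le_of_eq ?_))
      · rw [hS 0]
        simp [slotNorm]
      · simp [hS, Fin.succ_ne_zero]
      · simp_rw [NNReal.sq_sqrt]
    · refine le_trans (mixNorm_mono _ fun x => ?_) (ih _ u w (fun v => ?_)
        fun h => huw (congrArg Fin.succ h))
      · rw [hS 0, decide_eq_false (not_or.2
          ⟨(Fin.succ_ne_zero u).symm, (Fin.succ_ne_zero w).symm⟩)]
        simp only [Fin.cons_succ]
        exact slotNorm_const_le _
      · simp [hS]

/-- A sum over labelled graphs, all of whose vertices lie on at least two edges. -/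
lemma sum_prod_graph_le {E : Type*} [Fintype E] [DecidableEq E] {r : ℕ} (u w : E → Fin r)
    (h : ∀ v, ∃ e e', e ≠ e' ∧ (v = u e ∨ v = w e) ∧ (v = u e' ∨ v = w e')) (c : κ → κ → ℝ≥0) :
    ∑ x : Fin r → κ, ∏ e, c (x (u e)) (x (w e)) ≤
      NNReal.sqrt (∑ s, ∑ t, c s t ^ 2) ^ Fintype.card E := by
  refine (sum_prod_le_prod_mixNorm (fun e v => decide (v = u e ∨ v = w e))
    (fun e x => c (x (u e)) (x (w e))) fun v => by simpa using h v).trans ?_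
  refine (Finset.prod_le_prod' fun e _ => mixNorm_apply₂_le _ (u e) (w e) (fun v => rfl) c).trans ?_
  simp

end MixedNorm

lemma sum_le_sum_of_forall_exists {ι α : Type*} (s : Finset α)
    (t : Finset ι) (φ : ι → α) (w : α → ℝ≥0) (h : ∀ x ∈ s, ∃ i ∈ t, φ i = x) :
    ∑ x ∈ s, w x ≤ ∑ i ∈ t, w (φ i) := by
  classical
  obtain rfl | ⟨x₀, hx₀⟩ := s.eq_empty_or_nonempty
  · simp
  have : Nonempty ι := ⟨(h x₀ hx₀).choose⟩
  choose! ψ hψ hφ using h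
  calc ∑ x ∈ s, w x = ∑ x ∈ s, w (φ (ψ x)) := Finset.sum_congr rfl fun x hx => by rw [hφ x hx]
    _ = ∑ i ∈ s.image ψ, w (φ i) := by
        rw [Finset.sum_image fun x hx y hy hxy => by rw [← hφ x hx, ← hφ y hy, hxy]]
    _ ≤ _ := Finset.sum_le_sum_of_subset (Finset.image_subset_iff.2 hψ)

/-- Every label used by the family of pairs occurs in at least two of them. -/
def NoLonely {E κ : Type*} (x : E → κ × κ) : Prop :=
  ∀ e, ∀ σ, (σ = (x e).1 ∨ σ = (x e).2) → ∃ e' ≠ e, σ = (x e').1 ∨ σ = (x e').2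

lemma exists_pattern {κ : Type*} [DecidableEq κ] {q : ℕ} {x : Fin q → κ × κ} (hx : NoLonely x) :
    ∃ r : ℕ, r < 2 * q + 1 ∧ ∃ π : Fin q → Fin r × Fin r, ∃ z : Fin r → κ,
      (∀ v, ∃ e e', e ≠ e' ∧ (v = (π e).1 ∨ v = (π e).2) ∧ (v = (π e').1 ∨ v = (π e').2)) ∧
      ∀ e, x e = (z (π e).1, z (π e).2) := by
  set A : Finset κ := Finset.univ.image (fun e => (x e).1) ∪ Finset.univ.image fun e => (x e).2
    with hA
  have hm : ∀ σ, σ ∈ A ↔ ∃ e, σ = (x e).1 ∨ σ = (x e).2 := by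
    intro σ
    simp only [hA, Finset.mem_union, Finset.mem_image, Finset.mem_univ, true_and, ← exists_or,
      eq_comm]
  have h1 : ∀ e, (x e).1 ∈ A := fun e => (hm _).2 ⟨e, Or.inl rfl⟩
  have h2 : ∀ e, (x e).2 ∈ A := fun e => (hm _).2 ⟨e, Or.inr rfl⟩
  refine ⟨A.card, ?_, fun e => (A.equivFin ⟨_, h1 e⟩, A.equivFin ⟨_, h2 e⟩),
    fun v => (A.equivFin.symm v : κ), fun v => ?_, fun e => by simp⟩
  · rw [hA]
    have := Finset.card_union_le (Finset.univ.image fun e => (x e).1)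
      (Finset.univ.image fun e => (x e).2)
    have := Finset.card_image_le (s := Finset.univ) (f := fun e => (x e).1)
    have := Finset.card_image_le (s := Finset.univ) (f := fun e => (x e).2)
    simp only [Finset.card_univ, Fintype.card_fin] at *
    omega
  · obtain ⟨σ, rfl⟩ := A.equivFin.surjective v
    obtain ⟨e, he⟩ := (hm _).1 σ.2
    obtain ⟨e', hne, he'⟩ := hx e _ he
    refine ⟨e, e', hne.symm, ?_, ?_⟩ <;> simpa [Subtype.ext_iff]

/-- The number of ways of identifying the ends of `q` edges. -/
def patternCount (q : ℕ) : ℕ := ∑ r ∈ Finset.range (2 * q + 1), (r * r) ^ q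

open scoped Classical in
lemma sum_noLonely_le {κ : Type*} [Fintype κ] (q : ℕ) (c : κ → κ → ℝ≥0) :
    ∑ x : Fin q → κ × κ with NoLonely x, ∏ e, c (x e).1 (x e).2 ≤
      patternCount q * NNReal.sqrt (∑ s, ∑ t, c s t ^ 2) ^ q := by
  set t : Finset (Σ r : ℕ, (Fin r → κ) × (Fin q → Fin r × Fin r)) :=
    (Finset.range (2 * q + 1)).sigma fun r => Finset.univ ×ˢ Finset.univ.filter fun π =>
      ∀ v, ∃ e e', e ≠ e' ∧ (v = (π e).1 ∨ v = (π e).2) ∧ (v = (π e').1 ∨ v = (π e').2) with ht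
  refine (sum_le_sum_of_forall_exists _ t (fun i e => (i.2.1 (i.2.2 e).1, i.2.1 (i.2.2 e).2)) _
    fun x hx => ?_).trans ?_
  · obtain ⟨r, hr, π, z, hπ, hz⟩ := exists_pattern (Finset.mem_filter.1 hx).2
    refine ⟨⟨r, z, π⟩, ?_, ?_⟩
    · rw [ht]
      simp only [Finset.mem_sigma, Finset.mem_range, Finset.mem_product, Finset.mem_univ,
        Finset.mem_filter, true_and]
      exact ⟨hr, hπ⟩
    · exact funext fun e => (hz e).symm
  · rw [ht, Finset.sum_sigma, patternCount, Nat.cast_sum, Finset.sum_mul]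
    refine Finset.sum_le_sum fun r _ => ?_
    rw [Finset.sum_product_right]
    refine (Finset.sum_le_card_nsmul _ _ (NNReal.sqrt (∑ s, ∑ t, c s t ^ 2) ^ q)
      fun π hπ => ?_).trans ?_
    · refine (sum_prod_graph_le (fun e => (π e).1) (fun e => (π e).2)
        (Finset.mem_filter.1 hπ).2 c).trans ?_
      rw [Fintype.card_fin]
    · rw [nsmul_eq_mul]
      gcongr
      refine (Finset.card_filter_le _ _).trans (le_of_eq ?_)
      simp

section Chaos

variable {κ : Type*} [DecidableEq κ] {Λ : Finset (ℤ × ℤ)} {cls : ℤ × ℤ → κ} {q : ℕ}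

lemma noLonely_of_splits (hsym : ∀ ξ ∈ Λ, -ξ ∈ Λ) (h0 : (0 : ℤ × ℤ) ∉ Λ)
    (hs : Splits Λ cls (2 * q)) {x : Fin q → (ℤ × ℤ) × (ℤ × ℤ)} (hx : ∀ i, x i ∈ Λ.offDiag)
    (hsum : ∑ i, ((x i).1 - (x i).2) = 0) :
    NoLonely fun i => (cls (x i).1, cls (x i).2) := by
  intro e σ hσ
  by_contra! hne
  have h1 : ∀ i, (x i).1 ∈ Λ := fun i => (Finset.mem_offDiag.1 (hx i)).1
  have h2 : ∀ i, (x i).2 ∈ Λ := fun i => (Finset.mem_offDiag.1 (hx i)).2.1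
  have key := hs.2 (q + q) (by omega) (Fin.append (fun i => (x i).1) fun i => -(x i).2)
    (fun i => by
      refine Fin.addCases (fun i => ?_) (fun i => ?_) i
      · rw [Fin.append_left]; exact h1 i
      · rw [Fin.append_right]; exact hsym _ (h2 i)) (by
      rw [Fin.sum_univ_add]
      simp_rw [Fin.append_left, Fin.append_right]
      rw [← Finset.sum_add_distrib, ← hsum]
      simp_rw [sub_eq_add_neg]) σ
  rw [Finset.sum_filter, Fin.sum_univ_add] at key
  simp_rw [Fin.append_left, Fin.append_right, hs.1] at key
  rw [Finset.sum_eq_single e (fun i _ hi => if_neg fun h => (hne i hi).1 h.symm) (by simp),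
    Finset.sum_eq_single e (fun i _ hi => if_neg fun h => (hne i hi).2 h.symm) (by simp)] at key
  have n1 : (x e).1 ≠ 0 := fun h => h0 (h ▸ h1 e)
  have n2 : (x e).2 ≠ 0 := fun h => h0 (h ▸ h2 e)
  have n3 := (Finset.mem_offDiag.1 (hx e)).2.2
  split_ifs at key with ha hb hb
  · exact n3 (by rwa [← sub_eq_add_neg, sub_eq_zero] at key)
  · exact n1 (by rwa [add_zero] at key)
  · exact n2 (by rwa [zero_add, neg_eq_zero] at key)
  · rcases hσ with h | h
    · exact ha h.symm
    · exact hb h.symm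

/-- The total mass of a block of a matrix indexed by frequencies. -/
def blockMass (Λ : Finset (ℤ × ℤ)) (cls : ℤ × ℤ → κ) (B : ℤ × ℤ → ℤ × ℤ → ℂ) (σ τ : κ) : ℝ≥0 :=
  ∑ p ∈ Λ ×ˢ Λ with (cls p.1, cls p.2) = (σ, τ), ‖B p.1 p.2‖₊

lemma sum_blockMass_sq_le [Fintype κ] {D : ℕ}
    (hcard : ∀ σ, (Λ.filter fun ξ => cls ξ = σ).card ≤ D) (B : ℤ × ℤ → ℤ × ℤ → ℂ) :
    ∑ σ, ∑ τ, blockMass Λ cls B σ τ ^ 2 ≤ D ^ 2 * ∑ p ∈ Λ ×ˢ Λ, ‖B p.1 p.2‖₊ ^ 2 := by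
  rw [← Finset.sum_fiberwise (Λ ×ˢ Λ) (fun p => (cls p.1, cls p.2)), Fintype.sum_prod_type,
    Finset.mul_sum]
  refine Finset.sum_le_sum fun σ _ => ?_
  rw [Finset.mul_sum]
  refine Finset.sum_le_sum fun τ _ => ?_
  refine sq_sum_le_card_mul_sum_sq.trans ?_
  gcongr
  have : (Λ ×ˢ Λ).filter (fun p => (cls p.1, cls p.2) = (σ, τ)) =
      (Λ.filter fun ξ => cls ξ = σ) ×ˢ (Λ.filter fun ξ => cls ξ = τ) := by
    ext p
    simp only [Finset.mem_filter, Finset.mem_product, Prod.mk.injEq]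
    tauto
  rw [this, Finset.card_product, pow_two]
  exact_mod_cast Nat.mul_le_mul (hcard σ) (hcard τ)

lemma norm_integral_chaos_pow_le [Fintype κ] {D : ℕ} (hsym : ∀ ξ ∈ Λ, -ξ ∈ Λ)
    (h0 : (0 : ℤ × ℤ) ∉ Λ) (hs : Splits Λ cls (2 * q))
    (hcard : ∀ σ, (Λ.filter fun ξ => cls ξ = σ).card ≤ D) (B : ℤ × ℤ → ℤ × ℤ → ℂ) :
    ‖∫ y, (∑ p ∈ Λ.offDiag, B p.1 p.2 * chr (p.1 - p.2) y) ^ q ∂haarTor‖ ≤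
      patternCount q * (D * √(∑ p ∈ Λ ×ˢ Λ, ‖B p.1 p.2‖ ^ 2)) ^ q := by
  classical
  have expand : ∀ b : (ℤ × ℤ) × (ℤ × ℤ) → ℂ, (∑ p ∈ Λ.offDiag, b p) ^ q =
      ∑ x ∈ Fintype.piFinset fun _ : Fin q => Λ.offDiag, ∏ i, b (x i) := by
    intro b
    rw [← Finset.prod_univ_sum]
    simp
  simp_rw [expand, Finset.prod_mul_distrib]
  rw [integral_finsetSum _ fun p _ => integrable_haarTor (by
      have := continuous_chr
      fun_prop)]
  simp_rw [← chr_sum, integral_const_mul, integral_chr, mul_ite, mul_one, mul_zero]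
  rw [← Finset.sum_filter]
  have hbound : ∑ x ∈ (Fintype.piFinset fun _ : Fin q => Λ.offDiag).filter
        (fun x => ∑ i, ((x i).1 - (x i).2) = 0), ∏ i, ‖B (x i).1 (x i).2‖₊ ≤
      ∑ X : Fin q → κ × κ with NoLonely X, ∏ i, blockMass Λ cls B (X i).1 (X i).2 := by
    rw [← Finset.sum_fiberwise_of_maps_to (t := Finset.univ.filter NoLonely)
      (g := fun x i => (cls (x i).1, cls (x i).2)) fun x hx => by
        rw [Finset.mem_filter, Fintype.mem_piFinset] at hx
        exact Finset.mem_filter.2 ⟨Finset.mem_univ _, noLonely_of_splits hsym h0 hs hx.1 hx.2⟩]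
    refine Finset.sum_le_sum fun X _ => ?_
    unfold blockMass
    rw [Finset.prod_univ_sum]
    refine Finset.sum_le_sum_of_subset fun x hx => ?_
    simp only [Finset.mem_filter, Fintype.mem_piFinset] at hx ⊢
    intro i
    have := Finset.mem_offDiag.1 (hx.1.1 i)
    exact ⟨Finset.mem_product.2 ⟨this.1, this.2.1⟩, congrFun hx.2 i⟩
  have hfin := hbound.trans ((sum_noLonely_le q (blockMass Λ cls B)).trans (mul_le_mul_right
    (pow_le_pow_left' (NNReal.sqrt_le_sqrt.2 (sum_blockMass_sq_le hcard B)) q) _))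
  rw [NNReal.sqrt_mul, NNReal.sqrt_sq] at hfin
  refine (norm_sum_le _ _).trans ?_
  simp_rw [norm_prod]
  have := NNReal.coe_le_coe.2 hfin
  push_cast [Real.coe_sqrt] at this
  exact this

end Chaos

lemma pow_card_le_norm_prod_sub {ι : Type*} {s : Finset ι} {z : ι → ℂ} {δ : ℝ} (hδ : 0 ≤ δ) {ξ : ι}
    (hsep : ∀ η ∈ s, δ ≤ ‖z ξ - z η‖) : δ ^ s.card ≤ ‖∏ η ∈ s, (z ξ - z η)‖ := by
  rw [norm_prod]
  rw [← Finset.prod_const]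
  exact Finset.prod_le_prod (fun _ _ => hδ) hsep

section Isolation

variable {ι : Type*} [DecidableEq ι]

/-- Applying the difference operators which annihilate chosen frequencies to an exponential sum. -/
lemma norm_sum_mul_prod_sub_le (Λ s : Finset ι) (z : ι → ℂ) (hz : ∀ ξ, ‖z ξ‖ ≤ 1) (b : ι → ℂ)
    {ε : ℝ} (h : ∀ k ≤ s.card, ‖∑ ξ ∈ Λ, b ξ * z ξ ^ k‖ ≤ ε) :
    ‖∑ ξ ∈ Λ, b ξ * ∏ η ∈ s, (z ξ - z η)‖ ≤ 2 ^ s.card * ε := by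
  induction s using Finset.induction_on generalizing b ε with
  | empty => simpa using h 0 (by simp)
  | insert η s hη ih =>
    rw [Finset.card_insert_of_notMem hη] at h ⊢
    have := ih (fun ξ => b ξ * (z ξ - z η)) (ε := 2 * ε) fun k hk => by
      have e : ∑ ξ ∈ Λ, b ξ * (z ξ - z η) * z ξ ^ k =
          ∑ ξ ∈ Λ, b ξ * z ξ ^ (k + 1) - z η * ∑ ξ ∈ Λ, b ξ * z ξ ^ k := by
        rw [Finset.mul_sum, ← Finset.sum_sub_distrib]
        refine Finset.sum_congr rfl fun ξ _ => ?_
        ring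
      rw [e]
      have h1 := h (k + 1) (by omega)
      have h2 := h k (by omega)
      have h3 : ‖z η * ∑ ξ ∈ Λ, b ξ * z ξ ^ k‖ ≤ 1 * ε := by
        rw [norm_mul]
        exact mul_le_mul (hz η) h2 (norm_nonneg _) zero_le_one
      linarith [norm_sub_le (∑ ξ ∈ Λ, b ξ * z ξ ^ (k + 1)) (z η * ∑ ξ ∈ Λ, b ξ * z ξ ^ k)]
    simp_rw [Finset.prod_insert hη, ← mul_assoc]
    refine this.trans (le_of_eq ?_)
    ring

/-- A coefficient of an exponential sum with separated frequencies is controlled by as many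
consecutive values of the sum as there are frequencies. -/
lemma norm_coeff_le_of_separated {Λ : Finset ι} {z : ι → ℂ} (hz : ∀ ξ, ‖z ξ‖ ≤ 1) {δ ε : ℝ}
    (hδ : 0 < δ) (hsep : ∀ ξ ∈ Λ, ∀ η ∈ Λ, ξ ≠ η → δ ≤ ‖z ξ - z η‖) (b : ι → ℂ)
    (h : ∀ k ≤ Λ.card, ‖∑ ξ ∈ Λ, b ξ * z ξ ^ k‖ ≤ ε) {ξ : ι} (hξ : ξ ∈ Λ) :
    ‖b ξ‖ ≤ (2 / δ) ^ (Λ.card - 1) * ε := by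
  have hc := Finset.card_erase_of_mem hξ
  have h1 := norm_sum_mul_prod_sub_le Λ (Λ.erase ξ) z hz b fun k hk => h k (by omega)
  rw [Finset.sum_eq_single ξ (fun η hη hne => by
    rw [Finset.prod_eq_zero (Finset.mem_erase.2 ⟨hne, hη⟩) (sub_self _), mul_zero])
    (fun h => absurd hξ h), norm_mul, hc] at h1
  have h2 := pow_card_le_norm_prod_sub (s := Λ.erase ξ) hδ.le fun η hη =>
    hsep ξ hξ η (Finset.mem_of_mem_erase hη) (Finset.ne_of_mem_erase hη).symm
  rw [hc] at h2
  rw [div_pow, div_mul_eq_mul_div, le_div_iff₀ (by positivity)]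
  exact (mul_le_mul_of_nonneg_left h2 (norm_nonneg _)).trans h1

end Isolation

lemma norm_eval_le_of_nodes {ι : Type*} [DecidableEq ι] {s : Finset ι} {v : ι → ℝ}
    {P : Polynomial ℂ} (hP : P.degree < s.card) {x M ε : ℝ} (hM : 1 ≤ M)
    (hne : ∀ i ∈ s, ∀ j ∈ s, i ≠ j → v i ≠ v j)
    (hsep : ∀ i ∈ s, ∀ j ∈ s, i ≠ j → |x - v j| ≤ M * |v i - v j|)
    (h : ∀ i ∈ s, ‖P.eval (v i : ℂ)‖ ≤ ε) :
    ‖P.eval (x : ℂ)‖ ≤ s.card * M ^ s.card * ε := by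
  have hinj : Set.InjOn (fun i => (v i : ℂ)) s := by
    intro i hi j hj hij
    by_contra hne'
    exact hne i hi j hj hne' (Complex.ofReal_injective hij)
  rw [Lagrange.eq_interpolate hinj hP, Lagrange.interpolate_apply, Polynomial.eval_finsetSum]
  have hterm : ∀ i ∈ s, ‖(Polynomial.C (P.eval (v i : ℂ)) *
      Lagrange.basis s (fun i => (v i : ℂ)) i).eval (x : ℂ)‖ ≤ M ^ s.card * ε := by
    intro i hi
    rw [Polynomial.eval_mul, Polynomial.eval_C, norm_mul, mul_comm]
    refine mul_le_mul ?_ (h i hi) (norm_nonneg _) (by positivity)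
    rw [Lagrange.basis, Polynomial.eval_prod, norm_prod]
    calc _ ≤ ∏ j ∈ s.erase i, M := by
          refine Finset.prod_le_prod (fun _ _ => norm_nonneg _) fun j hj => ?_
          have hji := Finset.ne_of_mem_erase hj
          have hj' := Finset.mem_of_mem_erase hj
          have hpos : 0 < |v i - v j| := abs_pos.2 (sub_ne_zero.2 (hne i hi j hj' hji.symm))
          simp only [Lagrange.basisDivisor, Polynomial.eval_mul, Polynomial.eval_C,
            Polynomial.eval_sub, Polynomial.eval_X]
          rw [← Complex.ofReal_sub, ← Complex.ofReal_sub, norm_mul, norm_inv, Complex.norm_real,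
            Complex.norm_real, Real.norm_eq_abs, Real.norm_eq_abs, inv_mul_le_iff₀ hpos, mul_comm]
          exact hsep i hi j hj' hji.symm
      _ = M ^ (s.erase i).card := Finset.prod_const _
      _ ≤ M ^ s.card := pow_le_pow_right₀ hM (Finset.card_le_card (Finset.erase_subset _ _))
  refine (norm_sum_le_of_le s hterm).trans
    (le_of_eq (by rw [Finset.sum_const, nsmul_eq_mul, mul_assoc]))

/-- Smallness of an exponential sum at separated points spreads to the whole interval. -/
lemma norm_expSum_le_of_nodes {ι ι' : Type*} [DecidableEq ι] {s : Finset ι} {v : ι → ℝ}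
    (Λ : Finset ι') (b : ι' → ℂ) (ω : ι' → ℝ) {x M ε S c : ℝ} (hM : 1 ≤ M)
    (hS : ∑ ξ ∈ Λ, ‖b ξ‖ ≤ S) (hc : 0 ≤ c) (hω : ∀ ξ ∈ Λ, |x * ω ξ| ≤ c)
    (hω' : ∀ i ∈ s, ∀ ξ ∈ Λ, |v i * ω ξ| ≤ c)
    (hne : ∀ i ∈ s, ∀ j ∈ s, i ≠ j → v i ≠ v j)
    (hsep : ∀ i ∈ s, ∀ j ∈ s, i ≠ j → |x - v j| ≤ M * |v i - v j|)
    (h : ∀ i ∈ s, ‖∑ ξ ∈ Λ, b ξ * Complex.exp (((v i * ω ξ : ℝ) : ℂ) * I)‖ ≤ ε) :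
    ‖∑ ξ ∈ Λ, b ξ * Complex.exp (((x * ω ξ : ℝ) : ℂ) * I)‖ ≤
      s.card * M ^ s.card * (ε + S * c ^ s.card) + S * c ^ s.card := by
  set m := s.card with hm
  have hS0 : 0 ≤ S := (Finset.sum_nonneg fun _ _ => norm_nonneg _).trans hS
  set P : Polynomial ℂ := ∑ k ∈ Finset.range m,
    Polynomial.monomial k ((∑ ξ ∈ Λ, b ξ * (ω ξ * I) ^ k) / (k.factorial : ℂ)) with hP
  have hdeg : P.degree < m := by
    rw [hP, Polynomial.degree_lt_iff_coeff_zero]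
    intro k hk
    rw [Polynomial.finsetSum_coeff]
    refine Finset.sum_eq_zero fun j hj => ?_
    rw [Polynomial.coeff_monomial, if_neg]
    have := Finset.mem_range.1 hj
    omega
  have hev : ∀ r : ℝ, P.eval (r : ℂ) = ∑ ξ ∈ Λ, b ξ * ∑ k ∈ Finset.range m,
      (((r * ω ξ : ℝ) : ℂ) * I) ^ k / (k.factorial : ℂ) := by
    intro r
    rw [hP, Polynomial.eval_finsetSum]
    simp_rw [Finset.mul_sum, Polynomial.eval_monomial]
    rw [Finset.sum_comm]
    refine Finset.sum_congr rfl fun k _ => ?_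
    rw [Finset.sum_div, Finset.sum_mul]
    refine Finset.sum_congr rfl fun ξ _ => ?_
    push_cast
    ring
  have herr : ∀ r : ℝ, (∀ ξ ∈ Λ, |r * ω ξ| ≤ c) →
      ‖∑ ξ ∈ Λ, b ξ * Complex.exp (((r * ω ξ : ℝ) : ℂ) * I) - P.eval (r : ℂ)‖ ≤ S * c ^ m := by
    intro r hr
    rw [hev, ← Finset.sum_sub_distrib]
    have h1 : ∀ ξ ∈ Λ, ‖b ξ * Complex.exp (((r * ω ξ : ℝ) : ℂ) * I) - b ξ *
        ∑ k ∈ Finset.range m, (((r * ω ξ : ℝ) : ℂ) * I) ^ k / (k.factorial : ℂ)‖ ≤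
        ‖b ξ‖ * c ^ m := by
      intro ξ hξ
      rw [← mul_sub, norm_mul]
      gcongr
      refine (norm_cexp_sub_taylor_le m (r * ω ξ)).trans ((div_le_self (by positivity) ?_).trans ?_)
      · exact_mod_cast Nat.factorial_pos m
      · gcongr
        exact hr ξ hξ
    refine (norm_sum_le_of_le Λ h1).trans ?_
    rw [← Finset.sum_mul]
    gcongr
  have hnode : ∀ i ∈ s, ‖P.eval (v i : ℂ)‖ ≤ ε + S * c ^ m := by
    intro i hi
    have h1 := h i hi
    have h2 := herr (v i) (hω' i hi)
    rw [norm_sub_rev] at h2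
    linarith [norm_le_norm_add_norm_sub' (P.eval (v i : ℂ))
      (∑ ξ ∈ Λ, b ξ * Complex.exp (((v i * ω ξ : ℝ) : ℂ) * I))]
  have h3 := norm_eval_le_of_nodes hdeg hM hne hsep hnode
  have h4 := herr x hω
  linarith [norm_le_norm_add_norm_sub'
    (∑ ξ ∈ Λ, b ξ * Complex.exp (((x * ω ξ : ℝ) : ℂ) * I)) (P.eval (x : ℂ))]

/-- An orthonormal basis of the span of vectors which are biorthogonal to coordinates has
controlled coefficients. -/
lemma exists_orthonormal_combinations {ι : Type*} [DecidableEq ι] {Λ s : Finset ι} (hs : s ⊆ Λ)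
    {a : ι → ℂ} {A : ℝ} (hA : ∀ ν ∈ s, 1 ≤ A * ‖a ν‖) (w : ι → ι → ℂ)
    (hw : ∀ ν ∈ s, ∀ ν' ∈ s, w ν ν' = if ν = ν' then a ν else 0) :
    ∃ g γ : Fin s.card → ι → ℂ, (∀ j ξ, g j ξ = ∑ ν ∈ s, γ j ν * w ν ξ) ∧
      (∀ i j, ∑ ξ ∈ Λ, g i ξ * starRingEnd ℂ (g j ξ) = if i = j then 1 else 0) ∧
      ∀ j, ∀ ν ∈ s, ‖γ j ν‖ ≤ A := by
  set W : s → EuclideanSpace ℂ Λ := fun ν => WithLp.toLp 2 fun ξ => w ν ξ with hW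
  have ha0 : ∀ ν ∈ s, a ν ≠ 0 := by
    intro ν hν h
    have := hA ν hν
    rw [h, norm_zero, mul_zero] at this
    linarith
  have hcoord : ∀ (c : s → ℂ) (ν : s), (∑ μ, c μ • W μ) ⟨ν, hs ν.2⟩ = c ν * a ν := by
    intro c ν
    rw [WithLp.ofLp_sum, Finset.sum_apply]
    simp only [hW, WithLp.ofLp_smul, Pi.smul_apply, smul_eq_mul]
    rw [Finset.sum_eq_single ν]
    · rw [hw _ ν.2 _ ν.2, if_pos rfl]
    · intro μ _ hμ
      rw [hw _ μ.2 _ ν.2, if_neg (fun h => hμ (Subtype.ext h)), mul_zero]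
    · simp
  have hli : LinearIndependent ℂ W := by
    rw [Fintype.linearIndependent_iff]
    intro c hc ν
    have := hcoord c ν
    rw [hc] at this
    exact (mul_eq_zero.1 this.symm).resolve_right (ha0 ν ν.2)
  have hrank : Module.finrank ℂ (Submodule.span ℂ (Set.range W)) = s.card := by
    rw [finrank_span_eq_card hli, Fintype.card_coe]
  set e := (stdOrthonormalBasis ℂ (Submodule.span ℂ (Set.range W))).reindex (finCongr hrank)
    with he
  have hex : ∀ j, ∃ c : s → ℂ, ∑ ν, c ν • W ν = (e j : EuclideanSpace ℂ Λ) := fun j =>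
    (Submodule.mem_span_range_iff_exists_fun ℂ).1 (e j).2
  choose c hc using hex
  have hgc : ∀ j (ξ : Λ), (e j : EuclideanSpace ℂ Λ) ξ = ∑ ν, c j ν * w ν ξ := by
    intro j ξ
    rw [← hc, WithLp.ofLp_sum, Finset.sum_apply]
    rfl
  have hsum : ∀ j ξ, ∑ ν ∈ s, (if h : ν ∈ s then c j ⟨ν, h⟩ else 0) * w ν ξ =
      ∑ ν : s, c j ν * w ν ξ := by
    intro j ξ
    rw [← Finset.sum_coe_sort s]
    refine Finset.sum_congr rfl fun ν _ => ?_
    rw [dif_pos ν.2]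
  refine ⟨fun j ξ => ∑ ν : s, c j ν * w ν ξ, fun j ν => if h : ν ∈ s then c j ⟨ν, h⟩ else 0,
    fun j ξ => (hsum j ξ).symm, fun i j => ?_, fun j ν hν => ?_⟩
  · have h1 := orthonormal_iff_ite.1 e.orthonormal j i
    rw [Submodule.coe_inner, PiLp.inner_apply] at h1
    rw [← Finset.sum_coe_sort Λ]
    simp_rw [← hgc]
    simp only [RCLike.inner_apply] at h1
    rw [h1]
    simp only [eq_comm]
  · simp only [dif_pos hν]
    have h1 := hcoord (c j) ⟨ν, hν⟩
    rw [hc] at h1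
    have h2 : ‖(e j : EuclideanSpace ℂ Λ) ⟨ν, hs hν⟩‖ ≤ 1 := by
      refine (PiLp.norm_apply_le _ _).trans (le_of_eq ?_)
      exact e.orthonormal.1 j
    rw [h1, norm_mul] at h2
    have h3 := hA ν hν
    have h4 : 0 < ‖a ν‖ := norm_pos_iff.2 (ha0 ν hν)
    nlinarith [norm_nonneg (c j ⟨ν, hν⟩)]

/-- The rescaled kernel of the orthogonal projection onto the span of orthonormal vectors. -/
def projKernel {m : ℕ} (g : Fin m → ℤ × ℤ → ℂ) (ξ η : ℤ × ℤ) : ℂ :=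
  (m : ℂ)⁻¹ * ∑ j, g j ξ * starRingEnd ℂ (g j η)

section Kernel

variable {Λ : Finset (ℤ × ℤ)} {m : ℕ} {g : Fin m → ℤ × ℤ → ℂ}

lemma sum_projKernel_self (hm : 0 < m)
    (hg : ∀ i j, ∑ ξ ∈ Λ, g i ξ * starRingEnd ℂ (g j ξ) = if i = j then 1 else 0) :
    ∑ ξ ∈ Λ, projKernel g ξ ξ = 1 := by
  unfold projKernel
  rw [← Finset.mul_sum, Finset.sum_comm]
  simp_rw [hg]
  have : (m : ℂ) ≠ 0 := by exact_mod_cast hm.ne'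
  simp [this]

lemma sum_norm_projKernel_sq (hm : 0 < m)
    (hg : ∀ i j, ∑ ξ ∈ Λ, g i ξ * starRingEnd ℂ (g j ξ) = if i = j then 1 else 0) :
    ∑ p ∈ Λ ×ˢ Λ, ‖projKernel g p.1 p.2‖ ^ 2 = 1 / (m : ℝ) := by
  have hm0 : (m : ℂ) ≠ 0 := by exact_mod_cast hm.ne'
  have e : ∀ ξ η, ((‖projKernel g ξ η‖ ^ 2 : ℝ) : ℂ) = (m : ℂ)⁻¹ ^ 2 * ∑ i, ∑ j,
      (g i ξ * starRingEnd ℂ (g j ξ)) * (g j η * starRingEnd ℂ (g i η)) := by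
    intro ξ η
    rw [Complex.ofReal_pow, ← Complex.mul_conj', projKernel, map_mul, map_sum, map_inv₀,
      Complex.conj_natCast]
    rw [mul_mul_mul_comm, ← pow_two, Finset.sum_mul_sum]
    congr 1
    refine Finset.sum_congr rfl fun i _ => Finset.sum_congr rfl fun j _ => ?_
    rw [map_mul, Complex.conj_conj]
    ring
  have key : ((∑ p ∈ Λ ×ˢ Λ, ‖projKernel g p.1 p.2‖ ^ 2 : ℝ) : ℂ) = ((1 / (m : ℝ) : ℝ) : ℂ) := by
    rw [Complex.ofReal_sum]
    simp_rw [e]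
    rw [← Finset.mul_sum, Finset.sum_comm]
    have h1 : ∀ i, ∑ p ∈ Λ ×ˢ Λ, ∑ j, (g i p.1 * starRingEnd ℂ (g j p.1)) *
        (g j p.2 * starRingEnd ℂ (g i p.2)) = 1 := by
      intro i
      rw [Finset.sum_comm]
      have h2 : ∀ j, ∑ p ∈ Λ ×ˢ Λ, (g i p.1 * starRingEnd ℂ (g j p.1)) *
          (g j p.2 * starRingEnd ℂ (g i p.2)) = if i = j then 1 else 0 := by
        intro j
        rw [Finset.sum_product]
        simp_rw [← Finset.mul_sum]
        rw [← Finset.sum_mul, hg, hg]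
        by_cases h : i = j
        · simp [h]
        · simp [h]
      simp_rw [h2]
      simp
    simp_rw [h1]
    simp only [Finset.sum_const, Finset.card_univ, Fintype.card_fin, nsmul_eq_mul, mul_one]
    push_cast
    field_simp
  exact_mod_cast key

/-- Many orthonormal random trigonometric polynomials are unlikely to be simultaneously small. -/
lemma measure_forall_norm_trig_le {κ : Type*} [Fintype κ] [DecidableEq κ] {cls : ℤ × ℤ → κ}
    {D l : ℕ} (hsym : ∀ ξ ∈ Λ, -ξ ∈ Λ) (h0 : (0 : ℤ × ℤ) ∉ Λ) (hs : Splits Λ cls (2 * (2 * l)))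
    (hcard : ∀ σ, (Λ.filter fun ξ => cls ξ = σ).card ≤ D) (hm : 0 < m)
    (hg : ∀ i j, ∑ ξ ∈ Λ, g i ξ * starRingEnd ℂ (g j ξ) = if i = j then 1 else 0)
    {V : Set Tor} (hV : ∀ y ∈ V, ∀ j, ‖trig Λ (g j) y‖ ^ 2 ≤ 1 / 2) :
    haarTor.real V ≤ 4 ^ l * (patternCount (2 * l) * ((D : ℝ) ^ 2 / m) ^ l) := by
  have hm0 : (m : ℂ) ≠ 0 := by exact_mod_cast hm.ne'
  have hmr : (0 : ℝ) < m := by exact_mod_cast hm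
  set Z : Tor → ℝ := fun y => (m : ℝ)⁻¹ * ∑ j, ‖trig Λ (g j) y‖ ^ 2 - 1 with hZ
  have hZc : Continuous Z := by
    have := fun j => continuous_trig Λ (g j)
    fun_prop
  have hZe : ∀ y, (Z y : ℂ) = ∑ p ∈ Λ.offDiag, projKernel g p.1 p.2 * chr (p.1 - p.2) y := by
    intro y
    have h1 : ∑ p ∈ Λ ×ˢ Λ, projKernel g p.1 p.2 * chr (p.1 - p.2) y =
        (m : ℂ)⁻¹ * ∑ j, trig Λ (g j) y * starRingEnd ℂ (trig Λ (g j) y) := by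
      simp_rw [trig_mul_conj, projKernel]
      rw [Finset.sum_product]
      refine Eq.trans ?_ (congrArg ((m : ℂ)⁻¹ * ·) Finset.sum_comm)
      rw [Finset.mul_sum]
      refine Finset.sum_congr rfl fun ξ _ => ?_
      refine Eq.trans ?_ (congrArg ((m : ℂ)⁻¹ * ·) Finset.sum_comm)
      rw [Finset.mul_sum]
      refine Finset.sum_congr rfl fun η _ => ?_
      rw [mul_assoc, Finset.sum_mul]
    have h2 : (Z y : ℂ) = (m : ℂ)⁻¹ * ∑ j, trig Λ (g j) y * starRingEnd ℂ (trig Λ (g j) y) - 1 := by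
      rw [hZ]
      push_cast
      simp_rw [Complex.mul_conj']
    rw [h2, ← h1, ← Finset.diag_union_offDiag, Finset.sum_union (Finset.disjoint_diag_offDiag Λ),
      Finset.sum_diag]
    simp_rw [sub_self, chr_zero, mul_one]
    rw [sum_projKernel_self hm hg]
    ring
  have hmom : ∫ y, Z y ^ (2 * l) ∂haarTor ≤ patternCount (2 * l) * ((D : ℝ) ^ 2 / m) ^ l := by
    have h1 := norm_integral_chaos_pow_le hsym h0 hs hcard (projKernel g)
    simp_rw [← hZe] at h1
    rw [sum_norm_projKernel_sq hm hg] at h1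
    have h2 : ∫ y, (Z y : ℂ) ^ (2 * l) ∂haarTor = ((∫ y, Z y ^ (2 * l) ∂haarTor : ℝ) : ℂ) := by
      rw [← integral_complex_ofReal]
      push_cast
      rfl
    rw [h2, Complex.norm_real] at h1
    refine (le_abs_self _).trans (h1.trans (le_of_eq ?_))
    rw [pow_mul, mul_pow, Real.sq_sqrt (by positivity), mul_one_div]
  have hsub : V ⊆ {y | (1 / 4 : ℝ) ^ l ≤ Z y ^ (2 * l)} := by
    intro y hy
    have h1 : (m : ℝ)⁻¹ * ∑ j, ‖trig Λ (g j) y‖ ^ 2 ≤ 1 / 2 := by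
      rw [inv_mul_le_iff₀ hmr]
      refine (Finset.sum_le_card_nsmul _ _ (1 / 2) fun j _ => hV y hy j).trans (le_of_eq ?_)
      simp
    rw [Set.mem_ofPred_eq, pow_mul]
    refine pow_le_pow_left₀ (by norm_num) ?_ l
    have h2 : Z y ≤ -(1 / 2) := by
      rw [hZ]
      linarith
    nlinarith
  have hmark := mul_meas_ge_le_integral_of_nonneg (μ := haarTor) (f := fun y => Z y ^ (2 * l))
    (Eventually.of_forall fun y => (even_two_mul l).pow_nonneg _)
    (integrable_haarTor (by fun_prop)) ((1 / 4 : ℝ) ^ l)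
  have hle : haarTor.real V ≤ haarTor.real {y | (1 / 4 : ℝ) ^ l ≤ Z y ^ (2 * l)} :=
    measureReal_mono hsub
  have h4 : (4 : ℝ) ^ l * (1 / 4) ^ l = 1 := by
    rw [← mul_pow]
    norm_num
  calc haarTor.real V = 4 ^ l * ((1 / 4) ^ l * haarTor.real V) := by rw [← mul_assoc, h4, one_mul]
    _ ≤ 4 ^ l * ((1 / 4) ^ l * haarTor.real {y | (1 / 4 : ℝ) ^ l ≤ Z y ^ (2 * l)}) := by gcongr
    _ ≤ _ := by
      exact mul_le_mul_of_nonneg_left (hmark.trans hmom) (by positivity)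

end Kernel

/-- Some line with bounded slope separates the projections of a separated set of points. -/
lemma exists_separating_direction {Λ : Finset (ℤ × ℤ)} {δ : ℝ} (hδ : 0 < δ)
    (hsep : ∀ ξ ∈ Λ, ∀ η ∈ Λ, ξ ≠ η → δ ≤ |(ξ.1 : ℝ) - η.1| ∨ δ ≤ |(ξ.2 : ℝ) - η.2|) :
    ∃ c : ℝ, 0 ≤ c ∧ c ≤ 1 ∧ ∀ ξ ∈ Λ, ∀ η ∈ Λ, ξ ≠ η →
      δ / (8 * (Λ.card : ℝ) ^ 2) ≤ |((ξ.1 : ℝ) + c * ξ.2) - ((η.1 : ℝ) + c * η.2)| := by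
  rcases Λ.eq_empty_or_nonempty with rfl | hne
  · exact ⟨0, le_rfl, zero_le_one, by simp⟩
  have hN : 1 ≤ Λ.card := hne.card_pos
  have hN' : (1 : ℝ) ≤ Λ.card := by exact_mod_cast hN
  set M : ℕ := 2 * Λ.card ^ 2 with hM
  have hMr : (M : ℝ) = 2 * (Λ.card : ℝ) ^ 2 := by rw [hM]; push_cast; rfl
  have hM0 : (0 : ℝ) < M := by rw [hMr]; positivity
  by_contra! hcon
  have hbad : ∀ i ∈ Finset.range M, ∃ q ∈ Λ.offDiag,
      |((q.1.1 : ℝ) + i / M * q.1.2) - ((q.2.1 : ℝ) + i / M * q.2.2)| <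
        δ / (8 * (Λ.card : ℝ) ^ 2) := by
    intro i hi
    have hi' : (i : ℝ) ≤ M := by exact_mod_cast (Finset.mem_range.1 hi).le
    obtain ⟨ξ, hξ, η, hη, hne, h⟩ := hcon (i / M) (by positivity) ((div_le_one hM0).2 hi')
    exact ⟨(ξ, η), Finset.mem_offDiag.2 ⟨hξ, hη, hne⟩, h⟩
  choose! q hq hqb using hbad
  have hcard : Λ.offDiag.card < (Finset.range M).card := by
    rw [Finset.offDiag_card, Finset.card_range, hM]
    have : 1 ≤ Λ.card ^ 2 := Nat.one_le_pow _ _ hN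
    have : Λ.card * Λ.card = Λ.card ^ 2 := (pow_two _).symm
    omega
  obtain ⟨i, hi, j, hj, hij, hqij⟩ := Finset.exists_ne_map_eq_of_card_lt_of_maps_to hcard hq
  have h1 := hqb i hi
  have h2 := hqb j hj
  rw [← hqij] at h2
  obtain ⟨hξ, hη, hne⟩ := Finset.mem_offDiag.1 (hq i hi)
  set d1 : ℝ := ((q i).1.1 : ℝ) - (q i).2.1 with hd1
  set d2 : ℝ := ((q i).1.2 : ℝ) - (q i).2.2 with hd2
  have e1 : ∀ u : ℝ, ((q i).1.1 : ℝ) + u * (q i).1.2 - (((q i).2.1 : ℝ) + u * (q i).2.2) =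
      d1 + u * d2 := fun u => by rw [hd1, hd2]; ring
  rw [e1] at h1 h2
  have hdist : (1 : ℝ) ≤ |(i : ℝ) - j| := by
    have : (1 : ℤ) ≤ |(i : ℤ) - j| := Int.one_le_abs (sub_ne_zero.2 (by exact_mod_cast hij))
    exact_mod_cast this
  have hδM : δ / (8 * (Λ.card : ℝ) ^ 2) = δ / (4 * M) := by rw [hMr]; ring_nf
  rw [hδM] at h1 h2
  have h3 : |d2| < δ / 2 := by
    have h4 : |((i : ℝ) - j) * d2 / M| < δ / (4 * M) + δ / (4 * M) := by
      have : ((i : ℝ) - j) * d2 / M = (d1 + i / M * d2) - (d1 + j / M * d2) := by ring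
      rw [this]
      exact (abs_sub _ _).trans_lt (add_lt_add h1 h2)
    rw [abs_div, abs_of_pos hM0, div_lt_iff₀ hM0, abs_mul] at h4
    have h5 : (δ / (4 * M) + δ / (4 * M)) * M = δ / 2 := by field_simp; ring
    rw [h5] at h4
    nlinarith [abs_nonneg d2]
  have hM2 : (2 : ℝ) ≤ M := by rw [hMr]; nlinarith
  have h6 : |d1| < δ := by
    have hi' : (i : ℝ) / M ≤ 1 :=
      (div_le_one hM0).2 (by exact_mod_cast (Finset.mem_range.1 hi).le)
    have h7 : |d1| ≤ |d1 + i / M * d2| + |(i : ℝ) / M * d2| := by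
      have := abs_sub (d1 + i / M * d2) ((i : ℝ) / M * d2)
      rwa [add_sub_cancel_right] at this
    rw [abs_mul, abs_of_nonneg (by positivity : (0 : ℝ) ≤ (i : ℝ) / M)] at h7
    have h8 : (i : ℝ) / M * |d2| ≤ 1 * |d2| := by gcongr
    have h9 : δ / (4 * M) ≤ δ / 8 := by
      gcongr
      linarith
    linarith
  rcases hsep _ hξ _ hη hne with h | h
  · exact absurd h (not_le.2 h6)
  · linarith

/-- The point at parameter `s` on the line of slope `c` through the origin of the torus. -/
def lineShift (c s : ℝ) : Tor := ((s : AddCircle (1 : ℝ)), ((c * s : ℝ) : AddCircle (1 : ℝ)))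

lemma chr_lineShift (ξ : ℤ × ℤ) (c s : ℝ) :
    chr ξ (lineShift c s) =
      Complex.exp (((s * (2 * Real.pi * (ξ.1 + c * ξ.2)) : ℝ) : ℂ) * I) := by
  simp only [chr, lineShift, fourier_coe_apply]
  rw [← Complex.exp_add]
  congr 1
  push_cast
  ring

lemma trig_add_lineShift (Λ : Finset (ℤ × ℤ)) (a : ℤ × ℤ → ℂ) (y : Tor) (c s : ℝ) :
    trig Λ a (y + lineShift c s) = ∑ ξ ∈ Λ, a ξ * chr ξ y *
      Complex.exp (((s * (2 * Real.pi * (ξ.1 + c * ξ.2)) : ℝ) : ℂ) * I) := by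
  unfold trig
  simp_rw [chr_apply_add, chr_lineShift, mul_assoc]

open scoped Classical in
/-- Most points of a set of positive measure see the set along most lines. -/
lemma measure_le_measure_window_add {E : Set Tor} (hE : MeasurableSet E) (v : ℕ → Tor) {m P : ℕ}
    (hm : 0 < m) (hP : 0 < P) :
    haarTor.real E ≤
      haarTor.real {y | m ≤ ((Finset.range (m * P)).filter fun i => y + v i ∈ E).card} + 1 / P := by
  set V : Set Tor := {y | m ≤ ((Finset.range (m * P)).filter fun i => y + v i ∈ E).card} with hV
  have hEi : ∀ i, MeasurableSet ((fun y => y + v i) ⁻¹' E) := fun i =>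
    (measurable_add_const (v i)) hE
  have hcount : ∀ y, ((((Finset.range (m * P)).filter fun i => y + v i ∈ E).card : ℕ) : ℝ) =
      ∑ i ∈ Finset.range (m * P), ((fun y => y + v i) ⁻¹' E).indicator (fun _ => (1 : ℝ)) y := by
    intro y
    rw [Finset.card_filter]
    push_cast
    refine Finset.sum_congr rfl fun i _ => ?_
    simp only [Set.indicator, Set.mem_preimage]
  have hmeas : Measurable fun y =>
      ∑ i ∈ Finset.range (m * P), ((fun y => y + v i) ⁻¹' E).indicator (fun _ => (1 : ℝ)) y :=
    Finset.measurable_sum _ fun i _ => measurable_const.indicator (hEi i)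
  have hVm : MeasurableSet V := by
    have : V = {y | (m : ℝ) ≤ ∑ i ∈ Finset.range (m * P),
        ((fun y => y + v i) ⁻¹' E).indicator (fun _ => (1 : ℝ)) y} := by
      ext y
      rw [hV, Set.mem_ofPred_eq, Set.mem_ofPred_eq, ← hcount, Nat.cast_le]
    rw [this]
    exact measurableSet_le measurable_const hmeas
  have hpt : ∀ y, ∑ i ∈ Finset.range (m * P),
      ((fun y => y + v i) ⁻¹' E).indicator (fun _ => (1 : ℝ)) y ≤
        V.indicator (fun _ => ((m * P : ℕ) : ℝ)) y + m := by
    intro y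
    rw [← hcount]
    by_cases hy : y ∈ V
    · rw [Set.indicator_of_mem hy]
      have := Finset.card_filter_le (Finset.range (m * P)) fun i => y + v i ∈ E
      rw [Finset.card_range] at this
      have : ((((Finset.range (m * P)).filter fun i => y + v i ∈ E).card : ℕ) : ℝ) ≤
        (m * P : ℕ) := by exact_mod_cast this
      have := Nat.cast_nonneg (α := ℝ) m
      linarith
    · rw [Set.indicator_of_notMem hy, zero_add]
      rw [hV, Set.mem_ofPred_eq, not_le] at hy
      exact_mod_cast hy.le
  have hEint : ∀ i, Integrable (((fun y => y + v i) ⁻¹' E).indicator fun _ => (1 : ℝ)) haarTor :=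
    fun i => (integrable_const 1).indicator (hEi i)
  have hkey := integral_mono (integrable_finsetSum (Finset.range (m * P)) fun i _ => hEint i)
    (((integrable_const ((m * P : ℕ) : ℝ)).indicator hVm).add (integrable_const (m : ℝ))) hpt
  rw [integral_finsetSum _ fun i _ => hEint i, integral_add'
    ((integrable_const ((m * P : ℕ) : ℝ)).indicator hVm) (integrable_const (m : ℝ))] at hkey
  have hinv : ∀ i, haarTor.real ((fun y => y + v i) ⁻¹' E) = haarTor.real E := fun i => by
    rw [measureReal_def, measure_preimage_add_right, measureReal_def]
  simp_rw [integral_indicator_const _ (hEi _), integral_indicator_const _ hVm, hinv] at hkey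
  simp only [Finset.sum_const, Finset.card_range, nsmul_eq_mul, smul_eq_mul, mul_one,
    integral_const, probReal_univ, one_mul] at hkey
  push_cast at hkey
  have hm' : (0 : ℝ) < m := by exact_mod_cast hm
  have hP' : (0 : ℝ) < P := by exact_mod_cast hP
  have h1 : (m * P : ℝ) * (haarTor.real V + 1 / P) = haarTor.real V * (m * P) + m := by
    field_simp
  exact le_of_mul_le_mul_left (hkey.trans h1.symm.le) (by positivity)

lemma half_abs_sub_le_norm_exp_sub {α β : ℝ} (h : |α - β| ≤ Real.pi) :
    |α - β| / 2 ≤ ‖Complex.exp ((α : ℂ) * I) - Complex.exp ((β : ℂ) * I)‖ := by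
  have h1 : Complex.exp ((α : ℂ) * I) - Complex.exp ((β : ℂ) * I) =
      Complex.exp ((β : ℂ) * I) * (Complex.exp (I * ((α - β : ℝ) : ℂ)) - 1) := by
    rw [mul_sub, ← Complex.exp_add, mul_one]
    congr 2
    push_cast
    ring
  rw [h1, norm_mul, Complex.norm_exp_ofReal_mul_I, one_mul,
    Complex.norm_exp_I_mul_ofReal_sub_one, Real.norm_eq_abs, abs_mul, abs_two]
  have h2 : |(α - β) / 2| ≤ Real.pi / 2 := by
    rw [abs_div, abs_two]
    linarith
  have h3 := Real.mul_abs_le_abs_sin h2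
  rw [abs_div, abs_two] at h3
  have h4 : (1 : ℝ) / 2 ≤ 2 / Real.pi := by
    rw [div_le_div_iff₀ two_pos Real.pi_pos]
    linarith [Real.pi_le_four]
  nlinarith [abs_nonneg (α - β)]

/-- A trigonometric polynomial which is small at many points of a short grid on a line is small on
the whole segment spanned by the grid. -/
lemma norm_trig_lineShift_le {Λ : Finset (ℤ × ℤ)} {a : ℤ × ℤ → ℂ} {y : Tor} {c h C ε S : ℝ}
    {m M : ℕ} (hM : 1 ≤ M) (hh : 0 < h) (hS : ∑ ξ ∈ Λ, ‖a ξ‖ ≤ S) (hC : 0 ≤ C)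
    (hω : ∀ ξ ∈ Λ, M * h * |2 * Real.pi * ((ξ.1 : ℝ) + c * ξ.2)| ≤ C) {t : Finset ℕ}
    (ht : t ⊆ Finset.range M) (htm : m ≤ t.card)
    (hsmall : ∀ i ∈ t, ‖trig Λ a (y + lineShift c (i * h))‖ ≤ ε) {x : ℝ} (hx0 : 0 ≤ x)
    (hx : x ≤ M * h) :
    ‖trig Λ a (y + lineShift c x)‖ ≤ m * (M : ℝ) ^ m * (ε + S * C ^ m) + S * C ^ m := by
  obtain ⟨s, hst, rfl⟩ := Finset.exists_subset_card_eq htm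
  have hsM : ∀ i ∈ s, (i : ℝ) ≤ M := fun i hi => by
    exact_mod_cast (Finset.mem_range.1 (ht (hst hi))).le
  have hbd : ∀ u : ℝ, 0 ≤ u → u ≤ M * h → ∀ ξ ∈ Λ,
      |u * (2 * Real.pi * ((ξ.1 : ℝ) + c * ξ.2))| ≤ C := by
    intro u hu0 hu ξ hξ
    rw [abs_mul, abs_of_nonneg hu0]
    exact (mul_le_mul_of_nonneg_right hu (abs_nonneg _)).trans (hω ξ hξ)
  have hM' : (1 : ℝ) ≤ M := by exact_mod_cast hM
  rw [trig_add_lineShift]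
  refine norm_expSum_le_of_nodes (s := s) (v := fun i : ℕ => (i : ℝ) * h) Λ
    (fun ξ => a ξ * chr ξ y) _ hM' ?_ hC (hbd x hx0 hx)
    (fun i hi => hbd _ (by positivity) (mul_le_mul_of_nonneg_right (hsM i hi) hh.le)) ?_ ?_ ?_
  · simpa only [norm_mul, norm_chr, mul_one] using hS
  · intro i _ j _ hij hv
    exact hij (by exact_mod_cast mul_right_cancel₀ hh.ne' hv)
  · intro i hi j hj hij
    have h1 : (1 : ℝ) ≤ |(i : ℝ) - j| := by
      have : (1 : ℤ) ≤ |(i : ℤ) - j| := Int.one_le_abs (sub_ne_zero.2 (by exact_mod_cast hij))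
      exact_mod_cast this
    have h2 : |x - j * h| ≤ M * h := by
      have h3 := mul_le_mul_of_nonneg_right (hsM j hj) hh.le
      have h4 : 0 ≤ (j : ℝ) * h := by positivity
      exact abs_le.2 ⟨by linarith, by linarith⟩
    refine h2.trans (mul_le_mul_of_nonneg_left ?_ (by positivity))
    rw [← sub_mul, abs_mul, abs_of_pos hh]
    nlinarith
  · intro i hi
    have := hsmall i (hst hi)
    rwa [trig_add_lineShift] at this

lemma card_le_card_significant {Λ : Finset (ℤ × ℤ)} {a : ℤ × ℤ → ℂ} {q : ℕ} (hΛ : Λ.Nonempty)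
    (h1 : ∑ ξ ∈ Λ, ‖a ξ‖ ^ 2 = 1) (hflat : ∀ ξ ∈ Λ, ‖a ξ‖ ^ 2 * Λ.card ≤ 100)
    (hq : 200 * q ≤ Λ.card) :
    q ≤ (Λ.filter fun ξ => 1 ≤ 2 * (Λ.card : ℝ) * ‖a ξ‖ ^ 2).card := by
  have hN : (0 : ℝ) < Λ.card := by exact_mod_cast hΛ.card_pos
  set s := Λ.filter fun ξ => 1 ≤ 2 * (Λ.card : ℝ) * ‖a ξ‖ ^ 2 with hs
  have hpt : ∀ ξ ∈ Λ, ‖a ξ‖ ^ 2 * Λ.card ≤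
      (if 1 ≤ 2 * (Λ.card : ℝ) * ‖a ξ‖ ^ 2 then (100 : ℝ) else 0) + 1 / 2 := by
    intro ξ hξ
    split_ifs with h
    · linarith [hflat ξ hξ]
    · linarith
  have h2 := Finset.sum_le_sum hpt
  rw [← Finset.sum_mul, h1, Finset.sum_add_distrib, ← Finset.sum_filter, Finset.sum_const,
    Finset.sum_const, ← hs, nsmul_eq_mul, nsmul_eq_mul] at h2
  have h3 : (200 * q : ℝ) ≤ Λ.card := by exact_mod_cast hq
  have : (q : ℝ) ≤ s.card := by linarith
  exact_mod_cast this

/-- A flat trigonometric polynomial is unlikely to be tiny along a whole segment. -/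
lemma measure_le_of_forall_pow_le {κ : Type*} [DecidableEq κ] {cls : ℤ × ℤ → κ}
    {Λ : Finset (ℤ × ℤ)} {a : ℤ × ℤ → ℂ} {D l q : ℕ}
    (hsym : ∀ ξ ∈ Λ, -ξ ∈ Λ) (h0 : (0 : ℤ × ℤ) ∉ Λ) (hs : Splits Λ cls (2 * (2 * l)))
    (hcard : ∀ σ, (Λ.filter fun ξ => cls ξ = σ).card ≤ D) (hq : 0 < q)
    (h1 : ∑ ξ ∈ Λ, ‖a ξ‖ ^ 2 = 1) (hflat : ∀ ξ ∈ Λ, ‖a ξ‖ ^ 2 * Λ.card ≤ 100)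
    {z : ℤ × ℤ → ℂ} (hz : ∀ ξ, ‖z ξ‖ ≤ 1) {δ X ε : ℝ} (hδ : 0 < δ)
    (hsep : ∀ ξ ∈ Λ, ∀ η ∈ Λ, ξ ≠ η → δ ≤ ‖z ξ - z η‖) (hX1 : 1 ≤ X) (hX : 2 / δ ≤ X)
    (hε : 0 ≤ ε) (hsmall : 4 * Λ.card * q * X ^ (200 * q) * ε ≤ 1) {V : Set Tor}
    (hV : ∀ y ∈ V, ∀ k ≤ 200 * q, ‖∑ ξ ∈ Λ, a ξ * chr ξ y * z ξ ^ k‖ ≤ ε) :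
    haarTor.real V ≤ 4 ^ l * (patternCount (2 * l) * ((D : ℝ) ^ 2 / q) ^ l) := by
  classical
  have hΛ : Λ.Nonempty := by
    by_contra h
    rw [Finset.not_nonempty_iff_eq_empty.1 h] at h1
    simp at h1
  have hN : (1 : ℝ) ≤ Λ.card := by exact_mod_cast hΛ.card_pos
  have hq1 : (1 : ℝ) ≤ q := by exact_mod_cast hq
  have hδ2 : 0 ≤ 2 / δ := by positivity
  rcases le_total (200 * q) Λ.card with hqN | hqN
  · obtain ⟨s, hst, hsq⟩ :=
      Finset.exists_subset_card_eq (card_le_card_significant hΛ h1 hflat hqN)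
    have hsΛ : s ⊆ Λ := hst.trans (Finset.filter_subset _ _)
    have hA : ∀ ν ∈ s, 1 ≤ 2 * (Λ.card : ℝ) * ‖a ν‖ := by
      intro ν hν
      have h2 := (Finset.mem_filter.1 (hst hν)).2
      by_contra! h3
      have h4 : ‖a ν‖ ≤ 1 := by nlinarith [norm_nonneg (a ν)]
      nlinarith [norm_nonneg (a ν)]
    have hden : ∀ ν ∈ s, δ ^ (s.erase ν).card ≤ ‖∏ η ∈ s.erase ν, (z ν - z η)‖ := fun ν hν =>
      pow_card_le_norm_prod_sub hδ.le fun η hη => hsep ν (hsΛ hν) η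
        (hsΛ (Finset.mem_of_mem_erase hη)) (Finset.ne_of_mem_erase hη).symm
    set w : ℤ × ℤ → ℤ × ℤ → ℂ := fun ν ξ =>
      a ξ * ((∏ η ∈ s.erase ν, (z ξ - z η)) / ∏ η ∈ s.erase ν, (z ν - z η)) with hw
    have hww : ∀ ν ∈ s, ∀ ν' ∈ s, w ν ν' = if ν = ν' then a ν else 0 := by
      intro ν hν ν' hν'
      simp only [hw]
      split_ifs with h
      · subst h
        rw [div_self, mul_one]
        exact norm_pos_iff.1 ((pow_pos hδ _).trans_le (hden ν hν))
      · have h2 : ∏ η ∈ s.erase ν, (z ν' - z η) = 0 :=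
          Finset.prod_eq_zero (Finset.mem_erase.2 ⟨Ne.symm h, hν'⟩) (sub_self _)
        rw [h2, zero_div, mul_zero]
    obtain ⟨g, γ, hg, horth, hγ⟩ := exists_orthonormal_combinations hsΛ hA w hww
    have htw : ∀ y ∈ V, ∀ ν ∈ s, ‖trig Λ (w ν) y‖ ≤ X ^ (200 * q) * ε := by
      intro y hy ν hν
      have hcq : (s.erase ν).card ≤ 200 * q := by
        have := Finset.card_erase_le (s := s) (a := ν)
        omega
      have e1 : trig Λ (w ν) y =
          (∑ ξ ∈ Λ, a ξ * chr ξ y * ∏ η ∈ s.erase ν, (z ξ - z η)) /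
            ∏ η ∈ s.erase ν, (z ν - z η) := by
        rw [Finset.sum_div]
        refine Finset.sum_congr rfl fun ξ _ => ?_
        simp only [hw]
        ring
      rw [e1, norm_div]
      have e2 := norm_sum_mul_prod_sub_le Λ (s.erase ν) z hz (fun ξ => a ξ * chr ξ y)
        fun k hk => hV y hy k (hk.trans hcq)
      calc _ ≤ 2 ^ (s.erase ν).card * ε / δ ^ (s.erase ν).card :=
            div_le_div₀ (by positivity) e2 (by positivity) (hden ν hν)
        _ = (2 / δ) ^ (s.erase ν).card * ε := by rw [div_pow]; ring
        _ ≤ X ^ (s.erase ν).card * ε := by gcongr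
        _ ≤ _ := by gcongr
    have hs0 : 0 < s.card := hsq ▸ hq
    have hsmallg : ∀ y ∈ V, ∀ j, ‖trig Λ (g j) y‖ ^ 2 ≤ 1 / 2 := by
      intro y hy j
      have e1 : trig Λ (g j) y = ∑ ν ∈ s, γ j ν * trig Λ (w ν) y := by
        simp only [trig, hg, Finset.sum_mul, Finset.mul_sum]
        rw [Finset.sum_comm]
        simp only [mul_assoc]
      have e2 : ‖trig Λ (g j) y‖ ≤ 1 / 2 := by
        rw [e1]
        calc _ ≤ ∑ ν ∈ s, 2 * (Λ.card : ℝ) * (X ^ (200 * q) * ε) := by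
              refine norm_sum_le_of_le _ fun ν hν => ?_
              rw [norm_mul]
              exact mul_le_mul (hγ j ν hν) (htw y hy ν hν) (norm_nonneg _) (by positivity)
          _ = 4 * Λ.card * q * X ^ (200 * q) * ε / 2 := by
              rw [Finset.sum_const, nsmul_eq_mul, hsq]; ring
          _ ≤ _ := by linarith
      nlinarith [norm_nonneg (trig Λ (g j) y)]
    have := measure_forall_norm_trig_le hsym h0 (splits_finCls hs) (card_finCls_le hcard) hs0 horth
      hsmallg
    rwa [hsq] at this
  · have hVe : V = ∅ := by
      refine Set.eq_empty_of_forall_notMem fun y hy => ?_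
      have hco : ∀ ξ ∈ Λ, ‖a ξ‖ ≤ 1 / (4 * Λ.card) := by
        intro ξ hξ
        have h2 := norm_coeff_le_of_separated hz hδ hsep (fun ξ => a ξ * chr ξ y)
          (fun k hk => hV y hy k (hk.trans hqN)) hξ
        rw [norm_mul, norm_chr, mul_one] at h2
        rw [le_div_iff₀ (by positivity)]
        have h3 : (2 / δ) ^ (Λ.card - 1) * ε ≤ X ^ (200 * q) * ε := by
          refine mul_le_mul_of_nonneg_right ?_ hε
          exact (pow_le_pow_left₀ hδ2 hX _).trans (pow_le_pow_right₀ hX1 (by omega))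
        have h4 : 0 ≤ X ^ (200 * q) * ε := by positivity
        calc ‖a ξ‖ * (4 * Λ.card) ≤ X ^ (200 * q) * ε * (4 * Λ.card) := by
              gcongr; exact h2.trans h3
          _ ≤ X ^ (200 * q) * ε * (4 * Λ.card) * q := le_mul_of_one_le_right (by positivity) hq1
          _ ≤ 1 := by linarith
      have h2 : ∑ ξ ∈ Λ, ‖a ξ‖ ^ 2 ≤ ∑ ξ ∈ Λ, 1 / (4 * (Λ.card : ℝ)) := by
        refine Finset.sum_le_sum fun ξ hξ => ?_
        have h3 := hco ξ hξ
        have h4 : 1 / (4 * (Λ.card : ℝ)) ≤ 1 := by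
          rw [div_le_one (by positivity)]; linarith
        nlinarith [norm_nonneg (a ξ)]
      rw [h1, Finset.sum_const, nsmul_eq_mul] at h2
      have h3 : (Λ.card : ℝ) * (1 / (4 * Λ.card)) = 1 / 4 := by field_simp
      linarith
    rw [hVe, measureReal_empty]
    positivity

lemma exp_window_bound {τ A : ℕ} {N ε' : ℝ} (hN0 : 0 ≤ N) (hN : N ≤ Real.exp (4 * τ))
    (hτ : 10 ≤ τ) (hτ1 : 20800 * (τ : ℝ) ^ 8 ≤ Real.exp τ)
    (hτ2 : (τ : ℝ) ^ (15 + A) ≤ Real.exp (τ / 4))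
    (hε' : ε' = ((τ ^ 15 : ℕ) : ℝ) * ((τ : ℝ) ^ (15 + A)) ^ (τ ^ 15) *
      (Real.exp (-(τ : ℝ) ^ 16) + N * Real.exp (-τ) ^ (τ ^ 15)) + N * Real.exp (-τ) ^ (τ ^ 15)) :
    4 * N * ((τ ^ 8 : ℕ) : ℝ) * Real.exp (15 * τ) ^ (200 * τ ^ 8) * ε' ≤ 1 := by
  have hτr : (10 : ℝ) ≤ τ := by exact_mod_cast hτ
  have h1τ : (1 : ℝ) ≤ τ := by linarith
  set U : ℝ := Real.exp (-(τ : ℝ) ^ 16) with hU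
  have hC : Real.exp (-τ) ^ (τ ^ 15) = U := by
    rw [← Real.exp_nat_mul, hU]
    congr 1
    push_cast
    ring
  have hX : Real.exp (15 * τ) ^ (200 * τ ^ 8) = Real.exp (3000 * (τ : ℝ) ^ 9) := by
    rw [← Real.exp_nat_mul]
    congr 1
    push_cast
    ring
  set B : ℝ := Real.exp ((τ : ℝ) ^ 16 / 4 + τ / 4) with hB
  have hMm : ((τ ^ 15 : ℕ) : ℝ) * ((τ : ℝ) ^ (15 + A)) ^ (τ ^ 15) ≤ B := by
    have e1 : ((τ ^ 15 : ℕ) : ℝ) ≤ Real.exp (τ / 4) := by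
      push_cast
      exact (pow_le_pow_right₀ h1τ (by omega)).trans hτ2
    have e2 : ((τ : ℝ) ^ (15 + A)) ^ (τ ^ 15) ≤ Real.exp (τ / 4) ^ (τ ^ 15) :=
      pow_le_pow_left₀ (by positivity) hτ2 _
    rw [← Real.exp_nat_mul] at e2
    calc _ ≤ Real.exp (τ / 4) * Real.exp (((τ ^ 15 : ℕ) : ℝ) * (τ / 4)) := by gcongr
      _ = B := by
        rw [← Real.exp_add, hB]
        congr 1
        push_cast
        ring
  have hB1 : 1 ≤ B := Real.one_le_exp (by positivity)
  have hU0 : 0 < U := Real.exp_pos _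
  set G : ℝ := Real.exp (4 * τ) with hG
  have hG1 : 1 ≤ G := Real.one_le_exp (by positivity)
  rw [hC] at hε'
  have hε'' : ε' ≤ 3 * (B * G * U) := by
    rw [hε']
    have hUG : U ≤ G * U := le_mul_of_one_le_left hU0.le hG1
    have hNG : N * U ≤ G * U := mul_le_mul_of_nonneg_right hN hU0.le
    have hGB : G * U ≤ B * (G * U) := le_mul_of_one_le_left (by positivity) hB1
    calc _ ≤ B * (G * U + G * U) + B * (G * U) :=
          add_le_add (mul_le_mul hMm (add_le_add hUG hNG) (by positivity) (by positivity))
            (hNG.trans hGB)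
      _ = _ := by ring
  have hε0 : 0 ≤ ε' := by rw [hε']; positivity
  rw [hX]
  have h8 : 12 * ((τ ^ 8 : ℕ) : ℝ) ≤ Real.exp τ := by
    push_cast
    have : (0 : ℝ) ≤ (τ : ℝ) ^ 8 := by positivity
    linarith
  calc _ ≤ 4 * G * ((τ ^ 8 : ℕ) : ℝ) * Real.exp (3000 * (τ : ℝ) ^ 9) * (3 * (B * G * U)) := by
        gcongr
    _ = 12 * ((τ ^ 8 : ℕ) : ℝ) * (G * Real.exp (3000 * (τ : ℝ) ^ 9) * (B * G * U)) := by ring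
    _ ≤ Real.exp τ * (G * Real.exp (3000 * (τ : ℝ) ^ 9) * (B * G * U)) := by gcongr
    _ = Real.exp (τ + (4 * τ + 3000 * (τ : ℝ) ^ 9 +
          ((τ : ℝ) ^ 16 / 4 + τ / 4 + 4 * τ + -(τ : ℝ) ^ 16))) := by
        simp only [hG, hB, hU, ← Real.exp_add]
    _ ≤ 1 := by
        refine Real.exp_le_one_iff.2 ?_
        have h9 : (τ : ℝ) ≤ (τ : ℝ) ^ 9 := le_self_pow₀ h1τ (by norm_num)
        have h7 : (10 : ℝ) ^ 7 ≤ (τ : ℝ) ^ 7 := pow_le_pow_left₀ (by norm_num) hτr _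
        have h16 : (τ : ℝ) ^ 16 = (τ : ℝ) ^ 9 * (τ : ℝ) ^ 7 := by ring
        nlinarith

/-- If the frequencies are well separated, a flat trigonometric polynomial is unlikely to be
tiny. -/
lemma measure_norm_trig_le_of_separated {κ : Type*} [DecidableEq κ] {cls : ℤ × ℤ → κ}
    {Λ : Finset (ℤ × ℤ)} {a : ℤ × ℤ → ℂ} {A τ : ℕ} {R : ℝ}
    (hsym : ∀ ξ ∈ Λ, -ξ ∈ Λ) (h0 : (0 : ℤ × ℤ) ∉ Λ) (hs : Splits Λ cls (2 * (2 * A)))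
    (hcard : ∀ σ, (Λ.filter fun ξ => cls ξ = σ).card ≤ τ ^ 3)
    (h1 : ∑ ξ ∈ Λ, ‖a ξ‖ ^ 2 = 1) (hflat : ∀ ξ ∈ Λ, ‖a ξ‖ ^ 2 * Λ.card ≤ 100) (hR : 0 < R)
    (hbd : ∀ ξ ∈ Λ, |(ξ.1 : ℝ)| ≤ R ∧ |(ξ.2 : ℝ)| ≤ R)
    (hsep : ∀ ξ ∈ Λ, ∀ η ∈ Λ, ξ ≠ η → Real.exp (-(4 * τ)) * R ≤ |(ξ.1 : ℝ) - η.1| ∨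
      Real.exp (-(4 * τ)) * R ≤ |(ξ.2 : ℝ) - η.2|)
    (hN : (Λ.card : ℝ) ≤ Real.exp (4 * τ))
    (hτ : 10 ≤ τ) (hτ1 : 20800 * (τ : ℝ) ^ 8 ≤ Real.exp τ)
    (hτ2 : (τ : ℝ) ^ (15 + A) ≤ Real.exp (τ / 4)) :
    haarTor.real {y | ‖trig Λ a y‖ ≤ Real.exp (-(τ : ℝ) ^ 16)} ≤
      (1 + 4 ^ A * patternCount (2 * A)) / (τ : ℝ) ^ A := by
  classical
  have hτr : (10 : ℝ) ≤ τ := by exact_mod_cast hτ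
  have h1τ : (1 : ℝ) ≤ τ := by linarith
  have hτ0 : 0 < τ := by omega
  have hΛ : Λ.Nonempty := by
    by_contra h
    rw [Finset.not_nonempty_iff_eq_empty.1 h] at h1
    simp at h1
  have hN1 : (1 : ℝ) ≤ Λ.card := by exact_mod_cast hΛ.card_pos
  obtain ⟨c, hc0, hc1, hc⟩ := exists_separating_direction (by positivity) hsep
  set ω : ℤ × ℤ → ℝ := fun ξ => 2 * Real.pi * ((ξ.1 : ℝ) + c * ξ.2) with hω
  have hωR : ∀ ξ ∈ Λ, |ω ξ| ≤ 13 * R := by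
    intro ξ hξ
    obtain ⟨e1, e2⟩ := hbd ξ hξ
    have e3 : |(ξ.1 : ℝ) + c * ξ.2| ≤ 2 * R := by
      refine (abs_add_le _ _).trans ?_
      rw [abs_mul, abs_of_nonneg hc0]
      nlinarith [abs_nonneg (ξ.2 : ℝ)]
    rw [hω, abs_mul, abs_of_pos Real.two_pi_pos]
    nlinarith [Real.pi_lt_d2, Real.pi_pos, abs_nonneg ((ξ.1 : ℝ) + c * ξ.2)]
  have hωsep : ∀ ξ ∈ Λ, ∀ η ∈ Λ, ξ ≠ η → Real.exp (-(12 * τ)) * R / 2 ≤ |ω ξ - ω η| := by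
    intro ξ hξ η hη hne
    have e1 := hc ξ hξ η hη hne
    have e2 : ω ξ - ω η = 2 * Real.pi *
        (((ξ.1 : ℝ) + c * ξ.2) - ((η.1 : ℝ) + c * η.2)) := by simp only [hω]; ring
    rw [e2, abs_mul, abs_of_pos Real.two_pi_pos]
    have e3 : Real.exp (-(12 * τ)) * R / 8 ≤
        Real.exp (-(4 * τ)) * R / (8 * (Λ.card : ℝ) ^ 2) := by
      rw [div_le_div_iff₀ (by norm_num) (by positivity)]
      have e4 : (Λ.card : ℝ) ^ 2 ≤ Real.exp (8 * τ) := by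
        have : Real.exp (8 * τ) = Real.exp (4 * τ) ^ 2 := by
          rw [← Real.exp_nat_mul]; congr 1; push_cast; ring
        rw [this]
        gcongr
      have e5 : Real.exp (-(4 * τ : ℝ)) = Real.exp (-(12 * τ)) * Real.exp (8 * τ) := by
        rw [← Real.exp_add]; congr 1; ring
      rw [e5]
      have : 0 ≤ Real.exp (-(12 * τ : ℝ)) * R * 8 := by positivity
      nlinarith
    have e6 := e3.trans e1
    have e7 : 0 ≤ Real.exp (-(12 * τ : ℝ)) * R := by positivity
    nlinarith [Real.pi_gt_three]
  set m : ℕ := τ ^ 15 with hm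
  set P : ℕ := τ ^ A with hP
  set q : ℕ := τ ^ 8 with hq
  have hm0 : 0 < m := by positivity
  have hP0 : 0 < P := by positivity
  have hq0 : 0 < q := by positivity
  have hMr : ((m * P : ℕ) : ℝ) = (τ : ℝ) ^ (15 + A) := by
    rw [hm, hP]; push_cast; rw [pow_add]
  have hM1 : 1 ≤ m * P := Nat.mul_pos hm0 hP0
  have hM0 : (0 : ℝ) < ((m * P : ℕ) : ℝ) := by exact_mod_cast hM1
  set L : ℝ := Real.exp (-τ) / (13 * R) with hL
  have hL0 : 0 < L := by positivity
  set h : ℝ := L / ((m * P : ℕ) : ℝ) with hh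
  have hh0 : 0 < h := by positivity
  have hMh : ((m * P : ℕ) : ℝ) * h = L := by rw [hh]; field_simp
  have hLR : L * (13 * R) = Real.exp (-τ) := by rw [hL]; field_simp
  have hLω : ∀ ξ ∈ Λ, L * |ω ξ| ≤ Real.exp (-τ) := fun ξ hξ =>
    (mul_le_mul_of_nonneg_left (hωR ξ hξ) hL0.le).trans hLR.le
  set E : Set Tor := {y | ‖trig Λ a y‖ ≤ Real.exp (-(τ : ℝ) ^ 16)} with hE
  have hEm : MeasurableSet E :=
    (isClosed_le (continuous_trig Λ a).norm continuous_const).measurableSet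
  have hwin := measure_le_measure_window_add hEm (fun i => lineShift c (i * h)) hm0 hP0
  refine hwin.trans ?_
  set V : Set Tor := {y | m ≤ ((Finset.range (m * P)).filter fun i : ℕ =>
    y + lineShift c (i * h) ∈ E).card} with hV
  have hS : ∑ ξ ∈ Λ, ‖a ξ‖ ≤ Λ.card := by
    have : ∀ ξ ∈ Λ, ‖a ξ‖ ≤ 1 := by
      intro ξ hξ
      have e1 := Finset.single_le_sum (f := fun ξ => ‖a ξ‖ ^ 2) (fun _ _ => sq_nonneg _) hξ
      simp only [h1] at e1
      nlinarith [norm_nonneg (a ξ)]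
    simpa using Finset.sum_le_sum this
  set ε' : ℝ := ((τ ^ 15 : ℕ) : ℝ) * ((τ : ℝ) ^ (15 + A)) ^ (τ ^ 15) *
      (Real.exp (-(τ : ℝ) ^ 16) + Λ.card * Real.exp (-τ) ^ (τ ^ 15)) +
      Λ.card * Real.exp (-τ) ^ (τ ^ 15) with hε'
  have hline : ∀ y ∈ V, ∀ x : ℝ, 0 ≤ x → x ≤ L → ‖trig Λ a (y + lineShift c x)‖ ≤ ε' := by
    intro y hy x hx0 hx
    have := norm_trig_lineShift_le (Λ := Λ) (a := a) (y := y) (c := c) (C := Real.exp (-τ))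
      (ε := Real.exp (-(τ : ℝ) ^ 16)) hM1 hh0 hS (Real.exp_pos _).le
      (fun ξ hξ => by rw [hMh]; exact hLω ξ hξ) (Finset.filter_subset _ _) hy
      (fun i hi => (Finset.mem_filter.1 hi).2) hx0 (hx.trans hMh.ge)
    rwa [hMr] at this
  set n₁ : ℕ := 200 * q with hn₁
  have hn₁r : (0 : ℝ) < n₁ := by
    have : 0 < n₁ := by omega
    exact_mod_cast this
  set t : ℝ := L / n₁ with ht
  have ht0 : 0 < t := by positivity
  have htL : t ≤ L := div_le_self hL0.le (by
    have : 1 ≤ n₁ := by omega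
    exact_mod_cast this)
  set z : ℤ × ℤ → ℂ := fun ξ => Complex.exp (((t * ω ξ : ℝ) : ℂ) * I) with hz
  set δ : ℝ := Real.exp (-(13 * τ)) / (10400 * (τ : ℝ) ^ 8) with hδ
  have hδ0 : 0 < δ := by positivity
  have hzsep : ∀ ξ ∈ Λ, ∀ η ∈ Λ, ξ ≠ η → δ ≤ ‖z ξ - z η‖ := by
    intro ξ hξ η hη hne
    have e0 : |t * ω ξ - t * ω η| = t * |ω ξ - ω η| := by
      rw [← mul_sub, abs_mul, abs_of_pos ht0]
    have e1 : |t * ω ξ - t * ω η| ≤ Real.pi := by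
      rw [e0]
      have e2 : Real.exp (-τ : ℝ) ≤ 1 := Real.exp_le_one_iff.2 (by linarith)
      have e3 : |ω ξ - ω η| ≤ |ω ξ| + |ω η| := abs_sub _ _
      have e4 := hLω ξ hξ
      have e5 := hLω η hη
      have e6 : t * |ω ξ - ω η| ≤ L * (|ω ξ| + |ω η|) :=
        mul_le_mul htL e3 (abs_nonneg _) hL0.le
      linarith [Real.pi_gt_three]
    refine le_trans ?_ (half_abs_sub_le_norm_exp_sub e1)
    rw [e0]
    have e2 : t * (Real.exp (-(12 * τ)) * R / 2) / 2 = δ := by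
      have e3 : Real.exp (-(13 * τ : ℝ)) = Real.exp (-(12 * τ)) * Real.exp (-τ) := by
        rw [← Real.exp_add]; congr 1; ring
      rw [hδ, e3, ht, hL, hn₁, hq]
      push_cast
      field_simp
      norm_num
    rw [← e2]
    gcongr
    exact hωsep ξ hξ η hη hne
  have hX : 2 / δ ≤ Real.exp (15 * τ) := by
    have e1 : 2 / δ = 20800 * (τ : ℝ) ^ 8 * Real.exp (13 * τ) := by
      rw [hδ, Real.exp_neg]
      field_simp
      norm_num
    rw [e1]
    calc _ ≤ Real.exp τ * Real.exp (13 * τ) := by gcongr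
      _ = Real.exp (14 * τ) := by rw [← Real.exp_add]; congr 1; ring
      _ ≤ _ := Real.exp_le_exp.2 (by linarith)
  have hpow : ∀ y ∈ V, ∀ k ≤ 200 * q, ‖∑ ξ ∈ Λ, a ξ * chr ξ y * z ξ ^ k‖ ≤ ε' := by
    intro y hy k hk
    have e1 : (k : ℝ) * t ≤ L := by
      have e2 : (k : ℝ) ≤ n₁ := by exact_mod_cast hk
      calc (k : ℝ) * t ≤ n₁ * t := by gcongr
        _ = L := by rw [ht]; field_simp
    have e3 := hline y hy (k * t) (by positivity) e1
    rw [trig_add_lineShift] at e3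
    refine le_of_eq_of_le ?_ e3
    congr 1
    refine Finset.sum_congr rfl fun ξ _ => ?_
    rw [hz, ← Complex.exp_nat_mul]
    congr 2
    simp only [hω]
    push_cast
    ring
  have hmain := measure_le_of_forall_pow_le (D := τ ^ 3) (l := A) (q := q) hsym h0 hs hcard hq0 h1
    hflat (z := z) (fun ξ => (Complex.norm_exp_ofReal_mul_I _).le) hδ0 hzsep
    (Real.one_le_exp (by positivity)) hX (by positivity)
    (exp_window_bound (by positivity) hN hτ hτ1 hτ2 hε') hpow
  have e1 : ((((τ ^ 3 : ℕ) : ℝ)) ^ 2 / (q : ℝ)) ^ A ≤ 1 / (τ : ℝ) ^ A := by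
    rw [← one_div_pow]
    refine pow_le_pow_left₀ (by positivity) ?_ _
    rw [hq, div_le_div_iff₀ (by positivity) (by positivity)]
    push_cast
    have : (τ : ℝ) ^ 7 ≤ (τ : ℝ) ^ 8 := pow_le_pow_right₀ h1τ (by norm_num)
    linarith [show ((τ : ℝ) ^ 3) ^ 2 * τ = (τ : ℝ) ^ 7 by ring]
  have e2 : (1 : ℝ) / (P : ℝ) = 1 / (τ : ℝ) ^ A := by rw [hP]; push_cast; rfl
  rw [e2, add_div, add_comm]
  refine add_le_add_right (hmain.trans ?_) _
  calc _ ≤ (4 : ℝ) ^ A * (patternCount (2 * A) * (1 / (τ : ℝ) ^ A)) := by gcongr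
    _ = _ := by ring

lemma eventually_exp_bounds (A : ℕ) :
    ∃ τ₀ : ℕ, 10 ≤ τ₀ ∧ ∀ τ ≥ τ₀, 20800 * (τ : ℝ) ^ 8 ≤ Real.exp τ ∧
      (τ : ℝ) ^ (15 + A) ≤ Real.exp (τ / 4) := by
  have h1 : ∀ᶠ x : ℝ in atTop, 20800 * x ^ 8 ≤ Real.exp x := by
    filter_upwards [(Real.tendsto_exp_div_pow_atTop 8).eventually_ge_atTop 20800,
      eventually_gt_atTop 0] with x hx hx0
    rwa [le_div_iff₀ (by positivity)] at hx
  have h2 : ∀ᶠ x : ℝ in atTop, x ^ (15 + A) ≤ Real.exp (x / 4) := by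
    have h3 : Tendsto (fun x : ℝ => x / 4) atTop atTop := tendsto_id.atTop_div_const (by norm_num)
    filter_upwards [((Real.tendsto_exp_div_pow_atTop (15 + A)).comp h3).eventually_ge_atTop
      (4 ^ (15 + A)), eventually_gt_atTop 0] with x hx hx0
    simp only [Function.comp_apply] at hx
    rw [le_div_iff₀ (by positivity), ← mul_pow] at hx
    rwa [mul_div_cancel₀ x (by norm_num : (4 : ℝ) ≠ 0)] at hx
  obtain ⟨τ₀, h⟩ := eventually_atTop.1 ((h1.and h2).natCast_atTop)
  exact ⟨max 10 τ₀, le_max_left _ _, fun τ hτ => h τ ((le_max_right _ _).trans hτ)⟩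

/-- Uniform polynomial decay of the probability that a flat eigenfunction is tiny. -/
lemma exists_measure_abs_le (A : ℕ) :
    ∃ τ₀ : ℕ, 1 ≤ τ₀ ∧ ∃ B : ℝ, 0 ≤ B ∧ ∀ n : ℕ, 0 < n → Good 1 (2 * A) (2 * (2 * A)) n →
      ∀ (a : ℤ × ℤ → ℂ) (F : Tor → ℝ), (∀ y, (F y : ℂ) = trig (latticePts n) a y) →
      (∀ ξ, a (-ξ) = starRingEnd ℂ (a ξ)) → ∑ ξ ∈ latticePts n, ‖a ξ‖ ^ 2 = 1 →
      (∀ ξ ∈ latticePts n, ‖a ξ‖ ^ 2 * (latticePts n).card ≤ 100) →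
      ∀ τ ≥ τ₀, haarTor.real {y | |F y| ≤ Real.exp (-(τ : ℝ) ^ 16)} ≤ B / (τ : ℝ) ^ A := by
  obtain ⟨τ₀, hτ₀, hexp⟩ := eventually_exp_bounds A
  refine ⟨τ₀, by omega, max 40 (1 + 4 ^ A * patternCount (2 * A)), by positivity, ?_⟩
  rintro n hn ⟨K, hK, D, cls₁, cls₂, hc1, hs1, hD, hN, hsep, hc2, hs2⟩ a F hF ha h1 hflat τ hτ
  obtain ⟨hτ1, hτ2⟩ := hexp τ hτ
  have hτr : (1 : ℝ) ≤ τ := by exact_mod_cast (show 1 ≤ τ by omega)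
  have hsym : ∀ ξ ∈ latticePts n, -ξ ∈ latticePts n := by
    intro ξ hξ
    rw [mem_latticePts] at hξ ⊢
    simpa using hξ
  have h0 : (0 : ℤ × ℤ) ∉ latticePts n := by
    rw [mem_latticePts]
    simp only [Prod.fst_zero, Prod.snd_zero]
    omega
  rcases le_total τ K with hτK | hτK
  · have hQ : K ^ (2 * A) = (K ^ A) ^ 2 := by rw [← pow_mul, mul_comm]
    rw [hQ] at hs1 hD
    have hsub : {y | |F y| ≤ Real.exp (-(τ : ℝ) ^ 16)} ⊆ {y | |F y| ≤ 1 / ((τ ^ A : ℕ) : ℝ)} := by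
      intro y hy
      refine le_trans (show |F y| ≤ _ from hy) ?_
      rw [Real.exp_neg, ← one_div]
      push_cast
      refine one_div_le_one_div_of_le (by positivity) ?_
      calc (τ : ℝ) ^ A ≤ (τ : ℝ) ^ (15 + A) := pow_le_pow_right₀ hτr (by omega)
        _ ≤ Real.exp (τ / 4) := hτ2
        _ ≤ _ := by
          refine Real.exp_le_exp.2 ?_
          have := le_self_pow₀ hτr (show 16 ≠ 0 by norm_num)
          linarith
    refine (measureReal_mono hsub).trans ?_
    have := measure_abs_le_of_splits hF hsym h0 ha h1 hflat hs1 hc1 hD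
      (Nat.one_le_pow A τ (by omega)) (Nat.pow_le_pow_left hτK A)
    refine this.trans ?_
    push_cast
    gcongr
    exact le_max_left _ _
  · have hKτ : (K : ℝ) ≤ τ := by exact_mod_cast hτK
    have hset : {y | |F y| ≤ Real.exp (-(τ : ℝ) ^ 16)} =
        {y | ‖trig (latticePts n) a y‖ ≤ Real.exp (-(τ : ℝ) ^ 16)} := by
      ext y
      rw [Set.mem_ofPred_eq, Set.mem_ofPred_eq, ← hF, Complex.norm_real, Real.norm_eq_abs]
    have hn' : (0 : ℝ) < √n := Real.sqrt_pos.2 (by exact_mod_cast hn)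
    have hle : Real.exp (-(4 * τ)) * √n ≤ Real.exp (-(4 * K)) * √n := by gcongr
    rw [hset]
    refine (measure_norm_trig_le_of_separated hsym h0 hs2
      (fun σ => (hc2 σ).trans (Nat.pow_le_pow_left hτK 3)) h1 hflat hn' ?_
      (fun ξ hξ η hη hne => (hsep ξ hξ η hη hne).imp hle.trans hle.trans)
      (hN.trans (by gcongr)) (by omega) hτ1 hτ2).trans ?_
    · intro ξ hξ
      rw [mem_latticePts] at hξ
      have e : (ξ.1 : ℝ) ^ 2 + (ξ.2 : ℝ) ^ 2 = n := by exact_mod_cast hξ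
      exact ⟨Real.abs_le_sqrt (by nlinarith), Real.abs_le_sqrt (by nlinarith)⟩
    · gcongr
      exact le_max_right _ _

lemma IsFlat.norm_sq_mul_card_le {n : ℕ} {a : ℤ × ℤ → ℂ} (h : IsFlat n a) :
    ∀ ξ ∈ latticePts n, ‖a ξ‖ ^ 2 * (latticePts n).card ≤ 100 := by
  intro ξ hξ
  have hN : (0 : ℝ) < (latticePts n).card := by exact_mod_cast Finset.card_pos.2 ⟨ξ, hξ⟩
  have hcont : ContinuousAt (fun ε : ℝ => 100 * ((latticePts n).card : ℝ) ^ (-1 + ε)) 0 := by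
    refine continuousAt_const.mul (ContinuousAt.rpow continuousAt_const (by fun_prop) ?_)
    exact Or.inl hN.ne'
  have hlim : ‖a ξ‖ ^ 2 ≤ 100 * ((latticePts n).card : ℝ) ^ (-1 + 0 : ℝ) :=
    ge_of_tendsto (hcont.tendsto.mono_left (nhdsWithin_le_nhds (s := Set.Ioi 0)))
      (eventually_nhdsWithin_of_forall fun ε hε => h ε hε ξ hξ)
  rw [add_zero, Real.rpow_neg_one, ← div_eq_mul_inv, le_div_iff₀ hN] at hlim
  exact hlim

lemma abs_log_pow_le {p : ℕ} (hp : 1 ≤ p) (τ₀ : ℕ) (x : ℝ) :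
    |Real.log (|x|)| ^ p ≤ p.factorial * x ^ 2 + ((τ₀ : ℝ) ^ 16) ^ p ∨
      ∃ k : ℕ, |x| ≤ Real.exp (-((τ₀ + k : ℕ) : ℝ) ^ 16) ∧
        |Real.log (|x|)| ^ p ≤ (((τ₀ + k + 1 : ℕ) : ℝ) ^ 16) ^ p := by
  rcases eq_or_ne x 0 with rfl | hx
  · left
    rw [abs_zero, Real.log_zero, abs_zero, zero_pow (by omega)]
    positivity
  have hx0 : 0 < |x| := abs_pos.2 hx
  rcases le_total 1 |x| with h1 | h1
  · left
    have hl : 0 ≤ Real.log |x| := Real.log_nonneg h1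
    rw [abs_of_nonneg hl]
    have h2 := Real.pow_div_factorial_le_exp _ hl p
    rw [Real.exp_log hx0, div_le_iff₀ (by positivity)] at h2
    have h3 : |x| ≤ x ^ 2 := by rw [← sq_abs]; nlinarith
    have h4 : |x| * p.factorial ≤ p.factorial * x ^ 2 := by
      rw [mul_comm]
      gcongr
    have : 0 ≤ ((τ₀ : ℝ) ^ 16) ^ p := by positivity
    linarith
  · set u : ℝ := |Real.log (|x|)| with hu
    have hxu : |x| = Real.exp (-u) := by
      rw [hu, abs_of_nonpos (Real.log_nonpos hx0.le h1), neg_neg, Real.exp_log hx0]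
    have hu0 : 0 ≤ u := abs_nonneg _
    have hex : ∃ σ : ℕ, u ≤ (σ : ℝ) ^ 16 := by
      obtain ⟨σ, hσ⟩ := exists_nat_ge (max u 1)
      exact ⟨σ, ((le_max_left _ _).trans hσ).trans
        (le_self_pow₀ ((le_max_right _ _).trans hσ) (by norm_num))⟩
    classical
    set σ := Nat.find hex with hσ
    have hσ1 : u ≤ (σ : ℝ) ^ 16 := Nat.find_spec hex
    rcases le_or_gt σ τ₀ with h2 | h2
    · left
      have h3 : u ^ p ≤ ((τ₀ : ℝ) ^ 16) ^ p := by
        refine pow_le_pow_left₀ hu0 (hσ1.trans ?_) _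
        gcongr
      have : 0 ≤ (p.factorial : ℝ) * x ^ 2 := by positivity
      linarith
    · right
      obtain ⟨k, hk⟩ : ∃ k, σ = τ₀ + k + 1 := ⟨σ - τ₀ - 1, by omega⟩
      have h3 : ¬ u ≤ ((τ₀ + k : ℕ) : ℝ) ^ 16 := Nat.find_min hex (by omega)
      refine ⟨k, ?_, ?_⟩
      · rw [hxu]
        exact Real.exp_le_exp.2 (neg_le_neg (not_le.1 h3).le)
      · rw [hk] at hσ1
        exact pow_le_pow_left₀ hu0 hσ1 _

/-- Polynomial decay of the probability of tiny values gives integrability of powers of the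
logarithm. -/
lemma exists_lintegral_abs_log_pow_le {p : ℕ} (hp : 1 ≤ p) {τ₀ : ℕ} (hτ₀ : 1 ≤ τ₀) {B : ℝ}
    (hB : 0 ≤ B) :
    ∃ C : ℝ, 0 < C ∧ ∀ F : Tor → ℝ, Continuous F → ∫ y, F y ^ 2 ∂haarTor = 1 →
      (∀ τ ≥ τ₀, haarTor.real {y | |F y| ≤ Real.exp (-(τ : ℝ) ^ 16)} ≤
        B / (τ : ℝ) ^ (16 * p + 2)) →
      ∫⁻ y, ENNReal.ofReal (|Real.log (|F y|)| ^ p) ∂haarTor ≤ ENNReal.ofReal C := by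
  set r : ℕ → ℝ := fun k => (2 ^ 16) ^ p * B * (1 / ((k + 1 : ℕ) : ℝ) ^ 2) with hr
  have hr0 : ∀ k, 0 ≤ r k := fun k => by positivity
  have hrs : Summable r :=
    ((summable_nat_add_iff 1).2 (Real.summable_one_div_nat_pow.2 one_lt_two)).mul_left _
  refine ⟨p.factorial + ((τ₀ : ℝ) ^ 16) ^ p + ∑' k, r k, ?_, ?_⟩
  · have : 0 ≤ ∑' k, r k := tsum_nonneg hr0
    positivity
  intro F hF h1 htail
  set E : ℕ → Set Tor := fun k => {y | |F y| ≤ Real.exp (-((τ₀ + k : ℕ) : ℝ) ^ 16)} with hE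
  have hEm : ∀ k, MeasurableSet (E k) := fun k =>
    (isClosed_le hF.abs continuous_const).measurableSet
  set s : ℕ → ℝ := fun k => (((τ₀ + k + 1 : ℕ) : ℝ) ^ 16) ^ p with hs
  have hpt : ∀ y, ENNReal.ofReal (|Real.log (|F y|)| ^ p) ≤
      ENNReal.ofReal (p.factorial * F y ^ 2 + ((τ₀ : ℝ) ^ 16) ^ p) +
        ∑' k, (E k).indicator (fun _ => ENNReal.ofReal (s k)) y := by
    intro y
    rcases abs_log_pow_le hp τ₀ (F y) with h | ⟨k, hk, h⟩
    · exact (ENNReal.ofReal_le_ofReal h).trans le_self_add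
    · refine le_trans ?_ le_add_self
      refine (ENNReal.ofReal_le_ofReal h).trans (le_trans ?_ (ENNReal.le_tsum k))
      rw [Set.indicator_of_mem (show y ∈ E k from hk)]
  have hFi : Integrable (fun y => (p.factorial : ℝ) * F y ^ 2 + ((τ₀ : ℝ) ^ 16) ^ p) haarTor :=
    integrable_haarTor (by fun_prop)
  have hmain : ∫⁻ y, ENNReal.ofReal (p.factorial * F y ^ 2 + ((τ₀ : ℝ) ^ 16) ^ p) ∂haarTor =
      ENNReal.ofReal (p.factorial + ((τ₀ : ℝ) ^ 16) ^ p) := by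
    rw [← ofReal_integral_eq_lintegral_ofReal hFi
      (Eventually.of_forall fun y => by positivity)]
    congr 1
    rw [integral_add (f := fun y => (p.factorial : ℝ) * F y ^ 2)
      (g := fun _ => ((τ₀ : ℝ) ^ 16) ^ p) (integrable_haarTor (by fun_prop))
      (integrable_const _), integral_const_mul, h1]
    simp
  have hterm : ∀ k, ENNReal.ofReal (s k) * haarTor (E k) ≤ ENNReal.ofReal (r k) := by
    intro k
    rw [← ofReal_measureReal (measure_ne_top _ _), ← ENNReal.ofReal_mul (by positivity)]
    refine ENNReal.ofReal_le_ofReal ?_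
    have hT : (1 : ℝ) ≤ ((τ₀ + k : ℕ) : ℝ) := by exact_mod_cast (show 1 ≤ τ₀ + k by omega)
    have h2 := htail (τ₀ + k) (by omega)
    set T : ℝ := ((τ₀ + k : ℕ) : ℝ) with hTdef
    have h3 : s k ≤ (2 ^ 16) ^ p * (T ^ 16) ^ p := by
      rw [← mul_pow, ← mul_pow]
      refine pow_le_pow_left₀ (by positivity) (pow_le_pow_left₀ (by positivity) ?_ _) _
      rw [Nat.cast_add_one, ← hTdef]
      linarith
    have h4 : ((k + 1 : ℕ) : ℝ) ≤ T := by
      rw [hTdef]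
      exact_mod_cast (show k + 1 ≤ τ₀ + k by omega)
    calc s k * haarTor.real (E k) ≤
          ((2 ^ 16) ^ p * (T ^ 16) ^ p) * (B / T ^ (16 * p + 2)) := by gcongr
      _ = (2 ^ 16) ^ p * B * (1 / T ^ 2) := by
          rw [pow_add, pow_mul]
          field_simp
      _ ≤ _ := by
          simp only [hr]
          gcongr
  calc _ ≤ ∫⁻ y, (ENNReal.ofReal (p.factorial * F y ^ 2 + ((τ₀ : ℝ) ^ 16) ^ p) +
        ∑' k, (E k).indicator (fun _ => ENNReal.ofReal (s k)) y) ∂haarTor := lintegral_mono hpt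
    _ = ENNReal.ofReal (p.factorial + ((τ₀ : ℝ) ^ 16) ^ p) +
        ∑' k, ENNReal.ofReal (s k) * haarTor (E k) := by
      rw [lintegral_add_left (by fun_prop), hmain, lintegral_tsum fun k =>
        (measurable_const.indicator (hEm k)).aemeasurable]
      simp_rw [lintegral_indicator_const (hEm _)]
    _ ≤ ENNReal.ofReal (p.factorial + ((τ₀ : ℝ) ^ 16) ^ p) + ∑' k, ENNReal.ofReal (r k) := by
      gcongr with k
      exact hterm k
    _ = _ := by
      rw [← ENNReal.ofReal_tsum_of_nonneg hr0 hrs,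
        ← ENNReal.ofReal_add (by positivity) (tsum_nonneg hr0)]

/-- The quotient map from the plane to the torus. -/
def toTor (x : E2) : Tor := ((x 0 : AddCircle (1 : ℝ)), (x 1 : AddCircle (1 : ℝ)))

lemma lintegral_Tdom_comp_toTor {G : Tor → ℝ≥0∞} (hG : Measurable G) :
    ∫⁻ x in Tdom, G (toTor x) = ∫⁻ y, G y ∂haarTor := by
  have he : MeasurePreserving (fun x : E2 => ((x 0 : ℝ), (x 1 : ℝ))) volume volume :=
    (volume_preserving_finTwoArrow ℝ).comp
      (EuclideanSpace.volume_preserving_symm_measurableEquiv_toLp (Fin 2))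
  have hq : MeasurePreserving (fun t : ℝ => (t : AddCircle (1 : ℝ)))
      (volume.restrict (Set.Icc 0 1)) AddCircle.haarAddCircle := by
    have h := AddCircle.measurePreserving_mk 1 0
    rw [AddCircle.volume_eq_smul_haarAddCircle, ENNReal.ofReal_one, one_smul, zero_add,
      Measure.restrict_congr_set Ioc_ae_eq_Icc] at h
    exact h
  have hqq := hq.prod hq
  rw [Measure.prod_restrict] at hqq
  have hsq : MeasurableSet (Set.Icc (0 : ℝ) 1 ×ˢ Set.Icc (0 : ℝ) 1) :=
    measurableSet_Icc.prod measurableSet_Icc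
  exact (hqq.comp (he.restrict_preimage hsq)).lintegral_comp hG

lemma chr_toTor (ξ : ℤ × ℤ) (x : E2) :
    chr ξ (toTor x) = Complex.exp (2 * (Real.pi : ℂ) * Complex.I *
      ((((ξ.1 : ℝ) * x 0 + (ξ.2 : ℝ) * x 1 : ℝ)) : ℂ)) := by
  simp only [chr, toTor, fourier_coe_apply]
  rw [← Complex.exp_add]
  congr 1
  push_cast
  ring

/-- Proposition: log-integrability of flat toral eigenfunctions:
arbitrarily large powers of `log |f|` are integrable over `𝕋²`, uniformly along a
density one subsequence of eigenvalues. -/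
theorem log_integrability (p : ℕ) (hp : 1 ≤ p) :
    ∃ S' : Set ℕ, DensityOne S' ∧ ∃ C : ℝ, 0 < C ∧
      ∀ lam ∈ S', ∀ (a : ℤ × ℤ → ℂ) (f : E2 → ℝ),
        IsEigenfunction lam a f → IsFlat lam a →
        ∫⁻ x in Tdom, ENNReal.ofReal (|Real.log (_root_.abs (f x))| ^ p) ≤ ENNReal.ofReal C := by
  obtain ⟨τ₀, hτ₀, B, hB, htail⟩ := exists_measure_abs_le (16 * p + 2)
  obtain ⟨C, hC, hlog⟩ := exists_lintegral_abs_log_pow_le hp hτ₀ hB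
  refine ⟨_, densityOne_good 1 (2 * (16 * p + 2)) (2 * (2 * (16 * p + 2))), C, hC, ?_⟩
  rintro n ⟨hn, hgood⟩ a f ⟨-, ha, h1, hf⟩ hflat
  have hsym : ∀ ξ ∈ latticePts n, -ξ ∈ latticePts n := by
    intro ξ hξ
    rw [mem_latticePts] at hξ ⊢
    simpa using hξ
  set F : Tor → ℝ := fun y => (trig (latticePts n) a y).re with hF
  have hFt : ∀ y, (F y : ℂ) = trig (latticePts n) a y := fun y =>
    Complex.conj_eq_iff_re.1 (conj_trig hsym ha y)
  have hFc : Continuous F := Complex.continuous_re.comp (continuous_trig _ _)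
  have hfF : ∀ x, f x = F (toTor x) := by
    intro x
    apply Complex.ofReal_injective
    rw [hf, hFt, trig]
    simp_rw [chr_toTor]
  have hF2 : ∫ y, F y ^ 2 ∂haarTor = 1 := by
    refine Eq.trans ?_ ((integral_norm_trig_sq _ a).trans h1)
    refine integral_congr_ae (Eventually.of_forall fun y => ?_)
    simp only [← hFt, Complex.norm_real, Real.norm_eq_abs, sq_abs]
  simp_rw [hfF]
  rw [lintegral_Tdom_comp_toTor
    (G := fun y => ENNReal.ofReal (|Real.log (_root_.abs (F y))| ^ p)) (by fun_prop)]
  exact hlog F hFc hF2 (htail n hn.1 hgood a F hFt ha h1 hflat.norm_sq_mul_card_le)
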